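/- arXiv:0711.3155 — 3 statements merged into one kernel-verified Lean document; each statement's English description precedes it below -/
import Mathlib

section
/- Zero mass case: Assume V satisfies assumption (A), m = 0, and E lies in region III, i.e. V⁻ < E < V⁺. Suppose V(x) − E has a unique zero t₀(E), which is simple. Then there exists a classical analytic symbol φ(h) of non-negative order such that s₁₁ = s₂₂ = (1 + hφ(h))·exp(iT₀(E)/h), s₂₁ = O(h), and s₁₂ = O(h), where T₀(E) = (1/c)·(∫_{−∞}^{t₀(E)} (−V(t) + V⁻) dt − ∫_{t₀(E)}^{+∞} (V(t) − V⁺) dt + t₀(E)(V⁺ − V⁻)). -/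
open Complex Filter Topology MeasureTheory Set

noncomputable section

/-- The sector `𝒮 = {x ∈ ℂ : |Im x| < ε|Re x| + η}`. -/
def Sector (ε η : ℝ) : Set ℂ := {x : ℂ | |x.im| < ε * |x.re| + η}

/-- Assumption (A): `V` is real on the real axis, analytic in a sector `𝒮`
around the real axis, and tends to constants `V^±` at `±∞` in `𝒮` at rate
`⟨x⟩^{-δ}`, `δ > 1`, with `V⁻ < V⁺`. -/
structure AssumptionA (V : ℂ → ℂ) (Vm Vp : ℝ) : Prop where
  lt : Vm < Vp
  real_on_real : ∀ x : ℝ, (V x).im = 0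
  sector : ∃ ε > (0 : ℝ), ∃ η > (0 : ℝ), ∃ δ > (1 : ℝ),
    AnalyticOnNhd ℂ V (Sector ε η) ∧
    (∃ C R : ℝ, ∀ x ∈ Sector ε η, R ≤ x.re →
      ‖V x - (Vp : ℂ)‖ ≤ C * (1 + ‖x‖ ^ 2) ^ (-(δ / 2))) ∧
    (∃ C R : ℝ, ∀ x ∈ Sector ε η, x.re ≤ -R →
      ‖V x - (Vm : ℂ)‖ ≤ C * (1 + ‖x‖ ^ 2) ^ (-(δ / 2)))

/-- `u = (u₁,u₂)` solves the one-dimensional Dirac equation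
`(-i h c σ₁ d/dx + m c² σ₃ + V(x) I₂) u = E u` on `ℝ`. -/
structure IsDiracSolution (hp m c : ℝ) (V : ℂ → ℂ) (E : ℝ) (u : ℝ → ℂ × ℂ) : Prop where
  diff1 : Differentiable ℝ fun x : ℝ => (u x).1
  diff2 : Differentiable ℝ fun x : ℝ => (u x).2
  eq1 : ∀ x : ℝ,
    -Complex.I * (hp : ℂ) * (c : ℂ) * deriv (fun y : ℝ => (u y).2) x
      + ((m : ℂ) * (c : ℂ) ^ 2 + V x) * (u x).1 = (E : ℂ) * (u x).1
  eq2 : ∀ x : ℝ,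
    -Complex.I * (hp : ℂ) * (c : ℂ) * deriv (fun y : ℝ => (u y).1) x
      + (-((m : ℂ) * (c : ℂ) ^ 2) + V x) * (u x).2 = (E : ℂ) * (u x).2

/-- `Φ(λ) = sgn(λ) √(λ² − m²c⁴)`. -/
def PhiF (m c lam : ℝ) : ℝ := Real.sign lam * Real.sqrt (lam ^ 2 - m ^ 2 * c ^ 4)

/-- `A(λ) = ((λ + mc²)/(λ − mc²))^{1/4}`. -/
def AmpF (m c lam : ℝ) : ℝ := ((lam + m * c ^ 2) / (lam - m * c ^ 2)) ^ ((1 : ℝ) / 4)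

/-- `u(x)` behaves exactly like `e^{θ x} v` along the filter `l`,
i.e. `u(x) e^{-θ x} → v`. -/
def JostAsymp (u : ℝ → ℂ × ℂ) (θ : ℂ) (v : ℂ × ℂ) (l : Filter ℝ) : Prop :=
  Tendsto (fun x : ℝ => (u x).1 * Complex.exp (-(θ * (x : ℂ)))) l (𝓝 v.1) ∧
  Tendsto (fun x : ℝ => (u x).2 * Complex.exp (-(θ * (x : ℂ)))) l (𝓝 v.2)

/-- `u` behaves exactly like `exp(s (i/(hc)) Φ(E−V₀) x) · (A(E−V₀), s' A(E−V₀)⁻¹)`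
along `l`.  The Jost solutions `ω_in^±` correspond to `s = s' = ∓1`, `l = at±∞`,
and `ω_out^±` to `s = s' = ±1`, `l = at±∞`. -/
def JostCond (hp m c E V0 s s' : ℝ) (l : Filter ℝ) (u : ℝ → ℂ × ℂ) : Prop :=
  JostAsymp u ((s : ℂ) * Complex.I / ((hp : ℂ) * (c : ℂ)) * ((PhiF m c (E - V0) : ℝ) : ℂ))
    (((AmpF m c (E - V0) : ℝ) : ℂ), (s' : ℂ) * (((AmpF m c (E - V0) : ℝ) : ℂ))⁻¹) l

/-- `B^± = ((mc² + E − V^±)/(mc² − E + V^±))^{1/4}`. -/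
def Bsym (m c E W : ℝ) : ℝ := ((m * c ^ 2 + E - W) / (m * c ^ 2 - E + W)) ^ ((1 : ℝ) / 4)

/-- The decaying Jost solution `ω_d^±` (for `s = ±1`, `l = at±∞`):
`ω_d^± ~ exp(∓ (1/(hc)) √(m²c⁴ − (V^± − E)²) x) (∓ i B^±, (B^±)⁻¹)`. -/
def DecayCond (hp m c E W s : ℝ) (l : Filter ℝ) (u : ℝ → ℂ × ℂ) : Prop :=
  JostAsymp u (-(s : ℂ) * ((Real.sqrt (m ^ 2 * c ^ 4 - (W - E) ^ 2) : ℝ) : ℂ) / ((hp : ℂ) * (c : ℂ)))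
    (-(s : ℂ) * Complex.I * ((Bsym m c E W : ℝ) : ℂ), (((Bsym m c E W : ℝ) : ℂ))⁻¹) l

/-- The defining relation `(ω_in^−, ω_in^+) = (ω_out^+, ω_out^−) · 𝕊` of the
scattering matrix. -/
def ScatRel (ωinm ωinp ωoutp ωoutm : ℝ → ℂ × ℂ) (S : Matrix (Fin 2) (Fin 2) ℂ) : Prop :=
  (∀ x : ℝ, ωinm x = S 0 0 • ωoutp x + S 1 0 • ωoutm x) ∧
  (∀ x : ℝ, ωinp x = S 0 1 • ωoutp x + S 1 1 • ωoutm x)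

/-- A classical analytic symbol (of non-negative order `mo`) in the semiclassical
parameter `h`: there are coefficients `a j` with `‖a j‖ ≤ C^{j+1} j^j` such that
`f(h) − ∑_{0 ≤ j ≤ h⁻¹/(e C₁)} a j h^{mo+j}` is `O(e^{-ρ/h})` for every `C₁ > C`. -/
def IsCAS (f : ℝ → ℂ) : Prop :=
  ∃ (mo : ℕ) (a : ℕ → ℂ) (C : ℝ), 0 < C ∧
    (∀ j : ℕ, ‖a j‖ ≤ C ^ (j + 1) * (j : ℝ) ^ j) ∧
    ∀ C₁ : ℝ, C < C₁ → ∃ ρ > (0 : ℝ), ∃ M : ℝ,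
      ∀ h : ℝ, 0 < h → h < 1 →
        ‖f h - ∑ j ∈ Finset.range (⌊1 / (h * Real.exp 1 * C₁)⌋₊ + 1), a j * (h : ℂ) ^ (mo + j)‖
          ≤ M * Real.exp (-ρ / h)

/-- `E^± = (−m²c⁴ + (V^± − E)²)/c²`. -/
def Esym (m c E W : ℝ) : ℝ := (-(m ^ 2 * c ^ 4) + (W - E) ^ 2) / c ^ 2

/-- `Q^±(t,E) = √((−m²c⁴ + (V(t) − E)²)/c²) − √(E^±)` (here `W = V^±`). -/
def Qsym (m c E W : ℝ) (V : ℂ → ℂ) (t : ℝ) : ℝ :=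
  Real.sqrt ((-(m ^ 2 * c ^ 4) + ((V t).re - E) ^ 2) / c ^ 2) - Real.sqrt (Esym m c E W)

/-- `Q₋^±(t,E) = √((m²c⁴ − (V(t) − E)²)/c²) − √(−E^±)` (here `W = V^±`). -/
def Qminus (m c E W : ℝ) (V : ℂ → ℂ) (t : ℝ) : ℝ :=
  Real.sqrt ((m ^ 2 * c ^ 4 - ((V t).re - E) ^ 2) / c ^ 2) - Real.sqrt (-(Esym m c E W))

/-- The classical action `S(E)` between the turning points. -/
def SAct (m c E : ℝ) (V : ℂ → ℂ) (t₁ t₂ : ℝ) : ℝ :=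
  ∫ t in t₁..t₂, Real.sqrt ((m ^ 2 * c ^ 4 - ((V t).re - E) ^ 2) / c ^ 2)

/-- The phase `T(E)`. -/
def TPhase (m c E Vm Vp : ℝ) (V : ℂ → ℂ) (t₁ t₂ : ℝ) : ℝ :=
  (∫ t in Set.Iic t₁, Qsym m c E Vm V t) - (∫ t in Set.Ici t₂, Qsym m c E Vp V t)
    + t₁ * Real.sqrt (Esym m c E Vm) + t₂ * Real.sqrt (Esym m c E Vp)

/-- The Wronskian of two vectors in `ℂ²`. -/
def Wron (u v : ℂ × ℂ) : ℂ := u.1 * v.2 - u.2 * v.1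

end

/-- The sector contains the real axis. -/
theorem ofReal_mem_sector {ε η : ℝ} (hε : 0 < ε) (hη : 0 < η) (x : ℝ) :
    (x : ℂ) ∈ Sector ε η := by
  simp only [Sector, mem_ofPred_eq, ofReal_im, ofReal_re, abs_zero]
  positivity

/-- Under assumption (A), `V` is continuous on the real axis. -/
theorem AssumptionA.continuous_re {V : ℂ → ℂ} {Vm Vp : ℝ} (hA : AssumptionA V Vm Vp) :
    Continuous fun x : ℝ => (V x).re := by
  obtain ⟨ε, hε, η, hη, -, -, han, -⟩ := hA.sector
  refine Complex.continuous_re.comp (continuous_iff_continuousAt.2 fun x => ?_)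
  exact (han x (ofReal_mem_sector hε hη x)).continuousAt.comp (f := fun x : ℝ => (x : ℂ))
    continuous_ofReal.continuousAt

theorem integrable_one_add_sq_rpow {δ : ℝ} (hδ : 1 < δ) (C : ℝ) :
    Integrable fun x : ℝ => C * (1 + ‖(x : ℂ)‖ ^ 2) ^ (-(δ / 2)) := by
  have h := integrable_rpow_neg_one_add_norm_sq (E := ℝ) (μ := volume) (r := δ) (by simpa using hδ)
  simpa [neg_div] using h.const_mul C

/-- Under assumption (A), `V - V⁺` is integrable near `+∞`. -/
theorem AssumptionA.integrableOn_Ici {V : ℂ → ℂ} {Vm Vp : ℝ} (hA : AssumptionA V Vm Vp) (t : ℝ) :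
    IntegrableOn (fun x : ℝ => (V x).re - Vp) (Ici t) := by
  have hcont : Continuous fun x : ℝ => (V x).re - Vp := hA.continuous_re.sub continuous_const
  obtain ⟨ε, hε, η, hη, δ, hδ, -, ⟨C, R, hb⟩, -⟩ := hA.sector
  have htail : IntegrableOn (fun x : ℝ => (V x).re - Vp) (Ici R) := by
    refine (integrable_one_add_sq_rpow hδ C).integrableOn.mono'
      hcont.aestronglyMeasurable.restrict ?_
    filter_upwards [ae_restrict_mem measurableSet_Ici] with x hx
    refine le_trans ?_ (hb x (ofReal_mem_sector hε hη x) (by simpa using hx))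
    simpa using abs_re_le_norm (V x - Vp)
  refine ((hcont.integrableOn_Icc (a := t) (b := R)).union htail).mono_set fun x hx => ?_
  rcases le_total x R with h | h
  · exact Or.inl ⟨hx, h⟩
  · exact Or.inr h

/-- Under assumption (A), `V⁻ - V` is integrable near `-∞`. -/
theorem AssumptionA.integrableOn_Iic {V : ℂ → ℂ} {Vm Vp : ℝ} (hA : AssumptionA V Vm Vp) (t : ℝ) :
    IntegrableOn (fun x : ℝ => -(V x).re + Vm) (Iic t) := by
  have hcont : Continuous fun x : ℝ => -(V x).re + Vm := hA.continuous_re.neg.add continuous_const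
  obtain ⟨ε, hε, η, hη, δ, hδ, -, -, ⟨C, R, hb⟩⟩ := hA.sector
  have htail : IntegrableOn (fun x : ℝ => -(V x).re + Vm) (Iic (-R)) := by
    refine (integrable_one_add_sq_rpow hδ C).integrableOn.mono'
      hcont.aestronglyMeasurable.restrict ?_
    filter_upwards [ae_restrict_mem measurableSet_Iic] with x hx
    refine le_trans ?_ (hb x (ofReal_mem_sector hε hη x) (by simpa using hx))
    rw [Real.norm_eq_abs, ← abs_neg]
    refine le_of_eq_of_le (congrArg abs ?_) (abs_re_le_norm (V x - Vm))
    simp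
    ring
  refine ((hcont.integrableOn_Icc (a := -R) (b := t)).union htail).mono_set fun x hx => ?_
  rcases le_total x (-R) with h | h
  · exact Or.inr h
  · exact Or.inl ⟨h, hx⟩

/-- The primitive `∫_{t}^x (E - V)`, renormalised at `+∞`. -/
theorem AssumptionA.tendsto_action_atTop {V : ℂ → ℂ} {Vm Vp : ℝ} (hA : AssumptionA V Vm Vp)
    (E t : ℝ) :
    Tendsto (fun x : ℝ => (∫ y in t..x, (E - (V y).re)) - (E - Vp) * x) atTop
      (𝓝 (-(∫ y in Ici t, ((V y).re - Vp)) - (E - Vp) * t)) := by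
  have hcont : Continuous fun x : ℝ => (V x).re - Vp := hA.continuous_re.sub continuous_const
  have h := intervalIntegral_tendsto_integral_Ioi t
    ((hA.integrableOn_Ici t).mono_set Ioi_subset_Ici_self) tendsto_id
  rw [← integral_Ici_eq_integral_Ioi] at h
  refine (h.neg.sub_const ((E - Vp) * t)).congr fun x => ?_
  have hsub : ∫ y in t..x, (E - (V y).re) = ∫ y in t..x, ((E - Vp) - ((V y).re - Vp)) := by
    congr 1; ext y; ring
  rw [hsub, intervalIntegral.integral_sub (by simp) (hcont.intervalIntegrable _ _)]
  simp
  ring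

/-- The primitive `∫_{t}^x (E - V)`, renormalised at `-∞`. -/
theorem AssumptionA.tendsto_action_atBot {V : ℂ → ℂ} {Vm Vp : ℝ} (hA : AssumptionA V Vm Vp)
    (E t : ℝ) :
    Tendsto (fun x : ℝ => (∫ y in t..x, (E - (V y).re)) - (E - Vm) * x) atBot
      (𝓝 (-(∫ y in Iic t, (-(V y).re + Vm)) - (E - Vm) * t)) := by
  have hcont : Continuous fun x : ℝ => -(V x).re + Vm := hA.continuous_re.neg.add continuous_const
  have h := intervalIntegral_tendsto_integral_Iic t (hA.integrableOn_Iic t) tendsto_id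
  refine (h.neg.sub_const ((E - Vm) * t)).congr fun x => ?_
  have hsub : ∫ y in t..x, (E - (V y).re) = ∫ y in t..x, ((E - Vm) + (-(V y).re + Vm)) := by
    congr 1; ext y; ring
  rw [hsub, intervalIntegral.integral_add (by simp) (hcont.intervalIntegrable _ _),
    intervalIntegral.integral_symm]
  simp
  ring

/-- Solutions of the scalar equation `w' = k G' w`. -/
theorem exists_eq_mul_exp {w : ℝ → ℂ} {G g : ℝ → ℝ} {k : ℂ}
    (hG : ∀ x, HasDerivAt G (g x) x) (hw : ∀ x, HasDerivAt w (k * g x * w x) x) :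
    ∃ a : ℂ, ∀ x, w x = a * exp (k * G x) := by
  have hd : ∀ x, HasDerivAt (fun x => w x * exp (-(k * G x))) 0 x := fun x => by
    refine ((hw x).mul (((hG x).ofReal_comp.const_mul k).neg.cexp)).congr_deriv ?_
    simp only [Pi.neg_apply]
    ring
  have hconst := is_const_of_deriv_eq_zero (fun x => (hd x).differentiableAt)
    (fun x => (hd x).deriv)
  refine ⟨w 0 * exp (-(k * G 0)), fun x => ?_⟩
  rw [hconst 0 x, mul_assoc, ← exp_add]
  simp

/-- A solution of `w' = k G' w` is determined by its leading behaviour `v e^{kλx}` along `l`,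
when `G(x) - λx → L`. -/
theorem eq_mul_exp_of_tendsto {w : ℝ → ℂ} {G g : ℝ → ℝ} {k v : ℂ} {lam L : ℝ} {l : Filter ℝ}
    [l.NeBot] (hG : ∀ x, HasDerivAt G (g x) x) (hw : ∀ x, HasDerivAt w (k * g x * w x) x)
    (hL : Tendsto (fun x => G x - lam * x) l (𝓝 L))
    (hv : Tendsto (fun x : ℝ => w x * exp (-(k * lam * x))) l (𝓝 v)) (x : ℝ) :
    w x = v * exp (-(k * L)) * exp (k * G x) := by
  obtain ⟨a, ha⟩ := exists_eq_mul_exp hG hw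
  have hlim : Tendsto (fun x : ℝ => w x * exp (-(k * lam * x))) l (𝓝 (a * exp (k * L))) := by
    have hL' := (continuous_exp.tendsto _).comp
      (((continuous_ofReal.tendsto L).comp hL).const_mul k)
    refine (hL'.const_mul a).congr fun x => ?_
    rw [ha, mul_assoc, ← exp_add]
    simp only [Function.comp, ofReal_sub, ofReal_mul]
    congr 2
    ring
  rw [tendsto_nhds_unique hv hlim, mul_assoc a, ← exp_add, ha]
  simp

/-- A solution of `w' = k G' w`, with `k` purely imaginary, that tends to zero along `l` up to an
oscillating factor vanishes. -/
theorem eq_zero_of_tendsto {w : ℝ → ℂ} {G g : ℝ → ℝ} {k θ : ℂ} {l : Filter ℝ}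
    [l.NeBot] (hG : ∀ x, HasDerivAt G (g x) x) (hw : ∀ x, HasDerivAt w (k * g x * w x) x)
    (hk : k.re = 0) (hθ : θ.re = 0)
    (hv : Tendsto (fun x : ℝ => w x * exp (-(θ * x))) l (𝓝 0)) (x : ℝ) : w x = 0 := by
  obtain ⟨a, ha⟩ := exists_eq_mul_exp hG hw
  have hlim : Tendsto (fun _ : ℝ => ‖a‖) l (𝓝 0) := by
    refine (tendsto_zero_iff_norm_tendsto_zero.1 hv).congr fun x => ?_
    simp [ha, norm_exp, hk, hθ]
  have ha0 : a = 0 := norm_eq_zero.1 (tendsto_nhds_unique tendsto_const_nhds hlim)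
  simp [ha, ha0]

/-- For zero mass, `u₁ + u₂` satisfies a scalar transport equation. -/
theorem IsDiracSolution.hasDerivAt_add {h c E : ℝ} {V : ℂ → ℂ} {u : ℝ → ℂ × ℂ}
    (hu : IsDiracSolution h 0 c V E u) (hh : 0 < h) (hc : 0 < c) (hV : ∀ x : ℝ, (V x).im = 0)
    (x : ℝ) :
    HasDerivAt (fun x => (u x).1 + (u x).2)
      (I / (h * c) * ((E - (V x).re : ℝ) : ℂ) * ((u x).1 + (u x).2)) x := by
  refine ((hu.diff1 x).hasDerivAt.add (hu.diff2 x).hasDerivAt).congr_deriv ?_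
  have h1 := hu.eq1 x
  have h2 := hu.eq2 x
  have hVx : V x = ((V x).re : ℂ) := Complex.ext rfl (by simp [hV x])
  have hh0 : (h : ℂ) ≠ 0 := by exact_mod_cast hh.ne'
  have hc0 : (c : ℂ) ≠ 0 := by exact_mod_cast hc.ne'
  rw [hVx] at h1 h2
  push_cast at h1 h2 ⊢
  field_simp
  linear_combination I * h1 + I * h2 +
    (h * c * deriv (fun y : ℝ => (u y).1) x + h * c * deriv (fun y : ℝ => (u y).2) x) * I_sq

/-- For zero mass, `u₁ - u₂` satisfies a scalar transport equation. -/
theorem IsDiracSolution.hasDerivAt_sub {h c E : ℝ} {V : ℂ → ℂ} {u : ℝ → ℂ × ℂ}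
    (hu : IsDiracSolution h 0 c V E u) (hh : 0 < h) (hc : 0 < c) (hV : ∀ x : ℝ, (V x).im = 0)
    (x : ℝ) :
    HasDerivAt (fun x => (u x).1 - (u x).2)
      (-(I / (h * c)) * ((E - (V x).re : ℝ) : ℂ) * ((u x).1 - (u x).2)) x := by
  refine ((hu.diff1 x).hasDerivAt.sub (hu.diff2 x).hasDerivAt).congr_deriv ?_
  have h1 := hu.eq1 x
  have h2 := hu.eq2 x
  have hVx : V x = ((V x).re : ℂ) := Complex.ext rfl (by simp [hV x])
  have hh0 : (h : ℂ) ≠ 0 := by exact_mod_cast hh.ne'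
  have hc0 : (c : ℂ) ≠ 0 := by exact_mod_cast hc.ne'
  rw [hVx] at h1 h2
  push_cast at h1 h2 ⊢
  field_simp
  linear_combination I * h2 - I * h1 +
    (h * c * deriv (fun y : ℝ => (u y).1) x - h * c * deriv (fun y : ℝ => (u y).2) x) * I_sq

theorem phiF_zero_mass (c lam : ℝ) : PhiF 0 c lam = lam := by
  simp [PhiF, Real.sqrt_sq_eq_abs]
  rcases lt_trichotomy lam 0 with h | rfl | h
  · simp [Real.sign_of_neg h, abs_of_neg h]
  · simp
  · simp [Real.sign_of_pos h, abs_of_pos h]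

theorem ampF_zero_mass (c : ℝ) {lam : ℝ} (h : lam ≠ 0) : AmpF 0 c lam = 1 := by
  simp [AmpF, h]

/-- The Jost condition with `s = s' = 1` for zero mass, in terms of `u₁ ± u₂`. -/
theorem JostCond.right_moving {h c E V0 : ℝ} {l : Filter ℝ} {u : ℝ → ℂ × ℂ} (hE : E - V0 ≠ 0)
    (hu : JostCond h 0 c E V0 1 1 l u) :
    Tendsto (fun x : ℝ => ((u x).1 + (u x).2) * exp (-(I / (h * c) * (E - V0 : ℝ) * x))) l (𝓝 2) ∧
    Tendsto (fun x : ℝ => ((u x).1 - (u x).2) * exp (-(I / (h * c) * (E - V0 : ℝ) * x))) l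
      (𝓝 0) := by
  obtain ⟨h1, h2⟩ := hu
  simp only [phiF_zero_mass, ampF_zero_mass c hE, ofReal_one, inv_one, one_mul] at h1 h2
  refine ⟨?_, ?_⟩
  · simpa only [add_mul, one_add_one_eq_two] using h1.add h2
  · simpa only [sub_mul, sub_self] using h1.sub h2

/-- The Jost condition with `s = s' = -1` for zero mass, in terms of `u₁ ± u₂`. -/
theorem JostCond.left_moving {h c E V0 : ℝ} {l : Filter ℝ} {u : ℝ → ℂ × ℂ} (hE : E - V0 ≠ 0)
    (hu : JostCond h 0 c E V0 (-1) (-1) l u) :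
    Tendsto (fun x : ℝ => ((u x).1 + (u x).2) * exp (-(-(I / (h * c)) * (E - V0 : ℝ) * x))) l
      (𝓝 0) ∧
    Tendsto (fun x : ℝ => ((u x).1 - (u x).2) * exp (-(-(I / (h * c)) * (E - V0 : ℝ) * x))) l
      (𝓝 2) := by
  obtain ⟨h1, h2⟩ := hu
  simp only [phiF_zero_mass, ampF_zero_mass c hE, ofReal_one, inv_one, ofReal_neg, mul_one,
    neg_mul, one_mul, neg_div] at h1 h2
  simp only [neg_mul]
  refine ⟨?_, ?_⟩
  · simpa only [add_mul, add_neg_cancel] using h1.add h2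
  · simpa only [sub_mul, sub_neg_eq_add, one_add_one_eq_two] using h1.sub h2

/-- The zero function is a classical analytic symbol. -/
theorem isCAS_zero : IsCAS fun _ => 0 :=
  ⟨0, 0, 1, one_pos, fun j => by simp, fun _ _ => ⟨1, one_pos, 0, by simp⟩⟩

/-- **Zero mass case** (Theorem 2.3).  Under assumption (A), for `m = 0` and
`V⁻ < E < V⁺`, if `V(x) − E` has a unique simple zero `t₀(E)`, then there is a
classical analytic symbol `φ` of non-negative order with
`s₁₁ = s₂₂ = (1 + hφ(h)) e^{iT₀(E)/h}`, `s₂₁ = O(h)`, `s₁₂ = O(h)`, where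
`T₀(E) = (1/c)(∫_{−∞}^{t₀}(−V+V⁻) − ∫_{t₀}^{∞}(V−V⁺) + t₀(V⁺−V⁻))`. -/
theorem zero_mass_case
    (c Vm Vp E : ℝ) (V : ℂ → ℂ)
    (hA : AssumptionA V Vm Vp) (hc : 0 < c)
    (hE1 : Vm < E) (hE2 : E < Vp)
    (t₀ : ℝ)
    (hzero : ∀ x : ℝ, (V x).re - E = 0 ↔ x = t₀)
    (hsimple : deriv (fun x : ℝ => (V x).re) t₀ ≠ 0)
    (ωinm ωinp ωoutp ωoutm : ℝ → ℝ → ℂ × ℂ)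
    (S : ℝ → Matrix (Fin 2) (Fin 2) ℂ)
    (hsol : ∀ h : ℝ, 0 < h →
      IsDiracSolution h 0 c V E (ωinm h) ∧ IsDiracSolution h 0 c V E (ωinp h) ∧
      IsDiracSolution h 0 c V E (ωoutp h) ∧ IsDiracSolution h 0 c V E (ωoutm h))
    (hjost : ∀ h : ℝ, 0 < h →
      JostCond h 0 c E Vm 1 1 atBot (ωinm h) ∧
      JostCond h 0 c E Vp (-1) (-1) atTop (ωinp h) ∧
      JostCond h 0 c E Vp 1 1 atTop (ωoutp h) ∧
      JostCond h 0 c E Vm (-1) (-1) atBot (ωoutm h))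
    (hScat : ∀ h : ℝ, 0 < h → ScatRel (ωinm h) (ωinp h) (ωoutp h) (ωoutm h) (S h)) :
    ∃ φ : ℝ → ℂ, IsCAS φ ∧
      ∃ h₀ > (0 : ℝ), ∃ K : ℝ, ∀ h : ℝ, 0 < h → h < h₀ →
        (S h 0 0 = S h 1 1 ∧
          S h 0 0 = (1 + (h : ℂ) * φ h)
            * Complex.exp (Complex.I
              * ((((1 / c) * ((∫ t in Set.Iic t₀, (-(V t).re + Vm))
                  - (∫ t in Set.Ici t₀, ((V t).re - Vp))
                  + t₀ * (Vp - Vm)) : ℝ)) : ℂ) / (h : ℂ))) ∧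
        ‖S h 1 0‖ ≤ K * h ∧ ‖S h 0 1‖ ≤ K * h := by
  refine ⟨fun _ => 0, isCAS_zero, 1, one_pos, 0, fun h hh _ => ?_⟩
  obtain ⟨sim, sip, sop, som⟩ := hsol h hh
  obtain ⟨jim, jip, jop, jom⟩ := hjost h hh
  obtain ⟨e1, e2⟩ := hScat h hh
  have hEm : E - Vm ≠ 0 := (sub_pos.2 hE1).ne'
  have hEp : E - Vp ≠ 0 := (sub_neg.2 hE2).ne
  have hV := hA.real_on_real
  have hG : ∀ x : ℝ, HasDerivAt (fun x : ℝ => ∫ y in t₀..x, (E - (V y).re)) (E - (V x).re) x :=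
    fun x => (continuous_const.sub hA.continuous_re).integral_hasStrictDerivAt t₀ x |>.hasDerivAt
  have hLp := hA.tendsto_action_atTop E t₀
  have hLm := hA.tendsto_action_atBot E t₀
  have hk : (I / ((h : ℂ) * c)).re = 0 := by
    rw [← ofReal_mul, div_ofReal_re]
    simp
  have hθ : ∀ r : ℝ, (I / ((h : ℂ) * c) * r).re = 0 := fun r => by simp [hk]
  have hθn : ∀ r : ℝ, (-(I / ((h : ℂ) * c)) * r).re = 0 := fun r => by simp [hk]
  have hkn : (-(I / ((h : ℂ) * c))).re = 0 := by rw [neg_re, hk, neg_zero]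
  have im_add := eq_mul_exp_of_tendsto hG (sim.hasDerivAt_add hh hc hV) hLm
    (jim.right_moving hEm).1 t₀
  have im_sub := eq_zero_of_tendsto hG (sim.hasDerivAt_sub hh hc hV) hkn (hθ _)
    (jim.right_moving hEm).2 t₀
  have op_add := eq_mul_exp_of_tendsto hG (sop.hasDerivAt_add hh hc hV) hLp
    (jop.right_moving hEp).1 t₀
  have op_sub := eq_zero_of_tendsto hG (sop.hasDerivAt_sub hh hc hV) hkn (hθ _)
    (jop.right_moving hEp).2 t₀
  have ip_add := eq_zero_of_tendsto hG (sip.hasDerivAt_add hh hc hV) hk (hθn _)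
    (jip.left_moving hEp).1 t₀
  have ip_sub := eq_mul_exp_of_tendsto hG (sip.hasDerivAt_sub hh hc hV) hLp
    (jip.left_moving hEp).2 t₀
  have om_add := eq_zero_of_tendsto hG (som.hasDerivAt_add hh hc hV) hk (hθn _)
    (jom.left_moving hEm).1 t₀
  have om_sub := eq_mul_exp_of_tendsto hG (som.hasDerivAt_sub hh hc hV) hLm
    (jom.left_moving hEm).2 t₀
  simp only [intervalIntegral.integral_same, ofReal_zero, mul_zero, exp_zero, mul_one]
    at im_add op_add ip_sub om_sub
  have f1 : (ωinm h t₀).1 = S h 0 0 * (ωoutp h t₀).1 + S h 1 0 * (ωoutm h t₀).1 := by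
    simpa using congrArg Prod.fst (e1 t₀)
  have f2 : (ωinm h t₀).2 = S h 0 0 * (ωoutp h t₀).2 + S h 1 0 * (ωoutm h t₀).2 := by
    simpa using congrArg Prod.snd (e1 t₀)
  have g1 : (ωinp h t₀).1 = S h 0 1 * (ωoutp h t₀).1 + S h 1 1 * (ωoutm h t₀).1 := by
    simpa using congrArg Prod.fst (e2 t₀)
  have g2 : (ωinp h t₀).2 = S h 0 1 * (ωoutp h t₀).2 + S h 1 1 * (ωoutm h t₀).2 := by
    simpa using congrArg Prod.snd (e2 t₀)
  have op_ne : (ωoutp h t₀).1 + (ωoutp h t₀).2 ≠ 0 := by simp [op_add]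
  have om_ne : (ωoutm h t₀).1 - (ωoutm h t₀).2 ≠ 0 := by simp [om_sub]
  have h10 : S h 1 0 = 0 := (mul_eq_zero.1 (by
    linear_combination im_sub - S h 0 0 * op_sub - f1 + f2 :
      S h 1 0 * ((ωoutm h t₀).1 - (ωoutm h t₀).2) = 0)).resolve_right om_ne
  have h01 : S h 0 1 = 0 := (mul_eq_zero.1 (by
    linear_combination ip_add - S h 1 1 * om_add - g1 - g2 :
      S h 0 1 * ((ωoutp h t₀).1 + (ωoutp h t₀).2) = 0)).resolve_right op_ne
  have h00 : S h 0 0 * ((ωoutp h t₀).1 + (ωoutp h t₀).2) = (ωinm h t₀).1 + (ωinm h t₀).2 := by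
    linear_combination -f1 - f2 - S h 1 0 * om_add
  have h11 : S h 1 1 * ((ωoutm h t₀).1 - (ωoutm h t₀).2) = (ωinp h t₀).1 - (ωinp h t₀).2 := by
    linear_combination -g1 + g2 - S h 0 1 * op_sub
  have key00 : S h 0 0 = exp (I * ((((1 / c) * ((∫ t in Set.Iic t₀, (-(V t).re + Vm))
      - (∫ t in Set.Ici t₀, ((V t).re - Vp)) + t₀ * (Vp - Vm)) : ℝ)) : ℂ) / (h : ℂ)) := by
    refine mul_right_cancel₀ op_ne (h00.trans ?_)
    rw [im_add, op_add, mul_left_comm, ← exp_add]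
    congr 2
    push_cast
    ring
  have key11 : S h 1 1 = exp (I * ((((1 / c) * ((∫ t in Set.Iic t₀, (-(V t).re + Vm))
      - (∫ t in Set.Ici t₀, ((V t).re - Vp)) + t₀ * (Vp - Vm)) : ℝ)) : ℂ) / (h : ℂ)) := by
    refine mul_right_cancel₀ om_ne (h11.trans ?_)
    rw [ip_sub, om_sub, mul_left_comm, ← exp_add]
    congr 2
    push_cast
    ring
  refine ⟨⟨key00.trans key11.symm, ?_⟩, ?_, ?_⟩
  · rw [key00, mul_zero, add_zero, one_mul]
  · simp [h10]
  · simp [h01]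
end

section
/- Total transmission: Assume V satisfies assumption (A), m ≥ 0, E lies in region I (i.e. V⁺ + mc² < E), and m²c⁴ − (V(x)−E)² has no zeros. Then there exist a classical analytic symbol φ(h) of non-negative order and a constant C > 0 such that s₁₁ = s₂₂ = (1 + hφ(h))·exp(i·T̃(E)/h), s₂₁ = O(e^{−C/h}), and s₁₂ = O(e^{−C/h}), where T̃(E) = ∫_{−∞}^{0} Q⁻(t,E) dt + ∫_{0}^{+∞} Q⁺(t,E) dt and Q^±(t,E) = √((−m²c⁴ + (V(t)−E)²)/c²) − √(E^±), E^± = (−m²c⁴ + (V^± − E)²)/c², the functions Q^± being defined here for all t ∈ ℝ. -/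
open Complex Filter Topology MeasureTheory Set

lemma exists_truncation_bound {K C₁ : ℝ} (hK : 0 < K) (hC : 2 * K ≤ C₁) :
    ∃ ρ > (0 : ℝ), ∃ M : ℝ, 0 ≤ M ∧ ∀ h : ℝ, 0 < h → h < 1 →
      1 / h * ((K * h) ^ (⌊1 / (h * Real.exp 1 * C₁)⌋₊ + 1)
        * ((⌊1 / (h * Real.exp 1 * C₁)⌋₊ + 1).factorial : ℝ)) ≤ M * Real.exp (-ρ / h) := by
  have hC₁ : 0 < C₁ := by linarith
  have he : (2 : ℝ) ≤ Real.exp 1 := by linarith [Real.add_one_le_exp (1 : ℝ)]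
  have he0 := Real.exp_pos 1
  set ρ : ℝ := 1 / (4 * Real.exp 1 * C₁) with hρ
  have hρ0 : 0 < ρ := by positivity
  set N₁ : ℕ := ⌊1 / (1 / (4 * K) * Real.exp 1 * C₁)⌋₊ + 1 with hN₁
  set M₂ : ℝ := 4 * K * ((1 + K) ^ N₁ * (N₁.factorial : ℝ)) * Real.exp (ρ * (4 * K)) with hM₂
  refine ⟨ρ, hρ0, 1 / ρ + M₂, by positivity, fun h h0 h1 => ?_⟩
  set X : ℝ := 1 / (h * Real.exp 1 * C₁) with hX
  have hX0 : 0 < X := by positivity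
  set N : ℕ := ⌊X⌋₊ + 1 with hN
  have hXN : X < N := by rw [hN]; push_cast; exact Nat.lt_floor_add_one X
  have hNX : (N : ℝ) ≤ X + 1 := by
    rw [hN]; push_cast; linarith [Nat.floor_le hX0.le]
  have hexp := Real.exp_pos (-ρ / h)
  rcases le_or_gt h (1 / (4 * K)) with hh | hh
  · have hKh : K * h ≤ 1 / 4 := by
      rw [le_div_iff₀ (by positivity)] at hh; linarith
    have hKX : K * h * X ≤ 1 / 4 := by
      have : K * h * X = K / (Real.exp 1 * C₁) := by rw [hX]; field_simp
      rw [this, div_le_iff₀ (by positivity)]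
      nlinarith
    have hKN : K * h * N ≤ 1 / 2 := by
      have : K * h * N ≤ K * h * (X + 1) := by gcongr
      linarith
    have h2 : (K * h) ^ N * (N.factorial : ℝ) ≤ (1 / 2) ^ N := by
      calc (K * h) ^ N * (N.factorial : ℝ) ≤ (K * h) ^ N * (N : ℝ) ^ N := by
            gcongr; exact_mod_cast Nat.factorial_le_pow N
        _ = (K * h * N) ^ N := by rw [mul_pow _ (N : ℝ)]
        _ ≤ (1 / 2) ^ N := by gcongr
    have h3 : (1 / 2 : ℝ) ^ N ≤ Real.exp (-(2 * ρ / h)) := by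
      have e1 : (1 / 2 : ℝ) ≤ Real.exp (-(1 / 2)) := by
        linarith [Real.add_one_le_exp (-(1 / 2) : ℝ)]
      calc (1 / 2 : ℝ) ^ N ≤ Real.exp (-(1 / 2)) ^ N := by gcongr
        _ = Real.exp (N * (-(1 / 2))) := by rw [← Real.exp_nat_mul]
        _ ≤ Real.exp (-(2 * ρ / h)) := by
          apply Real.exp_le_exp.2
          have : 2 * ρ / h = X / 2 := by rw [hρ, hX]; field_simp; norm_num
          rw [this]; linarith
    have h4 : 1 / h ≤ 1 / ρ * Real.exp (ρ / h) := by
      have := Real.add_one_le_exp (ρ / h)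
      calc 1 / h = 1 / ρ * (ρ / h) := by field_simp
        _ ≤ _ := by gcongr; linarith
    calc 1 / h * ((K * h) ^ N * (N.factorial : ℝ))
        ≤ (1 / ρ * Real.exp (ρ / h)) * Real.exp (-(2 * ρ / h)) := by
          gcongr; exact h2.trans h3
      _ = 1 / ρ * Real.exp (-ρ / h) := by
          rw [mul_assoc, ← Real.exp_add]; congr 2; ring
      _ ≤ _ := by gcongr; linarith [show 0 ≤ M₂ by positivity]
  · have hNN : N ≤ N₁ := by
      rw [hN, hN₁, hX]
      gcongr
    have h5 : (K * h) ^ N ≤ (1 + K) ^ N₁ := by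
      calc (K * h) ^ N ≤ (1 + K) ^ N := by gcongr; nlinarith
        _ ≤ (1 + K) ^ N₁ := by gcongr; linarith
    have h6 : (N.factorial : ℝ) ≤ N₁.factorial := by exact_mod_cast Nat.factorial_le hNN
    have h7 : 1 / h ≤ 4 * K := by
      rw [div_le_iff₀ h0]; rw [div_lt_iff₀ (by positivity)] at hh; linarith
    have h8 : 1 ≤ Real.exp (ρ * (4 * K)) * Real.exp (-ρ / h) := by
      rw [← Real.exp_add]
      apply Real.one_le_exp
      have : -ρ / h = -(ρ * (1 / h)) := by ring
      rw [this]; nlinarith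
    calc 1 / h * ((K * h) ^ N * (N.factorial : ℝ))
        ≤ 4 * K * ((1 + K) ^ N₁ * (N₁.factorial : ℝ)) * 1 := by
          rw [mul_one]; gcongr
      _ ≤ 4 * K * ((1 + K) ^ N₁ * (N₁.factorial : ℝ))
          * (Real.exp (ρ * (4 * K)) * Real.exp (-ρ / h)) := by gcongr
      _ = M₂ * Real.exp (-ρ / h) := by rw [hM₂]; ring
      _ ≤ _ := by gcongr; linarith [show 0 < 1 / ρ by positivity]

lemma exists_exp_bound_of_gevrey {K M : ℝ} (hK : 0 < K) (hM : 0 ≤ M) :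
    ∃ C > (0 : ℝ), ∃ K' : ℝ, ∀ h : ℝ, 0 < h → h < 1 → ∀ x : ℝ,
      (∀ N : ℕ, x ≤ M * ((K * h) ^ N * (N.factorial : ℝ))) → x ≤ K' * Real.exp (-C / h) := by
  obtain ⟨ρ, hρ, M₁, hM₁, hb⟩ := exists_truncation_bound hK le_rfl
  refine ⟨ρ, hρ, M * M₁, fun h h0 h1 x hx => ?_⟩
  have := hb h h0 h1
  set N : ℕ := ⌊1 / (h * Real.exp 1 * (2 * K))⌋₊ + 1
  have h2 : (K * h) ^ N * (N.factorial : ℝ) ≤ 1 / h * ((K * h) ^ N * (N.factorial : ℝ)) := by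
    apply le_mul_of_one_le_left (by positivity)
    rw [le_div_iff₀ h0]; linarith
  calc x ≤ M * ((K * h) ^ N * (N.factorial : ℝ)) := hx N
    _ ≤ M * (M₁ * Real.exp (-ρ / h)) := mul_le_mul_of_nonneg_left (h2.trans this) hM
    _ = _ := by ring

lemma isCAS_of_gevrey {K M : ℝ} (hK : 0 < K) (hM : 0 ≤ M) {a : ℕ → ℂ} {φ : ℝ → ℂ}
    (ha : ∀ k, ‖a k‖ ≤ M * (K ^ k * (k.factorial : ℝ)))
    (hφ : ∀ h : ℝ, 0 < h → ∀ N : ℕ, ‖φ h - ∑ k ∈ Finset.range N, a k * (h : ℂ) ^ k‖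
      ≤ 1 / h * (M * ((K * h) ^ N * (N.factorial : ℝ)))) : IsCAS φ := by
  refine ⟨0, a, 2 * K + M, by positivity, fun j => ?_, fun C₁ hC₁ => ?_⟩
  · calc ‖a j‖ ≤ M * (K ^ j * (j.factorial : ℝ)) := ha j
      _ ≤ (2 * K + M) * ((2 * K + M) ^ j * (j : ℝ) ^ j) := by
        gcongr
        · linarith
        · linarith
        · exact_mod_cast Nat.factorial_le_pow j
      _ = _ := by ring
  · obtain ⟨ρ, hρ, M₁, hM₁, hb⟩ := exists_truncation_bound (C₁ := C₁) hK (by linarith)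
    refine ⟨ρ, hρ, M * M₁, fun h h0 h1 => ?_⟩
    simp only [zero_add]
    refine (hφ h h0 _).trans ?_
    have := hb h h0 h1
    calc _ = M * (1 / h * ((K * h) ^ (⌊1 / (h * Real.exp 1 * C₁)⌋₊ + 1)
        * ((⌊1 / (h * Real.exp 1 * C₁)⌋₊ + 1).factorial : ℝ))) := by ring
      _ ≤ M * (M₁ * Real.exp (-ρ / h)) := by gcongr
      _ = _ := by ring

/-- The open horizontal strip of half-width `κ`. -/
def strip (κ : ℝ) : Set ℂ := {x : ℂ | |x.im| < κ}

lemma isOpen_strip (κ : ℝ) : IsOpen (strip κ) :=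
  isOpen_lt (continuous_abs.comp Complex.continuous_im) continuous_const

lemma strip_mono {s κ : ℝ} (h : s ≤ κ) : strip s ⊆ strip κ := fun _ hx => lt_of_lt_of_le hx h

lemma add_ofReal_mem_strip {κ : ℝ} {x : ℂ} (hx : x ∈ strip κ) (t : ℝ) : x + t ∈ strip κ := by
  simpa [strip] using hx

lemma ofReal_mem_strip {κ : ℝ} (hκ : 0 < κ) (t : ℝ) : (t : ℂ) ∈ strip κ := by
  simpa [strip] using hκ

/-- An integrable weight on the line, slowly varying and vanishing at infinity. -/
structure SlowWeight (L : ℝ) (w : ℝ → ℝ) : Prop where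
  pos : ∀ t, 0 < w t
  le_one : ∀ t, w t ≤ 1
  cont : Continuous w
  integrable : Integrable w
  slow : ∀ s t, |s - t| ≤ 1 → w s ≤ L * w t
  tendsto_atTop : Tendsto w atTop (𝓝 0)
  tendsto_atBot : Tendsto w atBot (𝓝 0)

namespace SlowWeight
variable {L : ℝ} {w : ℝ → ℝ}

lemma one_le (hw : SlowWeight L w) : 1 ≤ L := by
  have := hw.slow 0 0 (by simp)
  have h0 := hw.pos 0
  by_contra h
  push Not at h
  nlinarith

lemma integrable_add_left (hw : SlowWeight L w) (x : ℝ) : Integrable fun t => w (x + t) :=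
  hw.integrable.comp_add_left x

lemma setIntegral_le (hw : SlowWeight L w) (x : ℝ) :
    ∫ t in Iic (0 : ℝ), w (x + t) ≤ ∫ t, w t := by
  calc ∫ t in Iic (0 : ℝ), w (x + t) ≤ ∫ t, w (x + t) :=
        setIntegral_le_integral (hw.integrable_add_left x)
          (Eventually.of_forall fun t => (hw.pos _).le)
    _ = ∫ t, w t := integral_add_left_eq_self w x

lemma integral_nonneg (hw : SlowWeight L w) : 0 ≤ ∫ t, w t :=
  MeasureTheory.integral_nonneg fun t => (hw.pos t).le

end SlowWeight

/-- The derivative of a holomorphic function is controlled by a slowly varying weight as soon as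
the function is controlled by this weight on a disc of radius at most one. -/
lemma norm_deriv_le_of_weight {L : ℝ} {w : ℝ → ℝ} (hw : SlowWeight L w) {F : ℂ → ℂ} {x : ℂ}
    {κ r M : ℝ} (hr : 0 < r) (hr1 : r ≤ 1) (hx : |x.im| + r < κ) (hM : 0 ≤ M)
    (hF : DifferentiableOn ℂ F (strip κ))
    (hb : ∀ y : ℂ, ‖y - x‖ = r → ‖F y‖ ≤ M * w y.re) :
    ‖deriv F x‖ ≤ L * M / r * w x.re := by
  have hsub : Metric.closedBall x r ⊆ strip κ := by
    intro y hy
    rw [Metric.mem_closedBall, dist_eq_norm] at hy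
    have h1 : |y.im - x.im| ≤ r := by
      simpa using (Complex.abs_im_le_norm (y - x)).trans hy
    have h2 : |y.im| ≤ |x.im| + |y.im - x.im| := by
      calc |y.im| = |x.im + (y.im - x.im)| := by ring_nf
        _ ≤ _ := abs_add_le _ _
    change |y.im| < κ
    linarith
  have hd : DiffContOnCl ℂ F (Metric.ball x r) := (hF.mono hsub).diffContOnCl_ball le_rfl
  have := Complex.norm_deriv_le_of_forall_mem_sphere_norm_le (C := M * (L * w x.re)) hr hd ?_
  · refine this.trans (le_of_eq ?_)
    ring
  · intro y hy
    rw [mem_sphere_iff_norm] at hy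
    refine (hb y hy).trans ?_
    gcongr
    apply hw.slow
    have := Complex.abs_re_le_norm (y - x)
    rw [hy] at this
    exact le_trans (by simpa using this) hr1

/-- The primitive vanishing at `-∞` along horizontal lines. -/
noncomputable def horizPrim (F : ℂ → ℂ) (x : ℂ) : ℂ := ∫ t in Iic (0 : ℝ), F (x + t)

lemma integrable_horiz {L : ℝ} {w : ℝ → ℝ} (hw : SlowWeight L w) {F : ℂ → ℂ} {κ M : ℝ} {x : ℂ}
    (hx : x ∈ strip κ) (hF : ContinuousOn F (strip κ))
    (hb : ∀ t : ℝ, ‖F (x + t)‖ ≤ M * w (x.re + t)) : Integrable fun t : ℝ => F (x + t) := by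
  have hc : Continuous fun t : ℝ => F (x + t) :=
    hF.comp_continuous (by fun_prop) (fun t => add_ofReal_mem_strip hx t)
  exact ((hw.integrable_add_left x.re).const_mul M).mono' hc.aestronglyMeasurable
    (Eventually.of_forall hb)

lemma norm_horizPrim_le {L : ℝ} {w : ℝ → ℝ} (hw : SlowWeight L w) {F : ℂ → ℂ} {M : ℝ} {x : ℂ}
    (hM : 0 ≤ M) (hb : ∀ t : ℝ, ‖F (x + t)‖ ≤ M * w (x.re + t)) :
    ‖horizPrim F x‖ ≤ M * ∫ t, w t := by
  calc ‖horizPrim F x‖ ≤ ∫ t in Iic (0 : ℝ), M * w (x.re + t) :=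
        norm_integral_le_of_norm_le ((hw.integrable_add_left x.re).const_mul M).integrableOn
          (Eventually.of_forall hb)
    _ = M * ∫ t in Iic (0 : ℝ), w (x.re + t) := by rw [integral_const_mul]
    _ ≤ _ := by gcongr; exact hw.setIntegral_le _

lemma hasDerivAt_horizPrim {L : ℝ} {w : ℝ → ℝ} (hw : SlowWeight L w) {F : ℂ → ℂ} {κ : ℝ}
    (hF : DifferentiableOn ℂ F (strip κ))
    (hb : ∀ s < κ, ∃ M : ℝ, 0 ≤ M ∧ ∀ y ∈ strip s, ‖F y‖ ≤ M * w y.re)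
    {x : ℂ} (hx : x ∈ strip κ) : HasDerivAt (horizPrim F) (F x) x := by
  have hxκ : |x.im| < κ := hx
  set d : ℝ := min 1 ((κ - |x.im|) / 4) with hd
  have hd0 : 0 < d := by apply lt_min <;> linarith
  have hd1 : d ≤ 1 := min_le_left _ _
  have hd2 : 4 * d ≤ κ - |x.im| := by linarith [min_le_right 1 ((κ - |x.im|) / 4)]
  obtain ⟨M, hM, hMb⟩ := hb (|x.im| + 3 * d) (by linarith)
  have hbx : ∀ t : ℝ, ‖F (x + t)‖ ≤ M * w (x.re + t) := fun t => by
    simpa using hMb (x + t) (by simp [strip, hd0])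
  have hF' : ContinuousOn (deriv F) (strip κ) :=
    (hF.deriv (isOpen_strip κ)).continuousOn
  have hball : ∀ y ∈ Metric.ball x d, ∀ t : ℝ, |(y + t).im| < |x.im| + d ∧
      |y.re + t - (x.re + t)| ≤ 1 := by
    intro y hy t
    rw [Metric.mem_ball, dist_eq_norm] at hy
    have h1 : |y.im - x.im| < d := by
      simpa using (Complex.abs_im_le_norm (y - x)).trans_lt hy
    have h3 : |y.re - x.re| < d := by
      simpa using (Complex.abs_re_le_norm (y - x)).trans_lt hy
    have h2 : |y.im| ≤ |x.im| + |y.im - x.im| := by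
      calc |y.im| = |x.im + (y.im - x.im)| := by ring_nf
        _ ≤ _ := abs_add_le _ _
    constructor
    · simp; linarith
    · rw [show y.re + t - (x.re + t) = y.re - x.re by ring]; linarith
  have hder : ∀ y ∈ Metric.ball x d, ∀ t : ℝ,
      ‖deriv F (y + t)‖ ≤ L * M / d * L * w (x.re + t) := by
    intro y hy t
    obtain ⟨h1, h2⟩ := hball y hy t
    have h3 := norm_deriv_le_of_weight (x := y + t) hw hd0 hd1 (by linarith) hM hF (fun z hz => by
      apply hMb
      have h4 : |z.im - (y + t).im| ≤ d := by
        rw [← hz]; simpa using Complex.abs_im_le_norm (z - (y + t))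
      have h5 : |z.im| ≤ |(y + t).im| + |z.im - (y + t).im| := by
        calc |z.im| = |(y + t).im + (z.im - (y + t).im)| := by ring_nf
          _ ≤ _ := abs_add_le _ _
      change |z.im| < _
      linarith)
    have hL := hw.one_le
    have h6 := hw.slow _ _ h2
    calc _ ≤ L * M / d * w (y.re + t) := by simpa using h3
      _ ≤ L * M / d * (L * w (x.re + t)) := by gcongr
      _ = _ := by ring
  have hmeas : ∀ {G : ℂ → ℂ}, ContinuousOn G (strip κ) → ∀ y ∈ strip κ,
      AEStronglyMeasurable (fun t : ℝ => G (y + t)) (volume.restrict (Iic 0)) := by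
    intro G hG y hy
    exact (hG.comp_continuous (by fun_prop)
      (fun t => add_ofReal_mem_strip hy t)).aestronglyMeasurable
  have key := (hasDerivAt_integral_of_dominated_loc_of_deriv_le
    (μ := volume.restrict (Iic (0 : ℝ))) (F := fun y t => F (y + (t : ℝ)))
    (F' := fun y t => deriv F (y + (t : ℝ))) (x₀ := x) (s := Metric.ball x d)
    (bound := fun t => L * M / d * L * w (x.re + t))
    (Metric.ball_mem_nhds x hd0)
    (by filter_upwards [(isOpen_strip κ).mem_nhds hx] with y hy using hmeas hF.continuousOn y hy)
    (integrable_horiz hw hx hF.continuousOn hbx).integrableOn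
    (hmeas hF' x hx)
    (Eventually.of_forall fun t y hy => hder y hy t)
    ((hw.integrable_add_left x.re).const_mul _).integrableOn
    (Eventually.of_forall fun t y hy => by
      have : (y + t) ∈ strip κ := by
        change |(y + t).im| < κ
        have := (hball y hy t).1
        linarith
      exact ((hF.differentiableAt ((isOpen_strip κ).mem_nhds this)).hasDerivAt).comp_add_const
        y (t : ℂ))).2
  have hval : ∫ t in Iic (0 : ℝ), deriv F (x + t) = F x := by
    have h1 := integral_Iic_of_hasDerivAt_of_tendsto' (f := fun t : ℝ => F (x + t))
      (f' := fun t : ℝ => deriv F (x + t)) (a := 0) (m := 0) (fun t _ => by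
        have : (x + t) ∈ strip κ := add_ofReal_mem_strip hx t
        have h2 := (hF.differentiableAt ((isOpen_strip κ).mem_nhds this)).hasDerivAt
        have h3 : HasDerivAt (fun s : ℂ => F (x + s)) (deriv F (x + t)) (t : ℂ) :=
          h2.comp_const_add x (t : ℂ)
        exact h3.comp_ofReal)
      (integrable_horiz hw hx hF' (hder x (Metric.mem_ball_self hd0))).integrableOn
      (by
        apply squeeze_zero_norm hbx
        have := (hw.tendsto_atBot.comp (tendsto_atBot_add_const_left atBot x.re tendsto_id)).const_mul M
        simpa using this)
    simpa using h1
  rw [hval] at key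
  exact key

lemma horizPrim_ofReal (F : ℂ → ℂ) (x : ℝ) :
    horizPrim F x = ∫ t in Iic x, F (t : ℝ) := by
  have h := (measurePreserving_add_left (volume : Measure ℝ) x).setIntegral_preimage_emb
    (MeasurableEquiv.addLeft x).measurableEmbedding (fun t : ℝ => F t) (Iic x)
  rw [← h, horizPrim]
  simp

lemma tendsto_horizPrim_atBot (F : ℂ → ℂ) :
    Tendsto (fun x : ℝ => horizPrim F x) atBot (𝓝 0) := by
  simp_rw [horizPrim_ofReal]
  exact tendsto_integral_Iic_zero tendsto_id

lemma tendsto_horizPrim_atTop {F : ℂ → ℂ} (hF : Integrable fun t : ℝ => F t) :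
    Tendsto (fun x : ℝ => horizPrim F x) atTop (𝓝 (∫ t : ℝ, F t)) := by
  simp_rw [horizPrim_ofReal]
  exact (aecover_Iic tendsto_id).integral_tendsto_of_countably_generated hF

/-- Coefficients of the first-order system `a' = -g b`, `b' = -(2ip/h) b - g a`,
holomorphic in a strip. -/
structure WKBData (κ L G p₀ : ℝ) (w : ℝ → ℝ) (g p : ℂ → ℂ) : Prop where
  weight : SlowWeight L w
  κ_pos : 0 < κ
  κ_le_one : κ ≤ 1
  p₀_pos : 0 < p₀
  G_nonneg : 0 ≤ G
  g_diff : DifferentiableOn ℂ g (strip κ)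
  p_diff : DifferentiableOn ℂ p (strip κ)
  g_le : ∀ x ∈ strip κ, ‖g x‖ ≤ G * w x.re
  p_ge : ∀ x ∈ strip κ, p₀ ≤ ‖p x‖

/-- The coefficients of `h ^ (n + 1)` in the formal expansion of `b`. -/
noncomputable def wkbB (g p : ℂ → ℂ) : ℕ → ℂ → ℂ
  | 0 => fun x => -g x / (2 * I * p x)
  | n + 1 => fun x =>
      -(deriv (wkbB g p n) x + g x * -horizPrim (fun y => g y * wkbB g p n y) x) / (2 * I * p x)

/-- The coefficients of `h ^ (n + 1)` in the formal expansion of `a`. -/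
noncomputable def wkbA (g p : ℂ → ℂ) (n : ℕ) (x : ℂ) : ℂ :=
  -horizPrim (fun y => g y * wkbB g p n y) x

namespace WKBData
variable {κ L G p₀ : ℝ} {w : ℝ → ℝ} {g p : ℂ → ℂ}

lemma p_ne_zero (hD : WKBData κ L G p₀ w g p) {x : ℂ} (hx : x ∈ strip κ) : p x ≠ 0 := by
  have h1 := hD.p_ge x hx
  have h2 := hD.p₀_pos
  intro h
  rw [h, norm_zero] at h1
  linarith

lemma norm_div_two_I_mul_le (hD : WKBData κ L G p₀ w g p) {x : ℂ} (hx : x ∈ strip κ) {z : ℂ}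
    {r : ℝ} (hz : ‖z‖ ≤ r) : ‖-z / (2 * I * p x)‖ ≤ r / (2 * p₀) := by
  have h2 := hD.p₀_pos
  have hr : 0 ≤ r := (norm_nonneg _).trans hz
  rw [norm_div, norm_neg]
  have : ‖2 * I * p x‖ = 2 * ‖p x‖ := by simp
  rw [this]
  have := hD.p_ge x hx
  gcongr

/-- The growth rate of the coefficients. -/
noncomputable def rate (L G p₀ : ℝ) (w : ℝ → ℝ) : ℝ := (6 * L + G ^ 2 * ∫ t, w t) / (2 * p₀)

lemma rate_pos (hD : WKBData κ L G p₀ w g p) : 0 < rate L G p₀ w := by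
  have h1 := hD.p₀_pos
  have h2 := hD.weight.one_le
  have h3 := hD.weight.integral_nonneg
  unfold rate
  positivity

/-- Bound on the `n`-th coefficient at distance `d` from the boundary of the strip. -/
noncomputable def coeffBound (L G p₀ : ℝ) (w : ℝ → ℝ) (n : ℕ) (d : ℝ) : ℝ :=
  G / (2 * p₀) * (rate L G p₀ w ^ n * (n.factorial : ℝ)) / d ^ n

lemma coeffBound_nonneg (hD : WKBData κ L G p₀ w g p) (n : ℕ) {d : ℝ} (hd : 0 < d) :
    0 ≤ coeffBound L G p₀ w n d := by
  have h1 := hD.p₀_pos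
  have h2 := hD.G_nonneg
  have h3 := hD.rate_pos
  unfold coeffBound
  positivity

lemma coeffBound_anti (hD : WKBData κ L G p₀ w g p) (n : ℕ) {d d' : ℝ} (hd : 0 < d)
    (h : d ≤ d') : coeffBound L G p₀ w n d' ≤ coeffBound L G p₀ w n d := by
  have h1 := hD.p₀_pos
  have h2 := hD.G_nonneg
  have h3 := hD.rate_pos
  unfold coeffBound
  gcongr

lemma norm_mul_le (hD : WKBData κ L G p₀ w g p) {F : ℂ → ℂ} {n : ℕ}
    (hF : ∀ x ∈ strip κ, ‖F x‖ ≤ coeffBound L G p₀ w n (κ - |x.im|) * w x.re)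
    {x : ℂ} (hx : x ∈ strip κ) :
    ‖g x * F x‖ ≤ G * coeffBound L G p₀ w n (κ - |x.im|) * w x.re := by
  have hx' : |x.im| < κ := hx
  have hw := hD.weight.pos x.re
  have hw1 := hD.weight.le_one x.re
  have hG := hD.G_nonneg
  have hc := hD.coeffBound_nonneg n (show 0 < κ - |x.im| by linarith)
  calc ‖g x * F x‖ = ‖g x‖ * ‖F x‖ := norm_mul _ _
    _ ≤ (G * w x.re) * (coeffBound L G p₀ w n (κ - |x.im|) * w x.re) := by
      gcongr
      · exact hD.g_le x hx
      · exact hF x hx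
    _ ≤ (G * 1) * (coeffBound L G p₀ w n (κ - |x.im|) * w x.re) := by gcongr
    _ = _ := by ring

lemma hasDerivAt_prim (hD : WKBData κ L G p₀ w g p) {F : ℂ → ℂ} {n : ℕ}
    (hFd : DifferentiableOn ℂ F (strip κ))
    (hF : ∀ x ∈ strip κ, ‖F x‖ ≤ coeffBound L G p₀ w n (κ - |x.im|) * w x.re)
    {x : ℂ} (hx : x ∈ strip κ) :
    HasDerivAt (horizPrim fun y => g y * F y) (g x * F x) x := by
  refine hasDerivAt_horizPrim hD.weight (F := fun y => g y * F y) (hD.g_diff.mul hFd)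
    (fun s hs => ?_) hx
  have hG := hD.G_nonneg
  have hc := hD.coeffBound_nonneg n (show 0 < κ - s by linarith)
  refine ⟨G * coeffBound L G p₀ w n (κ - s), by positivity, fun y hy => ?_⟩
  have hy' : |y.im| < s := hy
  refine (hD.norm_mul_le hF (strip_mono hs.le hy)).trans ?_
  have hw := hD.weight.pos y.re
  have := hD.coeffBound_anti n (show 0 < κ - s by linarith) (show κ - s ≤ κ - |y.im| by linarith)
  gcongr

lemma norm_prim_le (hD : WKBData κ L G p₀ w g p) {F : ℂ → ℂ} {n : ℕ}
    (hF : ∀ x ∈ strip κ, ‖F x‖ ≤ coeffBound L G p₀ w n (κ - |x.im|) * w x.re)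
    {x : ℂ} (hx : x ∈ strip κ) :
    ‖horizPrim (fun y => g y * F y) x‖ ≤ G * coeffBound L G p₀ w n (κ - |x.im|) * ∫ t, w t := by
  have hG := hD.G_nonneg
  have hx' : |x.im| < κ := hx
  have hc := hD.coeffBound_nonneg n (show 0 < κ - |x.im| by linarith)
  refine norm_horizPrim_le hD.weight (by positivity) (fun t => ?_)
  simpa using hD.norm_mul_le hF (add_ofReal_mem_strip hx t)

lemma norm_deriv_le (hD : WKBData κ L G p₀ w g p) {F : ℂ → ℂ} {n : ℕ}
    (hFd : DifferentiableOn ℂ F (strip κ))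
    (hF : ∀ x ∈ strip κ, ‖F x‖ ≤ coeffBound L G p₀ w n (κ - |x.im|) * w x.re)
    {x : ℂ} (hx : x ∈ strip κ) :
    ‖deriv F x‖ ≤ 6 * L * (n + 1) / (κ - |x.im|) * coeffBound L G p₀ w n (κ - |x.im|)
      * w x.re := by
  have hx' : |x.im| < κ := hx
  set d : ℝ := κ - |x.im| with hd
  have hd0 : 0 < d := by linarith
  have hd1 : d ≤ 1 := by linarith [hD.κ_le_one, abs_nonneg x.im]
  set r : ℝ := d / (n + 2) with hr
  have hr0 : 0 < r := by positivity
  have hrd : r < d := by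
    rw [hr, div_lt_iff₀ (by positivity)]; nlinarith [show (0 : ℝ) ≤ n by positivity]
  have hc := hD.coeffBound_nonneg n hd0
  have hq : (((n : ℝ) + 2) / (n + 1)) ^ n ≤ 3 := by
    have h1 : ((n : ℝ) + 2) / (n + 1) ≤ Real.exp (1 / (n + 1)) := by
      have := Real.add_one_le_exp (1 / ((n : ℝ) + 1))
      refine le_trans (le_of_eq ?_) this
      field_simp
      ring
    calc (((n : ℝ) + 2) / (n + 1)) ^ n ≤ Real.exp (1 / (n + 1)) ^ n := by gcongr
      _ = Real.exp (n * (1 / (n + 1))) := by rw [← Real.exp_nat_mul]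
      _ ≤ Real.exp 1 := by
        apply Real.exp_le_exp.2
        rw [mul_one_div, div_le_one (by positivity)]; linarith
      _ ≤ 3 := by linarith [Real.exp_one_lt_d9]
  have hscale : coeffBound L G p₀ w n (d - r) =
      (((n : ℝ) + 2) / (n + 1)) ^ n * coeffBound L G p₀ w n d := by
    have : d - r = d / (((n : ℝ) + 2) / (n + 1)) := by rw [hr]; field_simp; ring
    rw [this]
    unfold coeffBound
    rw [div_pow]
    field_simp
  have hsup : coeffBound L G p₀ w n (d - r) ≤ 3 * coeffBound L G p₀ w n d := by
    rw [hscale]; gcongr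
  have key := norm_deriv_le_of_weight (F := F) (M := 3 * coeffBound L G p₀ w n d) hD.weight hr0
    (by linarith) (by linarith : |x.im| + r < κ) (by positivity) hFd (fun y hy => by
      have h4 : |y.im - x.im| ≤ r := by
        rw [← hy]; simpa using Complex.abs_im_le_norm (y - x)
      have h5 : |y.im| ≤ |x.im| + |y.im - x.im| := by
        calc |y.im| = |x.im + (y.im - x.im)| := by ring_nf
          _ ≤ _ := abs_add_le _ _
      have hw := hD.weight.pos y.re
      refine (hF y (by change |y.im| < κ; linarith)).trans ?_
      gcongr
      refine (hD.coeffBound_anti n (by linarith) ?_).trans hsup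
      linarith)
  refine key.trans ?_
  have hw := hD.weight.pos x.re
  have hL := hD.weight.one_le
  have hn : (n : ℝ) + 2 ≤ 2 * (n + 1) := by nlinarith [show (0 : ℝ) ≤ n by positivity]
  calc L * (3 * coeffBound L G p₀ w n d) / r * w x.re
      = L * (3 * coeffBound L G p₀ w n d) * ((n : ℝ) + 2) / d * w x.re := by
        rw [hr, div_div_eq_mul_div]
    _ ≤ L * (3 * coeffBound L G p₀ w n d) * (2 * (n + 1)) / d * w x.re := by gcongr
    _ = _ := by ring

lemma wkbB_estimate (hD : WKBData κ L G p₀ w g p) (n : ℕ) :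
    DifferentiableOn ℂ (wkbB g p n) (strip κ) ∧
      ∀ x ∈ strip κ, ‖wkbB g p n x‖ ≤ coeffBound L G p₀ w n (κ - |x.im|) * w x.re := by
  have hp₀ := hD.p₀_pos
  have hden : DifferentiableOn ℂ (fun x => 2 * I * p x) (strip κ) := hD.p_diff.const_mul _
  have hden0 : ∀ x ∈ strip κ, 2 * I * p x ≠ 0 := fun x hx => by
    simp [hD.p_ne_zero hx, I_ne_zero]
  induction n with
  | zero =>
    refine ⟨hD.g_diff.neg.div hden hden0, fun x hx => ?_⟩
    refine (hD.norm_div_two_I_mul_le hx (hD.g_le x hx)).trans (le_of_eq ?_)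
    simp [coeffBound]
    ring
  | succ n ih =>
    obtain ⟨ihd, ihb⟩ := ih
    have hprim : DifferentiableOn ℂ (horizPrim fun y => g y * wkbB g p n y) (strip κ) :=
      fun x hx => (hD.hasDerivAt_prim ihd ihb hx).differentiableAt.differentiableWithinAt
    refine ⟨((ihd.deriv (isOpen_strip κ)).add (hD.g_diff.mul hprim.neg)).neg.div hden hden0,
      fun x hx => ?_⟩
    have hx' : |x.im| < κ := hx
    set d : ℝ := κ - |x.im| with hd
    have hd0 : 0 < d := by linarith
    have hd1 : d ≤ 1 := by linarith [hD.κ_le_one, abs_nonneg x.im]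
    have hw := hD.weight.pos x.re
    have hW := hD.weight.integral_nonneg
    have hG := hD.G_nonneg
    have hc := hD.coeffBound_nonneg n hd0
    have h1 := hD.norm_deriv_le ihd ihb hx
    have h2 := hD.norm_prim_le ihb hx
    rw [← hd] at h1 h2
    have h3 : ‖deriv (wkbB g p n) x + g x * -horizPrim (fun y => g y * wkbB g p n y) x‖ ≤
        (6 * L + G ^ 2 * ∫ t, w t) * ((n + 1) / d * coeffBound L G p₀ w n d * w x.re) := by
      have h4 : ‖g x * -horizPrim (fun y => g y * wkbB g p n y) x‖ ≤
          (G * w x.re) * (G * coeffBound L G p₀ w n d * ∫ t, w t) := by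
        rw [norm_mul, norm_neg]
        gcongr
        exact hD.g_le x hx
      have h5 : coeffBound L G p₀ w n d ≤ (n + 1) / d * coeffBound L G p₀ w n d := by
        apply le_mul_of_one_le_left hc
        rw [le_div_iff₀ hd0]; linarith [show (0 : ℝ) ≤ n by positivity]
      calc _ ≤ _ := norm_add_le _ _
        _ ≤ 6 * L * (n + 1) / d * coeffBound L G p₀ w n d * w x.re
            + (G * w x.re) * (G * ((n + 1) / d * coeffBound L G p₀ w n d) * ∫ t, w t) := by
          gcongr
          refine h4.trans ?_
          gcongr
        _ = _ := by ring
    refine (hD.norm_div_two_I_mul_le hx h3).trans (le_of_eq ?_)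
    have hR : 6 * L + G ^ 2 * ∫ t, w t = rate L G p₀ w * (2 * p₀) := by
      unfold rate; field_simp
    rw [hR]
    unfold coeffBound
    rw [Nat.factorial_succ]
    push_cast
    field_simp
    ring

end WKBData

lemma hasDerivAt_setIntegral_Iic {w : ℝ → ℝ} (hc : Continuous w) (hi : Integrable w) (x : ℝ) :
    HasDerivAt (fun x => ∫ t in Iic x, w t) (w x) x := by
  have h : (fun x => ∫ t in Iic x, w t) = fun x => (∫ t in Iic (0 : ℝ), w t) + ∫ t in (0 : ℝ)..x, w t := by
    funext y
    rw [← intervalIntegral.integral_Iic_sub_Iic hi.integrableOn hi.integrableOn]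
    ring
  rw [h]
  exact (intervalIntegral.integral_hasDerivAt_right (hc.intervalIntegrable _ _)
    (hc.stronglyMeasurableAtFilter _ _) hc.continuousAt).const_add _

/-- Energy estimate for the first-order system with a source, starting from zero at `-∞`. -/
lemma norm_sq_add_norm_sq_le {L G ρ : ℝ} {w : ℝ → ℝ} (hw : SlowWeight L w) {g θ : ℝ → ℝ}
    (hg : ∀ x, |g x| ≤ G * w x) {u v R : ℝ → ℂ}
    (hu : ∀ x, HasDerivAt u (-(g x) * v x) x)
    (hv : ∀ x, HasDerivAt v (-(I * θ x) * v x - g x * u x + R x) x)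
    (hR : ∀ x, ‖R x‖ ≤ ρ * w x)
    (hu0 : Tendsto u atBot (𝓝 0)) (hv0 : Tendsto v atBot (𝓝 0)) (x : ℝ) :
    ‖u x‖ ^ 2 + ‖v x‖ ^ 2
      ≤ ρ ^ 2 * ((∫ t, w t) * Real.exp ((2 * G + 1) * ∫ t, w t)) := by
  have hG : 0 ≤ G := by
    have h1 := hg 0
    have h2 := hw.pos 0
    have h3 := abs_nonneg (g 0)
    by_contra h
    push Not at h
    nlinarith
  set k : ℝ := 2 * G + 1 with hk
  set Ω : ℝ → ℝ := fun x => ∫ t in Iic x, w t with hΩ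
  have hΩd : ∀ x, HasDerivAt Ω (w x) x := hasDerivAt_setIntegral_Iic hw.cont hw.integrable
  have hΩ0 : ∀ x, 0 ≤ Ω x := fun x => MeasureTheory.integral_nonneg fun t => (hw.pos t).le
  have hΩW : ∀ x, Ω x ≤ ∫ t, w t := fun x =>
    setIntegral_le_integral hw.integrable (Eventually.of_forall fun t => (hw.pos _).le)
  have hΩl : Tendsto Ω atBot (𝓝 0) := tendsto_integral_Iic_zero tendsto_id
  set E : ℝ → ℝ := fun x => ‖u x‖ ^ 2 + ‖v x‖ ^ 2 with hE
  have hEd : ∀ x, ∃ e, HasDerivAt E e x ∧ e ≤ k * w x * E x + ρ ^ 2 * w x := by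
    intro x
    refine ⟨_, (hu x).norm_sq.add (hv x).norm_sq, ?_⟩
    have hwx := hw.pos x
    have hi1 : 2 * inner ℝ (u x) (-(g x) * v x) +
        2 * inner ℝ (v x) (-(I * θ x) * v x - g x * u x + R x)
        = -4 * g x * inner ℝ (u x) (v x) + 2 * inner ℝ (v x) (R x) := by
      simp [Complex.inner]
      ring
    rw [hi1]
    have h1 : |inner ℝ (u x) (v x)| ≤ ‖u x‖ * ‖v x‖ := abs_real_inner_le_norm _ _
    have h2 : inner ℝ (v x) (R x) ≤ ‖v x‖ * (ρ * w x) :=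
      (real_inner_le_norm _ _).trans (by gcongr; exact hR x)
    have h3 : -4 * g x * inner ℝ (u x) (v x) ≤ 4 * ((G * w x) * (‖u x‖ * ‖v x‖)) := by
      calc -4 * g x * inner ℝ (u x) (v x) ≤ |-4 * g x * inner ℝ (u x) (v x)| := le_abs_self _
        _ = 4 * (|g x| * |inner ℝ (u x) (v x)|) := by
          rw [abs_mul, abs_mul]; norm_num; ring
        _ ≤ _ := by gcongr; exact hg x
    have h4 : 2 * (‖u x‖ * ‖v x‖) ≤ E x := by
      simp only [hE]; nlinarith [sq_nonneg (‖u x‖ - ‖v x‖)]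
    have h5 : 2 * (‖v x‖ * ρ) ≤ E x + ρ ^ 2 := by
      simp only [hE]; nlinarith [sq_nonneg (‖v x‖ - ρ), sq_nonneg ‖u x‖]
    have hGw : 0 ≤ G * w x := by positivity
    calc _ ≤ 4 * ((G * w x) * (‖u x‖ * ‖v x‖)) + 2 * (‖v x‖ * (ρ * w x)) := by gcongr
      _ = 2 * (G * w x) * (2 * (‖u x‖ * ‖v x‖)) + w x * (2 * (‖v x‖ * ρ)) := by ring
      _ ≤ 2 * (G * w x) * E x + w x * (E x + ρ ^ 2) := by gcongr
      _ = _ := by rw [hk]; ring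
  choose e hed hel using hEd
  set F : ℝ → ℝ := fun x => E x * Real.exp (-(k * Ω x)) - ρ ^ 2 * Ω x with hF
  have hk0 : 0 ≤ k := by positivity
  have hFd : ∀ x, HasDerivAt F (e x * Real.exp (-(k * Ω x))
      + E x * (Real.exp (-(k * Ω x)) * -(k * w x)) - ρ ^ 2 * w x) x := fun x =>
    ((hed x).mul ((hΩd x).const_mul k).neg.exp).sub ((hΩd x).const_mul _)
  have hanti : Antitone F := by
    refine antitone_of_hasDerivAt_nonpos hFd fun x => ?_
    have h1 : Real.exp (-(k * Ω x)) ≤ 1 := by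
      rw [Real.exp_le_one_iff]; have := mul_nonneg hk0 (hΩ0 x); linarith
    have h0 := Real.exp_pos (-(k * Ω x))
    have h2 : 0 ≤ ρ ^ 2 * w x := mul_nonneg (sq_nonneg _) (hw.pos x).le
    have h3 := mul_le_mul_of_nonneg_right (hel x) h0.le
    change _ ≤ (0 : ℝ)
    nlinarith
  have hEl : Tendsto E atBot (𝓝 0) := by
    simpa using (hu0.norm.pow 2).add (hv0.norm.pow 2)
  have hFl : Tendsto F atBot (𝓝 0) := by
    have := (hEl.mul ((hΩl.const_mul k).neg.rexp)).sub (hΩl.const_mul (ρ ^ 2))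
    simpa using this
  have hF0 : F x ≤ 0 :=
    ge_of_tendsto hFl ((eventually_le_atBot x).mono fun y hy => hanti hy)
  have hle : E x * Real.exp (-(k * Ω x)) ≤ ρ ^ 2 * Ω x := by
    simpa [hF] using hF0
  calc E x = E x * Real.exp (-(k * Ω x)) * Real.exp (k * Ω x) := by
        rw [mul_assoc, ← Real.exp_add]; simp
    _ ≤ ρ ^ 2 * Ω x * Real.exp (k * Ω x) := by gcongr
    _ ≤ ρ ^ 2 * (∫ t, w t) * Real.exp (k * ∫ t, w t) := by
      have h1 := hw.integral_nonneg
      have h2 := hΩW x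
      have h3 := hΩ0 x
      gcongr
    _ = _ := by ring

namespace WKBData
variable {κ L G p₀ : ℝ} {w : ℝ → ℝ} {g p : ℂ → ℂ}

lemma coeffBound_eq (n : ℕ) (κ : ℝ) : coeffBound L G p₀ w n κ =
    G / (2 * p₀) * ((rate L G p₀ w / κ) ^ n * (n.factorial : ℝ)) := by
  unfold coeffBound
  rw [div_pow]
  ring

lemma norm_wkbB_ofReal_le (hD : WKBData κ L G p₀ w g p) (n : ℕ) (x : ℝ) :
    ‖wkbB g p n x‖ ≤ coeffBound L G p₀ w n κ * w x := by
  simpa using (hD.wkbB_estimate n).2 x (ofReal_mem_strip hD.κ_pos x)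

lemma hasDerivAt_wkbA (hD : WKBData κ L G p₀ w g p) (n : ℕ) (x : ℝ) :
    HasDerivAt (fun x : ℝ => wkbA g p n x) (-g x * wkbB g p n x) x := by
  have h := (hD.hasDerivAt_prim (hD.wkbB_estimate n).1 (hD.wkbB_estimate n).2
    (ofReal_mem_strip hD.κ_pos x)).neg.comp_ofReal
  rw [neg_mul]
  exact h

lemma two_I_mul_wkbB_zero (hD : WKBData κ L G p₀ w g p) (x : ℝ) :
    2 * I * p x * wkbB g p 0 x = -g x := by
  have := hD.p_ne_zero (ofReal_mem_strip hD.κ_pos x)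
  simp only [wkbB]
  field_simp

lemma hasDerivAt_wkbB (hD : WKBData κ L G p₀ w g p) (n : ℕ) (x : ℝ) :
    HasDerivAt (fun x : ℝ => wkbB g p n x)
      (-g x * wkbA g p n x - 2 * I * p x * wkbB g p (n + 1) x) x := by
  have hx := ofReal_mem_strip hD.κ_pos x
  have h := (((hD.wkbB_estimate n).1).differentiableAt
    ((isOpen_strip κ).mem_nhds hx)).hasDerivAt.comp_ofReal
  convert h using 1
  have := hD.p_ne_zero hx
  simp only [wkbB, wkbA]
  field_simp
  ring

lemma integrable_mul_wkbB (hD : WKBData κ L G p₀ w g p) (n : ℕ) :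
    Integrable fun t : ℝ => g t * wkbB g p n t := by
  have h := integrable_horiz (x := 0) (κ := κ) (F := fun y => g y * wkbB g p n y)
    (M := G * coeffBound L G p₀ w n κ) hD.weight (by simpa using ofReal_mem_strip hD.κ_pos 0)
    (hD.g_diff.mul (hD.wkbB_estimate n).1).continuousOn (fun t => by
      simpa using hD.norm_mul_le (hD.wkbB_estimate n).2 (ofReal_mem_strip hD.κ_pos t))
  simpa using h

lemma norm_integral_le (hD : WKBData κ L G p₀ w g p) (n : ℕ) :
    ‖∫ t : ℝ, g t * wkbB g p n t‖ ≤ G * coeffBound L G p₀ w n κ * ∫ t, w t := by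
  rw [← integral_const_mul]
  refine norm_integral_le_of_norm_le (hD.weight.integrable.const_mul _)
    (Eventually.of_forall fun t => ?_)
  simpa using hD.norm_mul_le (hD.wkbB_estimate n).2 (ofReal_mem_strip hD.κ_pos t)

lemma tendsto_wkbB (hD : WKBData κ L G p₀ w g p) (n : ℕ) {l : Filter ℝ}
    (hl : Tendsto w l (𝓝 0)) : Tendsto (fun x : ℝ => wkbB g p n x) l (𝓝 0) :=
  squeeze_zero_norm (hD.norm_wkbB_ofReal_le n)
    (by simpa using hl.const_mul (coeffBound L G p₀ w n κ))

/-- The truncated expansions solve the system up to a small source term. -/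
lemma sum_wkb_identity (hD : WKBData κ L G p₀ w g p) {h : ℂ} (hh : h ≠ 0) (x : ℝ) (N : ℕ) :
    ∑ k ∈ Finset.range N, h ^ (k + 1)
        * (-g x * wkbA g p k x - 2 * I * p x * wkbB g p (k + 1) x)
      = -g x * (1 + ∑ k ∈ Finset.range N, h ^ (k + 1) * wkbA g p k x)
        - 2 * I * p x / h * ∑ k ∈ Finset.range N, h ^ (k + 1) * wkbB g p k x
        - h ^ N * (2 * I * p x * wkbB g p N x) := by
  induction N with
  | zero => simp [hD.two_I_mul_wkbB_zero x]
  | succ N ih =>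
    rw [Finset.sum_range_succ, ih, Finset.sum_range_succ, Finset.sum_range_succ]
    field_simp
    ring

/-- Gevrey expansion at `+∞` of the solutions which tend to `(1, 0)` at `-∞`. -/
theorem exists_gevrey_expansion (hD : WKBData κ L G p₀ w g p) {P : ℝ} {gr pr : ℝ → ℝ}
    (hgr : ∀ x : ℝ, g x = gr x) (hpr : ∀ x : ℝ, p x = pr x) (hP : ∀ x : ℝ, |pr x| ≤ P) :
    ∃ K > (0 : ℝ), ∃ M : ℝ, 0 ≤ M ∧ ∃ c : ℕ → ℂ,
      (∀ k, ‖c k‖ ≤ M * (K ^ k * (k.factorial : ℝ))) ∧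
      ∀ h : ℝ, 0 < h → ∀ a b : ℝ → ℂ,
        (∀ x, HasDerivAt a (-(gr x) * b x) x) →
        (∀ x, HasDerivAt b (-(I * (2 * pr x / h : ℝ)) * b x - gr x * a x) x) →
        Tendsto a atBot (𝓝 1) → Tendsto b atBot (𝓝 0) →
        ∀ N : ℕ, ∃ aN bN : ℝ → ℂ,
          (∀ x, ‖a x - aN x‖ ≤ M * ((K * h) ^ N * (N.factorial : ℝ))) ∧
          (∀ x, ‖b x - bN x‖ ≤ M * ((K * h) ^ N * (N.factorial : ℝ))) ∧
          Tendsto aN atTop (𝓝 (1 + ∑ k ∈ Finset.range N, c k * (h : ℂ) ^ (k + 1))) ∧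
          Tendsto bN atTop (𝓝 0) := by
  have hp₀ := hD.p₀_pos
  have hG := hD.G_nonneg
  have hκ := hD.κ_pos
  have hW := hD.weight.integral_nonneg
  have hrate := hD.rate_pos
  have hP0 : 0 ≤ P := (abs_nonneg _).trans (hP 0)
  set W : ℝ := ∫ t, w t with hWdef
  set K : ℝ := rate L G p₀ w / κ with hK
  have hK0 : 0 < K := by positivity
  set A₀ : ℝ := G * (G / (2 * p₀)) * W with hA₀
  set B₀ : ℝ := 2 * P * (G / (2 * p₀)) * Real.sqrt (W * Real.exp ((2 * G + 1) * W)) with hB₀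
  have hA₀0 : 0 ≤ A₀ := by positivity
  have hB₀0 : 0 ≤ B₀ := by positivity
  refine ⟨K, hK0, A₀ + B₀, by positivity, fun k => -∫ t : ℝ, g t * wkbB g p k t, fun k => ?_, ?_⟩
  · rw [norm_neg]
    refine (hD.norm_integral_le k).trans ?_
    rw [coeffBound_eq, ← hK]
    calc _ = A₀ * (K ^ k * (k.factorial : ℝ)) := by rw [hA₀]; ring
      _ ≤ _ := by gcongr; linarith
  intro h hh a b ha hb ha0 hb0 N
  have hhC : (h : ℂ) ≠ 0 := by exact_mod_cast hh.ne'
  set aN : ℝ → ℂ := fun x => 1 + ∑ k ∈ Finset.range N, (h : ℂ) ^ (k + 1) * wkbA g p k x with haN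
  set bN : ℝ → ℂ := fun x => ∑ k ∈ Finset.range N, (h : ℂ) ^ (k + 1) * wkbB g p k x with hbN
  have haNd : ∀ x, HasDerivAt aN (-(gr x) * bN x) x := by
    intro x
    have h1 := (HasDerivAt.fun_sum (u := Finset.range N) fun k _ =>
      (hD.hasDerivAt_wkbA k x).const_mul ((h : ℂ) ^ (k + 1))).const_add 1
    refine h1.congr_deriv ?_
    simp only [hbN]
    rw [Finset.mul_sum, ← hgr]
    exact Finset.sum_congr rfl fun k _ => by ring
  have hbNd : ∀ x, HasDerivAt bN (-(I * (2 * pr x / h : ℝ)) * bN x - gr x * aN x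
      - (h : ℂ) ^ N * (2 * I * p x * wkbB g p N x)) x := by
    intro x
    have h1 := (HasDerivAt.fun_sum (u := Finset.range N) fun k _ =>
      (hD.hasDerivAt_wkbB k x).const_mul ((h : ℂ) ^ (k + 1)))
    refine h1.congr_deriv ?_
    rw [hD.sum_wkb_identity hhC x N, ← hgr]
    simp only [haN, hbN, hpr]
    push_cast
    ring
  have haN0 : Tendsto aN atBot (𝓝 1) := by
    have h1 : Tendsto aN atBot
        (𝓝 (1 + ∑ k ∈ Finset.range N, (h : ℂ) ^ (k + 1) * -0)) :=
      tendsto_const_nhds.add (tendsto_finsetSum _ fun k _ =>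
        (tendsto_horizPrim_atBot (fun y => g y * wkbB g p k y)).neg.const_mul _)
    simpa using h1
  have hbNl : ∀ l : Filter ℝ, Tendsto w l (𝓝 0) → Tendsto bN l (𝓝 0) := by
    intro l hl
    have h1 : Tendsto bN l (𝓝 (∑ k ∈ Finset.range N, (h : ℂ) ^ (k + 1) * 0)) :=
      tendsto_finsetSum _ fun k _ => (hD.tendsto_wkbB k hl).const_mul _
    simpa using h1
  have hen := norm_sq_add_norm_sq_le (G := G) (g := gr) (θ := fun x => 2 * pr x / h)
    (ρ := 2 * P * coeffBound L G p₀ w N κ * h ^ N)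
    (u := fun x => a x - aN x) (v := fun x => b x - bN x)
    (R := fun x => (h : ℂ) ^ N * (2 * I * p x * wkbB g p N x)) hD.weight
    (fun x => by
      have := hD.g_le x (ofReal_mem_strip hκ x)
      rw [hgr] at this
      simpa using this)
    (fun x => ((ha x).sub (haNd x)).congr_deriv (by ring))
    (fun x => ((hb x).sub (hbNd x)).congr_deriv (by push_cast; ring))
    (fun x => by
      have h1 := hD.norm_wkbB_ofReal_le N x
      have h2 : ‖p x‖ ≤ P := by rw [hpr]; simpa using hP x
      calc ‖(h : ℂ) ^ N * (2 * I * p x * wkbB g p N x)‖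
          = h ^ N * (2 * ‖p x‖ * ‖wkbB g p N x‖) := by
            simp [abs_of_pos hh]
        _ ≤ h ^ N * (2 * P * (coeffBound L G p₀ w N κ * w x)) := by gcongr
        _ = _ := by ring)
    (by simpa using ha0.sub haN0)
    (by simpa using hb0.sub (hbNl _ hD.weight.tendsto_atBot))
  have hρ : 0 ≤ 2 * P * coeffBound L G p₀ w N κ * h ^ N := by
    have := hD.coeffBound_nonneg N hκ
    positivity
  have hfin : ∀ x, ‖a x - aN x‖ ≤ (A₀ + B₀) * ((K * h) ^ N * (N.factorial : ℝ)) ∧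
      ‖b x - bN x‖ ≤ (A₀ + B₀) * ((K * h) ^ N * (N.factorial : ℝ)) := by
    intro x
    have h1 := hen x
    have h2 : 2 * P * coeffBound L G p₀ w N κ * h ^ N
        * Real.sqrt (W * Real.exp ((2 * G + 1) * W))
        ≤ (A₀ + B₀) * ((K * h) ^ N * (N.factorial : ℝ)) := by
      rw [coeffBound_eq, ← hK]
      calc _ = B₀ * ((K * h) ^ N * (N.factorial : ℝ)) := by rw [hB₀, mul_pow]; ring
        _ ≤ _ := by gcongr; linarith
    have h3 : ∀ y : ℝ, 0 ≤ y → y ^ 2 ≤ (2 * P * coeffBound L G p₀ w N κ * h ^ N) ^ 2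
        * (W * Real.exp ((2 * G + 1) * W)) → y ≤ (A₀ + B₀) * ((K * h) ^ N * (N.factorial : ℝ)) := by
      intro y hy hy2
      refine le_trans (le_of_sq_le_sq ?_ (by positivity)) h2
      rw [mul_pow, Real.sq_sqrt (by positivity)]
      exact hy2
    exact ⟨h3 _ (norm_nonneg _) (by nlinarith [sq_nonneg ‖b x - bN x‖]),
      h3 _ (norm_nonneg _) (by nlinarith [sq_nonneg ‖a x - aN x‖])⟩
  refine ⟨aN, bN, fun x => (hfin x).1, fun x => (hfin x).2, ?_, hbNl _ hD.weight.tendsto_atTop⟩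
  refine tendsto_const_nhds.add (tendsto_finsetSum _ fun k _ => ?_)
  rw [mul_comm]
  exact (tendsto_horizPrim_atTop (F := fun y => g y * wkbB g p k y)
    (hD.integrable_mul_wkbB k)).neg.const_mul _

end WKBData

lemma slowWeight_rpow {δ : ℝ} (hδ : 1 < δ) :
    SlowWeight (3 ^ (δ / 2)) fun t : ℝ => (1 + t ^ 2) ^ (-(δ / 2)) := by
  have hpos : ∀ t : ℝ, 0 < 1 + t ^ 2 := fun t => by positivity
  have htop : Tendsto (fun y : ℝ => (1 + y) ^ (-(δ / 2))) atTop (𝓝 0) :=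
    (tendsto_rpow_neg_atTop (by linarith)).comp (tendsto_atTop_add_const_left _ _ tendsto_id)
  refine ⟨fun t => Real.rpow_pos_of_pos (hpos t) _, fun t => ?_, ?_, ?_, fun s t hst => ?_, ?_, ?_⟩
  · exact Real.rpow_le_one_of_one_le_of_nonpos (by nlinarith [sq_nonneg t]) (by linarith)
  · exact Continuous.rpow_const (by fun_prop) fun t => Or.inl (hpos t).ne'
  · have := integrable_rpow_neg_one_add_norm_sq (E := ℝ) (μ := volume) (r := δ) (by simpa using hδ)
    refine this.congr (Eventually.of_forall fun t => ?_)
    simp [neg_div]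
  · have h1 : 1 + t ^ 2 ≤ 3 * (1 + s ^ 2) := by
      have := abs_le.1 hst
      nlinarith [sq_nonneg (t - 2 * s), sq_nonneg (s - t), sq_nonneg t]
    have h2 : (1 + t ^ 2) ^ (δ / 2) ≤ 3 ^ (δ / 2) * (1 + s ^ 2) ^ (δ / 2) := by
      rw [← Real.mul_rpow (by norm_num) (hpos s).le]
      exact Real.rpow_le_rpow (hpos t).le h1 (by linarith)
    have h3 := Real.rpow_pos_of_pos (hpos t) (δ / 2)
    have h4 := Real.rpow_pos_of_pos (hpos s) (δ / 2)
    rw [Real.rpow_neg (hpos s).le, Real.rpow_neg (hpos t).le, ← div_eq_mul_inv,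
      inv_le_iff_one_le_mul₀ h4, div_mul_eq_mul_div, one_le_div h3]
    exact h2
  · exact htop.comp (tendsto_pow_atTop (by norm_num))
  · refine htop.comp ?_
    have := (tendsto_pow_atTop (α := ℝ) (n := 2) (by norm_num)).comp tendsto_neg_atBot_atTop
    refine this.congr fun t => by simp

/-- A potential, holomorphic in a strip, which tends to constants at infinity at a rate given by
a slowly varying weight. -/
structure PotentialBounds (κ L C : ℝ) (w : ℝ → ℝ) (V : ℂ → ℂ) (Vm Vp : ℝ) : Prop where
  weight : SlowWeight L w
  κ_pos : 0 < κ
  κ_le_one : κ ≤ 1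
  C_nonneg : 0 ≤ C
  diff : DifferentiableOn ℂ V (strip κ)
  real : ∀ x : ℝ, (V x).im = 0
  deriv_le : ∀ x ∈ strip κ, ‖deriv V x‖ ≤ C * w x.re
  right : ∀ x : ℝ, 0 ≤ x → |(V x).re - Vp| ≤ C * w x
  left : ∀ x : ℝ, x ≤ 0 → |(V x).re - Vm| ≤ C * w x

lemma AssumptionA.exists_potentialBounds {V : ℂ → ℂ} {Vm Vp : ℝ} (hA : AssumptionA V Vm Vp) :
    ∃ (κ L C : ℝ) (w : ℝ → ℝ), PotentialBounds κ L C w V Vm Vp := by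
  obtain ⟨ε, hε, η, hη, δ, hδ, hV, ⟨Cp, Rp, hp⟩, ⟨Cm, Rm, hm⟩⟩ := hA.sector
  set w : ℝ → ℝ := fun t => (1 + t ^ 2) ^ (-(δ / 2)) with hw
  have hW : SlowWeight (3 ^ (δ / 2)) w := slowWeight_rpow hδ
  set L : ℝ := 3 ^ (δ / 2) with hL
  have hL1 := hW.one_le
  have hsub : strip η ⊆ Sector ε η := fun x hx => by
    have h1 : |x.im| < η := hx
    have h2 : 0 ≤ ε * |x.re| := by positivity
    change |x.im| < ε * |x.re| + η
    linarith
  have hVd : DifferentiableOn ℂ V (strip η) := fun x hx =>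
    (hV x (hsub hx)).differentiableAt.differentiableWithinAt
  have hVd' : ContinuousOn (deriv V) (strip η) := (hVd.deriv (isOpen_strip η)).continuousOn
  have hww : ∀ (C : ℝ) (x : ℂ), C * (1 + ‖x‖ ^ 2) ^ (-(δ / 2)) ≤ |C| * w x.re := by
    intro C x
    have h1 : (1 + ‖x‖ ^ 2) ^ (-(δ / 2)) ≤ w x.re := by
      apply Real.rpow_le_rpow_of_nonpos (by positivity) _ (by linarith)
      have := Complex.abs_re_le_norm x
      have : x.re ^ 2 ≤ ‖x‖ ^ 2 := sq_le_sq' (by linarith [neg_abs_le x.re]) (by linarith [le_abs_self x.re])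
      linarith
    have h2 : 0 ≤ (1 + ‖x‖ ^ 2) ^ (-(δ / 2)) := Real.rpow_nonneg (by positivity) _
    calc _ ≤ |C| * (1 + ‖x‖ ^ 2) ^ (-(δ / 2)) := by gcongr; exact le_abs_self C
      _ ≤ _ := by gcongr
  set r : ℝ := min 1 (η / 4) with hr
  have hr0 : 0 < r := by apply lt_min <;> linarith
  have hr1 : r ≤ 1 := min_le_left _ _
  have hrη : r ≤ η / 4 := min_le_right _ _
  -- bound near infinity
  have hfar : ∀ (C : ℝ) (W₀ : ℂ) (x : ℂ), |x.im| < r →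
      (∀ y ∈ Sector ε η, ‖y - x‖ = r → ‖V y - W₀‖ ≤ C * (1 + ‖y‖ ^ 2) ^ (-(δ / 2))) →
      ‖deriv V x‖ ≤ L * |C| / r * w x.re := by
    intro C W₀ x hx hb
    have h1 := norm_deriv_le_of_weight (F := fun y => V y - W₀) (x := x) hW hr0 hr1
      (by linarith : |x.im| + r < η) (abs_nonneg C) (hVd.sub_const _) (fun y hy => by
        have h4 : |y.im - x.im| ≤ r := by
          rw [← hy]; simpa using Complex.abs_im_le_norm (y - x)
        have h5 : |y.im| ≤ |x.im| + |y.im - x.im| := by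
          calc |y.im| = |x.im + (y.im - x.im)| := by ring_nf
            _ ≤ _ := abs_add_le _ _
        exact (hb y (hsub (by change |y.im| < η; linarith)) hy).trans (hww C y))
    simpa using h1
  -- bound on compact sets
  set T : ℝ := |Rp| + |Rm| + 1 with hT
  have hKc : IsCompact (Icc (-T) T ×ℂ Icc (-r) r) := isCompact_Icc.reProdIm isCompact_Icc
  have hKs : Icc (-T) T ×ℂ Icc (-r) r ⊆ strip η := fun x hx => by
    have h1 := (mem_reProdIm.1 hx).2
    have h2 : |x.im| ≤ r := abs_le.2 h1
    change |x.im| < η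
    linarith
  have hwinv : Continuous fun x : ℂ => (((w x.re)⁻¹ : ℝ) : ℂ) :=
    Complex.continuous_ofReal.comp
      ((hW.cont.comp Complex.continuous_re).inv₀ fun x => (hW.pos _).ne')
  obtain ⟨D₁, hD₁⟩ := hKc.exists_bound_of_continuousOn
    ((hVd'.mono hKs).mul hwinv.continuousOn)
  have hVc : Continuous fun x : ℝ => V x :=
    hVd.continuousOn.comp_continuous Complex.continuous_ofReal fun x => ofReal_mem_strip hη x
  have hreal : ∀ W₀ : ℝ, ∃ D : ℝ, ∀ x ∈ Icc (-T) T, |(V x).re - W₀| ≤ D * w x := by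
    intro W₀
    have hc : Continuous fun x : ℝ => ((V x).re - W₀) * (w x)⁻¹ :=
      ((Complex.continuous_re.comp hVc).sub continuous_const).mul
        (hW.cont.inv₀ fun x => (hW.pos _).ne')
    obtain ⟨D, hD⟩ := (isCompact_Icc (a := -T) (b := T)).exists_bound_of_continuousOn
      hc.continuousOn
    refine ⟨D, fun x hx => ?_⟩
    have h1 := hD x hx
    have h2 := hW.pos x
    rw [Real.norm_eq_abs, abs_mul, abs_of_pos (inv_pos.2 h2)] at h1
    rwa [← div_eq_mul_inv, div_le_iff₀ h2] at h1
  obtain ⟨Dp, hDp⟩ := hreal Vp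
  obtain ⟨Dm, hDm⟩ := hreal Vm
  have hre : ∀ (x : ℝ) (W₀ : ℝ), |(V x).re - W₀| ≤ ‖V x - (W₀ : ℂ)‖ := fun x W₀ => by
    simpa using Complex.abs_re_le_norm (V x - (W₀ : ℂ))
  set C : ℝ := L * |Cp| / r + L * |Cm| / r + |D₁| + |Dp| + |Dm| + |Cp| + |Cm| with hC
  have i1 : 0 ≤ L * |Cp| / r := by positivity
  have i2 : 0 ≤ L * |Cm| / r := by positivity
  have i3 := abs_nonneg D₁
  have i4 := abs_nonneg Dp
  have i5 := abs_nonneg Dm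
  have i6 := abs_nonneg Cp
  have i7 := abs_nonneg Cm
  have j1 := le_abs_self Rp
  have j2 := abs_nonneg Rp
  have j3 := le_abs_self Rm
  have j4 := abs_nonneg Rm
  refine ⟨r, L, C, w, hW, hr0, hr1, by positivity, hVd.mono (strip_mono (by linarith)),
    hA.real_on_real, fun x hx => ?_, fun x hx => ?_, fun x hx => ?_⟩
  · have hx' : |x.im| < r := hx
    have hwx := hW.pos x.re
    rcases le_or_gt x.re T with h1 | h1
    · rcases le_or_gt (-T) x.re with h2 | h2
      · have h3 := hD₁ x (mem_reProdIm.2 ⟨⟨h2, h1⟩, abs_le.1 hx'.le⟩)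
        rw [Pi.mul_apply, norm_mul, Complex.norm_real, Real.norm_eq_abs, abs_of_pos (inv_pos.2 hwx),
          ← div_eq_mul_inv, div_le_iff₀ hwx] at h3
        refine h3.trans ?_
        gcongr
        linarith [le_abs_self D₁]
      · refine (hfar Cm Vm x hx' fun y hy hyx => hm y hy ?_).trans ?_
        · have := Complex.abs_re_le_norm (y - x)
          rw [hyx, sub_re, abs_le] at this
          linarith
        · gcongr; linarith
    · refine (hfar Cp Vp x hx' fun y hy hyx => hp y hy ?_).trans ?_
      · have := Complex.abs_re_le_norm (y - x)
        rw [hyx, sub_re, abs_le] at this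
        linarith
      · gcongr; linarith
  · have hwx := hW.pos x
    rcases le_or_gt x T with h1 | h1
    · refine (hDp x ⟨by linarith, h1⟩).trans ?_
      gcongr; linarith [le_abs_self Dp]
    · refine ((hre x Vp).trans (hp x (hsub (ofReal_mem_strip hη x)) (by simp; linarith))).trans
        ((hww Cp x).trans ?_)
      simp only [ofReal_re]
      gcongr; linarith
  · have hwx := hW.pos x
    rcases le_or_gt (-T) x with h1 | h1
    · refine (hDm x ⟨h1, by linarith⟩).trans ?_
      gcongr; linarith [le_abs_self Dm]
    · refine ((hre x Vm).trans (hm x (hsub (ofReal_mem_strip hη x)) (by simp; linarith))).trans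
        ((hww Cm x).trans ?_)
      simp only [ofReal_re]
      gcongr; linarith

namespace PotentialBounds
variable {κ L C : ℝ} {w : ℝ → ℝ} {V : ℂ → ℂ} {Vm Vp : ℝ}

lemma ofReal_re_eq (hV : PotentialBounds κ L C w V Vm Vp) (x : ℝ) : (((V x).re : ℝ) : ℂ) = V x :=
  Complex.ext (by simp) (by simp [hV.real x])

lemma continuous_re (hV : PotentialBounds κ L C w V Vm Vp) : Continuous fun x : ℝ => (V x).re :=
  Complex.continuous_re.comp
    (hV.diff.continuousOn.comp_continuous Complex.continuous_ofReal fun x =>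
      ofReal_mem_strip hV.κ_pos x)

lemma hasDerivAt_ofReal (hV : PotentialBounds κ L C w V Vm Vp) (x : ℝ) :
    HasDerivAt (fun y : ℝ => V y) (deriv V x) x :=
  ((hV.diff.differentiableAt ((isOpen_strip κ).mem_nhds
    (ofReal_mem_strip hV.κ_pos x))).hasDerivAt).comp_ofReal

lemma hasDerivAt_re (hV : PotentialBounds κ L C w V Vm Vp) (x : ℝ) :
    HasDerivAt (fun y : ℝ => (V y).re) (deriv V x).re x := by
  exact Complex.reCLM.hasFDerivAt.comp_hasDerivAt x (hV.hasDerivAt_ofReal x)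

lemma deriv_im (hV : PotentialBounds κ L C w V Vm Vp) (x : ℝ) : (deriv V x).im = 0 := by
  have h1 : HasDerivAt (fun y : ℝ => (V y).im) (deriv V x).im x := by
    exact Complex.imCLM.hasFDerivAt.comp_hasDerivAt x (hV.hasDerivAt_ofReal x)
  have h2 : (fun y : ℝ => (V y).im) = fun _ => 0 := funext hV.real
  rw [h2] at h1
  exact h1.unique (hasDerivAt_const x 0)

lemma tendsto_atTop (hV : PotentialBounds κ L C w V Vm Vp) :
    Tendsto (fun x : ℝ => (V x).re) atTop (𝓝 Vp) := by
  rw [tendsto_iff_norm_sub_tendsto_zero]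
  refine squeeze_zero' (Eventually.of_forall fun x => norm_nonneg _) ?_
    (by simpa using hV.weight.tendsto_atTop.const_mul C)
  filter_upwards [eventually_ge_atTop 0] with x hx using hV.right x hx

lemma tendsto_atBot (hV : PotentialBounds κ L C w V Vm Vp) :
    Tendsto (fun x : ℝ => (V x).re) atBot (𝓝 Vm) := by
  rw [tendsto_iff_norm_sub_tendsto_zero]
  refine squeeze_zero' (Eventually.of_forall fun x => norm_nonneg _) ?_
    (by simpa using hV.weight.tendsto_atBot.const_mul C)
  filter_upwards [eventually_le_atBot 0] with x hx using hV.left x hx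

lemma abs_re_le (hV : PotentialBounds κ L C w V Vm Vp) (x : ℝ) :
    |(V x).re| ≤ |Vm| + |Vp| + C := by
  have hw := mul_le_mul_of_nonneg_left (hV.weight.le_one x) hV.C_nonneg
  have h1 := abs_nonneg Vm
  have h2 := abs_nonneg Vp
  rcases le_total 0 x with hx | hx
  · have := abs_sub_abs_le_abs_sub (V x).re Vp
    linarith [hV.right x hx]
  · have := abs_sub_abs_le_abs_sub (V x).re Vm
    linarith [hV.left x hx]

end PotentialBounds

/-- A positive continuous function on the line with positive limits at both ends is bounded below
by a positive constant. -/
lemma exists_pos_lower_bound {f : ℝ → ℝ} (hf : Continuous f) (hpos : ∀ x, 0 < f x) {a b : ℝ}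
    (ha : 0 < a) (hb : 0 < b) (hbot : Tendsto f atBot (𝓝 a)) (htop : Tendsto f atTop (𝓝 b)) :
    ∃ ν > 0, ∀ x, ν ≤ f x := by
  obtain ⟨R₁, h₁⟩ := eventually_atBot.1 (hbot.eventually (lt_mem_nhds (half_lt_self ha)))
  obtain ⟨R₂, h₂⟩ := eventually_atTop.1 (htop.eventually (lt_mem_nhds (half_lt_self hb)))
  set R := |R₁| + |R₂|
  have i1 := neg_abs_le R₁
  have i2 := le_abs_self R₂
  have i3 := abs_nonneg R₁
  have i4 := abs_nonneg R₂
  obtain ⟨y, -, hy⟩ := (isCompact_Icc (a := -R) (b := R)).exists_isMinOn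
    ⟨0, by simp only [mem_Icc, R]; constructor <;> linarith⟩ hf.continuousOn
  refine ⟨min (f y) (min (a / 2) (b / 2)),
    lt_min (hpos y) (lt_min (half_pos ha) (half_pos hb)), fun x => ?_⟩
  rcases lt_or_ge x (-R) with hx | hx
  · exact (min_le_right _ _).trans ((min_le_left _ _).trans (h₁ x (by simp only [R] at hx; linarith)).le)
  rcases lt_or_ge R x with hx' | hx'
  · exact (min_le_right _ _).trans ((min_le_right _ _).trans (h₂ x (by simp only [R] at hx'; linarith)).le)
  · exact (min_le_left _ _).trans (hy ⟨hx, hx'⟩)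

lemma PotentialBounds.exists_gap {κ L C : ℝ} {w : ℝ → ℝ} {V : ℂ → ℂ} {Vm Vp : ℝ}
    (hV : PotentialBounds κ L C w V Vm Vp) (hlt : Vm < Vp) {m c E : ℝ}
    (hE : Vp + m * c ^ 2 < E)
    (hnozero : ∀ x : ℝ, m ^ 2 * c ^ 4 - ((V x).re - E) ^ 2 ≠ 0) :
    ∃ ν > 0, ∀ x : ℝ, m * c ^ 2 + 2 * ν ≤ E - (V x).re := by
  set f : ℝ → ℝ := fun x => E - (V x).re - m * c ^ 2 with hf
  have hfc : Continuous f := (continuous_const.sub hV.continuous_re).sub continuous_const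
  have htop : Tendsto f atTop (𝓝 (E - Vp - m * c ^ 2)) :=
    (tendsto_const_nhds.sub hV.tendsto_atTop).sub_const _
  have hbot : Tendsto f atBot (𝓝 (E - Vm - m * c ^ 2)) :=
    (tendsto_const_nhds.sub hV.tendsto_atBot).sub_const _
  have hpos : ∀ x, 0 < f x := by
    intro x
    by_contra! hx
    obtain ⟨y, hy⟩ := (htop.eventually (lt_mem_nhds (by linarith : 0 < E - Vp - m * c ^ 2))).exists
    obtain ⟨t, ht⟩ := mem_range_of_exists_le_of_exists_ge hfc ⟨x, hx⟩ ⟨y, hy.le⟩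
    apply hnozero t
    have : (V t).re - E = -(m * c ^ 2) := by simp only [hf] at ht; linarith
    rw [this]; ring
  obtain ⟨ν, hν, h⟩ := exists_pos_lower_bound hfc hpos (by linarith) (by linarith) hbot htop
  refine ⟨ν / 2, half_pos hν, fun x => ?_⟩
  have := h x
  simp only [hf] at this
  linarith

/-- The coupling coefficient between the two WKB amplitudes. -/
noncomputable def dirCoupling (m c E : ℝ) (V : ℂ → ℂ) (x : ℂ) : ℂ :=
  (m * c ^ 2 : ℝ) * deriv V x / (2 * ((E - V x - (m * c ^ 2 : ℝ)) * (E - V x + (m * c ^ 2 : ℝ))))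

/-- The classical momentum, continued to a strip. -/
noncomputable def dirMomentum (m c E : ℝ) (V : ℂ → ℂ) (x : ℂ) : ℂ :=
  exp ((log (E - V x - (m * c ^ 2 : ℝ)) + log (E - V x + (m * c ^ 2 : ℝ))) / 2) / c

/-- The coupling coefficient on the real line. -/
noncomputable def realCoupling (m c E : ℝ) (V : ℂ → ℂ) (x : ℝ) : ℝ :=
  m * c ^ 2 * (deriv V x).re / (2 * ((E - (V x).re - m * c ^ 2) * (E - (V x).re + m * c ^ 2)))

/-- The classical momentum on the real line. -/
noncomputable def realMomentum (m c E : ℝ) (V : ℂ → ℂ) (x : ℝ) : ℝ :=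
  Real.sqrt ((-(m ^ 2 * c ^ 4) + ((V x).re - E) ^ 2) / c ^ 2)

lemma convex_strip (κ : ℝ) : Convex ℝ (strip κ) := by
  have : strip κ = Complex.imCLM ⁻¹' Ioo (-κ) κ := by
    ext x; simp [strip, abs_lt]
  rw [this]
  exact (convex_Ioo _ _).linear_preimage Complex.imCLM.toLinearMap

namespace PotentialBounds
variable {κ L C : ℝ} {w : ℝ → ℝ} {V : ℂ → ℂ} {Vm Vp : ℝ}

lemma norm_sub_re_le (hV : PotentialBounds κ L C w V Vm Vp) {x : ℂ} (hx : x ∈ strip κ) :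
    ‖V x - V x.re‖ ≤ C * |x.im| := by
  have h1 := (convex_strip κ).norm_image_sub_le_of_norm_deriv_le (f := V) (C := C)
    (x := (x.re : ℂ)) (y := x)
    (fun y hy => hV.diff.differentiableAt ((isOpen_strip κ).mem_nhds hy))
    (fun y hy => (hV.deriv_le y hy).trans
      (by simpa using mul_le_mul_of_nonneg_left (hV.weight.le_one y.re) hV.C_nonneg))
    (ofReal_mem_strip hV.κ_pos _) hx
  have h2 : x - x.re = x.im * I := by
    apply Complex.ext <;> simp
  rw [h2] at h1
  simpa using h1

lemma exists_wkbData (hV : PotentialBounds κ L C w V Vm Vp) {m c E ν : ℝ} (hm : 0 ≤ m) (hc : 0 < c)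
    (hν : 0 < ν) (hgap : ∀ x : ℝ, m * c ^ 2 + 2 * ν ≤ E - (V x).re) :
    ∃ κ' G p₀ : ℝ, WKBData κ' L G p₀ w (dirCoupling m c E V) (dirMomentum m c E V) := by
  have hμ : 0 ≤ m * c ^ 2 := by positivity
  have hC := hV.C_nonneg
  set κ' := min κ (ν / (C + 1)) with hκ'
  have hκ0 : 0 < κ' := lt_min hV.κ_pos (by positivity)
  have hsub : strip κ' ⊆ strip κ := strip_mono (min_le_left _ _)
  have hre : ∀ x ∈ strip κ', m * c ^ 2 + ν ≤ (E - V x).re := by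
    intro x hx
    have h1 := hV.norm_sub_re_le (hsub hx)
    have hx' : |x.im| < κ' := hx
    have h2 : C * |x.im| ≤ ν := by
      have : |x.im| ≤ ν / (C + 1) := hx'.le.trans (min_le_right _ _)
      calc C * |x.im| ≤ (C + 1) * (ν / (C + 1)) := by gcongr; linarith
        _ = ν := by field_simp
    have h3 := (abs_le.1 ((Complex.abs_re_le_norm _).trans (h1.trans h2))).2
    have h4 := hgap x.re
    simp only [sub_re, ofReal_re] at h3 ⊢
    linarith
  have hre1 : ∀ x ∈ strip κ', ν ≤ (E - V x - (m * c ^ 2 : ℝ)).re := fun x hx => by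
    have := hre x hx
    rw [sub_re, ofReal_re]; linarith
  have hre2 : ∀ x ∈ strip κ', ν ≤ (E - V x + (m * c ^ 2 : ℝ)).re := fun x hx => by
    have := hre x hx
    rw [add_re, ofReal_re]; linarith
  have hn1 : ∀ x ∈ strip κ', ν ≤ ‖E - V x - (m * c ^ 2 : ℝ)‖ := fun x hx =>
    (hre1 x hx).trans (Complex.re_le_norm _)
  have hn2 : ∀ x ∈ strip κ', ν ≤ ‖E - V x + (m * c ^ 2 : ℝ)‖ := fun x hx =>
    (hre2 x hx).trans (Complex.re_le_norm _)
  have h01 : ∀ x ∈ strip κ', E - V x - (m * c ^ 2 : ℝ) ≠ 0 := fun x hx =>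
    norm_pos_iff.1 (hν.trans_le (hn1 x hx))
  have h02 : ∀ x ∈ strip κ', E - V x + (m * c ^ 2 : ℝ) ≠ 0 := fun x hx =>
    norm_pos_iff.1 (hν.trans_le (hn2 x hx))
  have hVd := hV.diff.mono hsub
  have hd1 : DifferentiableOn ℂ (fun x => E - V x - (m * c ^ 2 : ℝ)) (strip κ') :=
    (hVd.const_sub _).sub_const _
  have hd2 : DifferentiableOn ℂ (fun x => E - V x + (m * c ^ 2 : ℝ)) (strip κ') :=
    (hVd.const_sub _).add_const _
  refine ⟨κ', m * c ^ 2 * C / (2 * (ν * ν)), ν / c, hV.weight, hκ0,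
    (min_le_left _ _).trans hV.κ_le_one, by positivity, by positivity, ?_, ?_, ?_, ?_⟩
  · refine DifferentiableOn.div ((hVd.deriv (isOpen_strip _)).const_mul _)
      ((hd1.mul hd2).const_mul 2) fun x hx => ?_
    exact mul_ne_zero two_ne_zero (mul_ne_zero (h01 x hx) (h02 x hx))
  · refine DifferentiableOn.div_const (DifferentiableOn.cexp (DifferentiableOn.div_const
      (DifferentiableOn.add (hd1.clog fun x hx => ?_) (hd2.clog fun x hx => ?_)) _)) _
    · exact Or.inl (hν.trans_le (hre1 x hx))
    · exact Or.inl (hν.trans_le (hre2 x hx))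
  · intro x hx
    have h1 := hn1 x hx
    have h2 := hn2 x hx
    have h3 := hV.deriv_le x (hsub hx)
    have h4 := hV.weight.pos x.re
    rw [dirCoupling, norm_div, norm_mul, norm_mul, norm_mul, Complex.norm_real, Real.norm_eq_abs,
      abs_of_nonneg hμ, Complex.norm_ofNat]
    calc m * c ^ 2 * ‖deriv V x‖ / (2 * (‖E - V x - (m * c ^ 2 : ℝ)‖ * ‖E - V x + (m * c ^ 2 : ℝ)‖))
        ≤ m * c ^ 2 * (C * w x.re) / (2 * (ν * ν)) := by gcongr
      _ = _ := by ring
  · intro x hx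
    rw [dirMomentum, norm_div, Complex.norm_exp, Complex.norm_real, Real.norm_eq_abs,
      abs_of_pos hc]
    gcongr
    have h1 := Real.log_le_log hν (hn1 x hx)
    have h2 := Real.log_le_log hν (hn2 x hx)
    have h3 : ((log (E - V x - (m * c ^ 2 : ℝ)) + log (E - V x + (m * c ^ 2 : ℝ))) / 2).re =
        (Real.log ‖E - V x - (m * c ^ 2 : ℝ)‖ + Real.log ‖E - V x + (m * c ^ 2 : ℝ)‖) / 2 := by
      rw [← Complex.log_re, ← Complex.log_re, ← add_re]
      simp
    rw [h3]
    calc ν = Real.exp (Real.log ν) := (Real.exp_log hν).symm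
      _ ≤ _ := Real.exp_le_exp.2 (by linarith)

lemma dirCoupling_ofReal (hV : PotentialBounds κ L C w V Vm Vp) (m c E : ℝ) (x : ℝ) :
    dirCoupling m c E V x = realCoupling m c E V x := by
  have h1 : (((deriv V x).re : ℝ) : ℂ) = deriv V x :=
    Complex.ext (by simp) (by simp [hV.deriv_im x])
  rw [dirCoupling, ← h1, ← hV.ofReal_re_eq x, realCoupling]
  push_cast
  ring

lemma dirMomentum_ofReal (hV : PotentialBounds κ L C w V Vm Vp) {m c E ν : ℝ} (hm : 0 ≤ m)
    (hc : 0 < c) (hν : 0 < ν) (hgap : ∀ x : ℝ, m * c ^ 2 + 2 * ν ≤ E - (V x).re) (x : ℝ) :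
    dirMomentum m c E V x = realMomentum m c E V x := by
  have hμ : 0 ≤ m * c ^ 2 := by positivity
  have h1 : 0 < E - (V x).re - m * c ^ 2 := by linarith [hgap x]
  have h2 : 0 < E - (V x).re + m * c ^ 2 := by linarith [hgap x]
  have h3 : realMomentum m c E V x =
      Real.exp ((Real.log (E - (V x).re - m * c ^ 2) + Real.log (E - (V x).re + m * c ^ 2)) / 2)
        / c := by
    rw [realMomentum, Real.sqrt_div' _ (sq_nonneg c), Real.sqrt_sq hc.le, ← Real.log_mul h1.ne' h2.ne',
      ← Real.log_sqrt (by positivity), Real.exp_log (by positivity)]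
    congr 2
    ring
  rw [h3, dirMomentum, ← hV.ofReal_re_eq x]
  simp only [ofReal_re]
  push_cast
  rw [Complex.ofReal_log h1.le, Complex.ofReal_log h2.le]
  push_cast
  rfl

end PotentialBounds

/-- The real functions entering the WKB ansatz `u₁ = A (α + β)`, `u₂ = A⁻¹ (α - β)`
for a Dirac equation, with their behaviour at infinity. -/
structure DiracFrame (m c E Vm Vp Tm Tp : ℝ) (V : ℂ → ℂ) (A p g : ℝ → ℝ) : Prop where
  V_real : ∀ x : ℝ, (((V x).re : ℝ) : ℂ) = V x
  A_pos : ∀ x, 0 < A x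
  A_deriv : ∀ x, HasDerivAt A (g x * A x) x
  minus : ∀ x : ℝ, (E - (V x).re - m * c ^ 2) * A x ^ 2 = c * p x
  plus : ∀ x : ℝ, c * p x * A x ^ 2 = E - (V x).re + m * c ^ 2
  p_cont : Continuous p
  Am_pos : 0 < AmpF m c (E - Vm)
  Ap_pos : 0 < AmpF m c (E - Vp)
  A_atBot : Tendsto A atBot (𝓝 (AmpF m c (E - Vm)))
  A_atTop : Tendsto A atTop (𝓝 (AmpF m c (E - Vp)))
  action_atBot : Tendsto (fun x => (∫ t in (0 : ℝ)..x, p t) - x * (PhiF m c (E - Vm) / c)) atBot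
    (𝓝 (-Tm))
  action_atTop : Tendsto (fun x => (∫ t in (0 : ℝ)..x, p t) - x * (PhiF m c (E - Vp) / c)) atTop
    (𝓝 Tp)

lemma AmpF_pos {m c l : ℝ} (hm : 0 ≤ m) (hl : m * c ^ 2 < l) : 0 < AmpF m c l := by
  have : 0 ≤ m * c ^ 2 := by positivity
  exact Real.rpow_pos_of_pos (div_pos (by linarith) (by linarith)) _

lemma AmpF_sq {m c l : ℝ} (hm : 0 ≤ m) (hl : m * c ^ 2 < l) :
    AmpF m c l ^ 2 = Real.sqrt (l + m * c ^ 2) / Real.sqrt (l - m * c ^ 2) := by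
  have : 0 ≤ m * c ^ 2 := by positivity
  rw [← Real.sqrt_div (by linarith), Real.sqrt_eq_rpow, AmpF, ← Real.rpow_natCast,
    ← Real.rpow_mul (div_nonneg (by linarith) (by linarith))]
  norm_num

lemma hasDerivAt_AmpF {m c : ℝ} {l : ℝ → ℝ} {l' x : ℝ} (hm : 0 ≤ m) (hl : m * c ^ 2 < l x)
    (hd : HasDerivAt l l' x) :
    HasDerivAt (fun y => AmpF m c (l y))
      (-(m * c ^ 2 * l') / (2 * ((l x - m * c ^ 2) * (l x + m * c ^ 2))) * AmpF m c (l x)) x := by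
  have hμ : 0 ≤ m * c ^ 2 := by positivity
  have h1 : 0 < l x - m * c ^ 2 := by linarith
  have h2 : 0 < l x + m * c ^ 2 := by linarith
  have h3 : HasDerivAt (fun y => AmpF m c (l y))
      ((l' * (l x - m * c ^ 2) - (l x + m * c ^ 2) * l') / (l x - m * c ^ 2) ^ 2 * (1 / 4) *
        ((l x + m * c ^ 2) / (l x - m * c ^ 2)) ^ ((1 : ℝ) / 4 - 1)) x :=
    ((hd.add_const (m * c ^ 2)).div (hd.sub_const (m * c ^ 2)) h1.ne').rpow_const
      (p := 1 / 4) (Or.inl (div_pos h2 h1).ne')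
  refine h3.congr_deriv ?_
  have h4 : AmpF m c (l x) = ((l x + m * c ^ 2) / (l x - m * c ^ 2)) ^ ((1 : ℝ) / 4 - 1) *
      ((l x + m * c ^ 2) / (l x - m * c ^ 2)) := by
    rw [AmpF, ← Real.rpow_add_one (div_pos h2 h1).ne']
    norm_num
  rw [h4]
  field_simp
  ring

lemma PhiF_div {m c l W E : ℝ} (hm : 0 ≤ m) (hc : 0 < c) (hl : m * c ^ 2 < l) (hW : E - W = l) :
    PhiF m c l / c = Real.sqrt (Esym m c E W) := by
  have : 0 ≤ m * c ^ 2 := by positivity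
  rw [PhiF, Real.sign_of_pos (by linarith), one_mul, Esym, Real.sqrt_div' _ (sq_nonneg c),
    Real.sqrt_sq hc.le, ← hW]
  congr 2
  ring

lemma abs_sqrt_sub_sqrt_le {s t : ℝ} (hs : 0 ≤ s) (ht : 0 < t) :
    |Real.sqrt s - Real.sqrt t| ≤ |s - t| / Real.sqrt t := by
  have h1 := Real.sqrt_pos.2 ht
  have h2 := Real.sqrt_nonneg s
  rw [le_div_iff₀ h1]
  calc |Real.sqrt s - Real.sqrt t| * Real.sqrt t
      ≤ |Real.sqrt s - Real.sqrt t| * |Real.sqrt s + Real.sqrt t| := by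
        gcongr
        rw [abs_of_pos (by linarith)]
        linarith
    _ = |s - t| := by
        rw [← abs_mul]
        congr 1
        nlinarith [Real.sq_sqrt hs, Real.sq_sqrt ht.le]

namespace PotentialBounds
variable {κ L C : ℝ} {w : ℝ → ℝ} {V : ℂ → ℂ} {Vm Vp m c E ν : ℝ}

lemma continuous_realMomentum (hV : PotentialBounds κ L C w V Vm Vp) (m c E : ℝ) :
    Continuous (realMomentum m c E V) :=
  Real.continuous_sqrt.comp
    ((continuous_const.add ((hV.continuous_re.sub continuous_const).pow 2)).div_const _)

lemma abs_realMomentum_le (hV : PotentialBounds κ L C w V Vm Vp) (m c E : ℝ) (x : ℝ) :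
    |realMomentum m c E V x| ≤ Real.sqrt ((|Vm| + |Vp| + C + |E|) ^ 2 / c ^ 2) := by
  rw [realMomentum, abs_of_nonneg (Real.sqrt_nonneg _)]
  apply Real.sqrt_le_sqrt
  have h1 := hV.abs_re_le x
  have h2 : |(V x).re - E| ≤ |Vm| + |Vp| + C + |E| := (abs_sub _ _).trans (by linarith)
  have h3 : ((V x).re - E) ^ 2 ≤ (|Vm| + |Vp| + C + |E|) ^ 2 := by
    rw [← sq_abs]; gcongr
  have h4 : 0 ≤ m ^ 2 * c ^ 4 := by positivity
  gcongr
  linarith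

lemma integrableOn_Qsym (hV : PotentialBounds κ L C w V Vm Vp) (hm : 0 ≤ m) (hc : 0 < c)
    (hν : 0 < ν) (hgap : ∀ x : ℝ, m * c ^ 2 + 2 * ν ≤ E - (V x).re) {W : ℝ} {s : Set ℝ}
    (hs : MeasurableSet s) (hW : m * c ^ 2 < E - W) (hb : ∀ x ∈ s, |(V x).re - W| ≤ C * w x) :
    IntegrableOn (Qsym m c E W V) s := by
  have hμ : 0 ≤ m * c ^ 2 := by positivity
  have hEs : 0 < Esym m c E W := by
    apply div_pos _ (by positivity)
    nlinarith
  set D := |Vm| + |Vp| + C + |W| + 2 * |E|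
  have hD : 0 ≤ D := by have := hV.C_nonneg; positivity
  have hcont : Continuous (Qsym m c E W V) :=
    (hV.continuous_realMomentum m c E).sub continuous_const
  refine Integrable.mono' ((hV.weight.integrable.const_mul
    (C * D / c ^ 2 / Real.sqrt (Esym m c E W))).integrableOn) hcont.aestronglyMeasurable ?_
  refine (ae_restrict_iff' hs).2 (Eventually.of_forall fun x hx => ?_)
  have h0 : 0 ≤ (-(m ^ 2 * c ^ 4) + ((V x).re - E) ^ 2) / c ^ 2 := by
    apply div_nonneg _ (sq_nonneg c)
    nlinarith [hgap x]
  refine (abs_sqrt_sub_sqrt_le h0 hEs).trans ?_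
  have h1 : (-(m ^ 2 * c ^ 4) + ((V x).re - E) ^ 2) / c ^ 2 - Esym m c E W =
      ((V x).re - W) * ((V x).re + W - 2 * E) / c ^ 2 := by
    rw [Esym]; ring
  have h2 : |(V x).re + W - 2 * E| ≤ D := by
    have i1 := hV.abs_re_le x
    have i2 := abs_sub ((V x).re + W) (2 * E)
    have i3 := abs_add_le (V x).re W
    rw [abs_mul, abs_of_pos (by norm_num : (0 : ℝ) < 2)] at i2
    simp only [D]; linarith
  rw [h1, abs_div, abs_mul, abs_of_pos (by positivity : 0 < c ^ 2)]
  have h3 := hb x hx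
  have h4 := (abs_nonneg _).trans h3
  calc |(V x).re - W| * |(V x).re + W - 2 * E| / c ^ 2 / Real.sqrt (Esym m c E W)
      ≤ C * w x * D / c ^ 2 / Real.sqrt (Esym m c E W) := by gcongr
    _ = _ := by ring

lemma integral_Qsym (hV : PotentialBounds κ L C w V Vm Vp) (W a b : ℝ) :
    ∫ t in a..b, Qsym m c E W V t =
      (∫ t in a..b, realMomentum m c E V t) - (b - a) * Real.sqrt (Esym m c E W) := by
  have := intervalIntegral.integral_sub
    ((hV.continuous_realMomentum m c E).intervalIntegrable (μ := volume) a b)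
    (intervalIntegrable_const (c := Real.sqrt (Esym m c E W)))
  rw [intervalIntegral.integral_const, smul_eq_mul] at this
  exact this

lemma diracFrame (hV : PotentialBounds κ L C w V Vm Vp) (hlt : Vm < Vp) (hm : 0 ≤ m) (hc : 0 < c)
    (hE : Vp + m * c ^ 2 < E)
    (hν : 0 < ν) (hgap : ∀ x : ℝ, m * c ^ 2 + 2 * ν ≤ E - (V x).re) :
    DiracFrame m c E Vm Vp (∫ t in Iic (0 : ℝ), Qsym m c E Vm V t)
      (∫ t in Ici (0 : ℝ), Qsym m c E Vp V t) V (fun x => AmpF m c (E - (V x).re))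
      (realMomentum m c E V) (realCoupling m c E V) := by
  have hμ : 0 ≤ m * c ^ 2 := by positivity
  have hl : ∀ x : ℝ, m * c ^ 2 < E - (V x).re := fun x => by linarith [hgap x]
  have hp : ∀ x : ℝ, c * realMomentum m c E V x =
      Real.sqrt (E - (V x).re - m * c ^ 2) * Real.sqrt (E - (V x).re + m * c ^ 2) := fun x => by
    rw [← Real.sqrt_mul (by linarith [hl x]), realMomentum, Real.sqrt_div' _ (sq_nonneg c),
      Real.sqrt_sq hc.le, mul_div_cancel₀ _ hc.ne']
    congr 1
    ring
  have hlim : ∀ {l : Filter ℝ} {W : ℝ}, m * c ^ 2 < E - W → Tendsto (fun x : ℝ => (V x).re) l (𝓝 W) →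
      Tendsto (fun x : ℝ => AmpF m c (E - (V x).re)) l (𝓝 (AmpF m c (E - W))) := fun hW hT =>
    ((hasDerivAt_AmpF (c := c) (l := id) hm hW (hasDerivAt_id _)).continuousAt.tendsto).comp
      (tendsto_const_nhds.sub hT)
  refine ⟨hV.ofReal_re_eq, fun x => AmpF_pos hm (hl x), fun x => ?_, fun x => ?_, fun x => ?_,
    hV.continuous_realMomentum m c E, AmpF_pos hm (by linarith), AmpF_pos hm (by linarith),
    hlim (by linarith) hV.tendsto_atBot, hlim (by linarith) hV.tendsto_atTop, ?_, ?_⟩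
  · refine (hasDerivAt_AmpF (l := fun y : ℝ => E - (V y).re) hm (hl x) ((hV.hasDerivAt_re x).const_sub E)).congr_deriv ?_
    rw [realCoupling]
    ring
  · have h1 : 0 < E - (V x).re - m * c ^ 2 := by linarith [hl x]
    have h2 := Real.sqrt_pos.2 h1
    rw [hp, AmpF_sq hm (hl x)]
    conv_lhs => enter [1]; rw [← Real.mul_self_sqrt h1.le]
    field_simp
  · have h1 : 0 < E - (V x).re - m * c ^ 2 := by linarith [hl x]
    have h3 : 0 ≤ E - (V x).re + m * c ^ 2 := by linarith [hl x]
    have h2 := Real.sqrt_pos.2 h1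
    rw [hp, AmpF_sq hm (hl x)]
    conv_rhs => rw [← Real.mul_self_sqrt h3]
    field_simp
  · have h1 := intervalIntegral_tendsto_integral_Iic 0 (hV.integrableOn_Qsym hm hc hν hgap
      measurableSet_Iic (by linarith : m * c ^ 2 < E - Vm) fun x hx => hV.left x hx) tendsto_id
    refine h1.neg.congr fun x => ?_
    rw [hV.integral_Qsym, intervalIntegral.integral_symm, PhiF_div hm hc (by linarith) rfl]
    simp
    ring
  · have h1 := intervalIntegral_tendsto_integral_Ioi 0 ((hV.integrableOn_Qsym hm hc hν hgap
      measurableSet_Ici (by linarith : m * c ^ 2 < E - Vp) fun x hx => hV.right x hx).mono_set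
      Ioi_subset_Ici_self) tendsto_id
    rw [integral_Ici_eq_integral_Ioi]
    refine h1.congr fun x => ?_
    rw [hV.integral_Qsym, PhiF_div hm hc (by linarith) rfl]
    simp

end PotentialBounds

/-- Solutions of the first-order system satisfied by the WKB amplitudes; `q` is the rate of the
relative phase. -/
structure AmpPair (q g : ℝ → ℝ) (a b : ℝ → ℂ) : Prop where
  left : ∀ x, HasDerivAt a (-(g x) * b x) x
  right : ∀ x, HasDerivAt b (-(I * (q x : ℝ)) * b x - g x * a x) x

/-- The unimodular relative phase associated with the rate `q`. -/
structure UnitPhase (q : ℝ → ℝ) (e : ℝ → ℂ) : Prop where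
  norm_eq : ∀ x, ‖e x‖ = 1
  deriv : ∀ x, HasDerivAt e (I * (q x : ℝ) * e x) x

lemma eq_of_hasDerivAt_zero {F : ℝ → ℂ} (hF : ∀ x, HasDerivAt F 0 x) (x y : ℝ) : F x = F y :=
  is_const_of_deriv_eq_zero (fun x => (hF x).differentiableAt) (fun x => (hF x).deriv) x y

namespace AmpPair
variable {q g : ℝ → ℝ} {a b a' b' e : ℝ → ℂ}

lemma const_mul (hp : AmpPair q g a b) (k : ℂ) :
    AmpPair q g (fun x => k * a x) fun x => k * b x :=
  ⟨fun x => ((hp.left x).const_mul k).congr_deriv (by ring),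
    fun x => ((hp.right x).const_mul k).congr_deriv (by ring)⟩

lemma conj_swap (hp : AmpPair q g a b) (he : UnitPhase q e) :
    AmpPair q g (fun x => star (e x * b x)) fun x => star (e x * a x) := by
  refine ⟨fun x => (((he.deriv x).mul (hp.right x)).star).congr_deriv ?_,
    fun x => (((he.deriv x).mul (hp.left x)).star).congr_deriv ?_⟩
  · simp only [star_def, map_mul, map_add, map_sub, map_neg, conj_I, conj_ofReal]
    ring
  · simp only [star_def, map_mul, map_add, map_neg, conj_I, conj_ofReal]
    ring

lemma wronskian_eq (hp : AmpPair q g a b) (hp' : AmpPair q g a' b') (he : UnitPhase q e) (x y : ℝ) :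
    e x * (b x * a' x - a x * b' x) = e y * (b y * a' y - a y * b' y) := by
  refine eq_of_hasDerivAt_zero (F := fun x => e x * (b x * a' x - a x * b' x)) (fun t => ?_) x y
  refine ((he.deriv t).mul (((hp.right t).mul (hp'.left t)).sub
    ((hp.left t).mul (hp'.right t)))).congr_deriv ?_
  simp only [Pi.mul_apply, Pi.sub_apply]
  ring

lemma norm_sq_sub_eq (hp : AmpPair q g a b) (x y : ℝ) :
    ‖a x‖ ^ 2 - ‖b x‖ ^ 2 = ‖a y‖ ^ 2 - ‖b y‖ ^ 2 := by
  have h : ∀ x y, star (a x) * a x - star (b x) * b x = star (a y) * a y - star (b y) * b y := by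
    refine fun x y => eq_of_hasDerivAt_zero
      (F := fun x => star (a x) * a x - star (b x) * b x) (fun t => ?_) x y
    refine ((((hp.left t).star).mul (hp.left t)).sub
      (((hp.right t).star).mul (hp.right t))).congr_deriv ?_
    simp only [star_def, map_mul, map_sub, map_neg, conj_I, conj_ofReal]
    ring
  have h1 := h x y
  simp only [star_def, Complex.conj_mul'] at h1
  exact_mod_cast h1

lemma norm_sq_sub_eq_one (hp : AmpPair q g a b) (ha : Tendsto a atBot (𝓝 1))
    (hb : Tendsto b atBot (𝓝 0)) (x : ℝ) : ‖a x‖ ^ 2 - ‖b x‖ ^ 2 = 1 := by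
  have h1 : Tendsto (fun y => ‖a y‖ ^ 2 - ‖b y‖ ^ 2) atBot (𝓝 1) := by
    simpa using (ha.norm.pow 2).sub (hb.norm.pow 2)
  refine tendsto_nhds_unique (tendsto_const_nhds.congr fun y => hp.norm_sq_sub_eq x y) h1

end AmpPair

/-- Approximation, up to `ε N`, of the solution normalised at `-∞` by functions with the limits
`P N` and `0` at `+∞`. -/
def ApproxAtTop (ε : ℕ → ℝ) (P : ℕ → ℂ) (a b : ℝ → ℂ) : Prop :=
  ∀ N, ∃ aN bN : ℝ → ℂ, (∀ x, ‖a x - aN x‖ ≤ ε N) ∧ (∀ x, ‖b x - bN x‖ ≤ ε N) ∧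
    Tendsto aN atTop (𝓝 (P N)) ∧ Tendsto bN atTop (𝓝 0)

namespace ApproxAtTop
variable {ε : ℕ → ℝ} {P : ℕ → ℂ} {a b : ℝ → ℂ}

lemma isBoundedUnder_left (h : ApproxAtTop ε P a b) :
    IsBoundedUnder (· ≤ ·) atTop fun x => ‖a x‖ := by
  obtain ⟨aN, bN, h1, -, h3, -⟩ := h 0
  refine ⟨ε 0 + (‖P 0‖ + 1), eventually_map.2 ?_⟩
  filter_upwards [h3.norm.eventually (gt_mem_nhds (lt_add_one ‖P 0‖))] with x hx
  have := norm_add_le (a x - aN x) (aN x)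
  rw [sub_add_cancel] at this
  linarith [h1 x]

lemma isBoundedUnder_right (h : ApproxAtTop ε P a b) :
    IsBoundedUnder (· ≤ ·) atTop fun x => ‖b x‖ := by
  obtain ⟨aN, bN, -, h1, -, h3⟩ := h 0
  refine ⟨ε 0 + (‖(0 : ℂ)‖ + 1), eventually_map.2 ?_⟩
  filter_upwards [h3.norm.eventually (gt_mem_nhds (lt_add_one ‖(0 : ℂ)‖))] with x hx
  have := norm_add_le (b x - bN x) (bN x)
  rw [sub_add_cancel] at this
  linarith [h1 x]

lemma norm_sub_le (h : ApproxAtTop ε P a b) {τ : ℂ} (hτ : Tendsto a atTop (𝓝 τ)) (N : ℕ) :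
    ‖τ - P N‖ ≤ ε N := by
  obtain ⟨aN, bN, h1, -, h3, -⟩ := h N
  exact le_of_tendsto (hτ.sub h3).norm (Eventually.of_forall h1)

lemma le_of_tendsto_norm_mul (h : ApproxAtTop ε P a b) {f : ℝ → ℂ} {k : ℝ}
    (hf : Tendsto (fun x => ‖f x‖) atTop (𝓝 1)) (hk : Tendsto (fun x => ‖b x * f x‖) atTop (𝓝 k))
    (N : ℕ) : k ≤ ε N := by
  obtain ⟨aN, bN, -, h1, -, h3⟩ := h N
  have h4 : Tendsto (fun x => (ε N + ‖bN x‖) * ‖f x‖) atTop (𝓝 ((ε N + ‖(0 : ℂ)‖) * 1)) :=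
    (h3.norm.const_add _).mul hf
  rw [norm_zero, add_zero, mul_one] at h4
  refine le_of_tendsto_of_tendsto' hk h4 fun x => ?_
  rw [norm_mul]
  have := norm_add_le (b x - bN x) (bN x)
  rw [sub_add_cancel] at this
  gcongr
  linarith [h1 x]

end ApproxAtTop

/-- The limit at `+∞` of the solution normalised at `-∞`, its inverse conjugate and the
reflected amplitude are determined up to the errors `ε N`. -/
lemma norm_inv_conj_sub_le {q g : ℝ → ℝ} {a b : ℝ → ℂ} {ε : ℕ → ℝ} {P : ℕ → ℂ}
    (hp : AmpPair q g a b) (ha : Tendsto a atBot (𝓝 1)) (hb : Tendsto b atBot (𝓝 0))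
    (h : ApproxAtTop ε P a b) {τ : ℂ} (hτ : Tendsto a atTop (𝓝 τ)) :
    1 ≤ ‖τ‖ ∧ ∀ N, ‖(star τ)⁻¹ - P N‖ ≤ ε N + ε 0 * ε N := by
  have h1 := hp.norm_sq_sub_eq_one ha hb
  have hge : 1 ≤ ‖τ‖ := by
    refine ge_of_tendsto hτ.norm (Eventually.of_forall fun x => ?_)
    nlinarith [h1 x, norm_nonneg (a x), sq_nonneg ‖b x‖]
  have hb2 : Tendsto (fun x => ‖b x‖) atTop (𝓝 (Real.sqrt (‖τ‖ ^ 2 - 1))) := by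
    have h2 : Tendsto (fun x => Real.sqrt (‖a x‖ ^ 2 - 1)) atTop (𝓝 (Real.sqrt (‖τ‖ ^ 2 - 1))) :=
      (Real.continuous_sqrt.tendsto _).comp ((hτ.norm.pow 2).sub_const 1)
    refine h2.congr fun x => ?_
    rw [show ‖a x‖ ^ 2 - 1 = ‖b x‖ ^ 2 by linarith [h1 x], Real.sqrt_sq (norm_nonneg _)]
  have hle : ∀ N, Real.sqrt (‖τ‖ ^ 2 - 1) ≤ ε N := fun N =>
    h.le_of_tendsto_norm_mul (f := fun _ => 1) (by simp) (by simpa using hb2) N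
  refine ⟨hge, fun N => ?_⟩
  have hτ0 : star τ ≠ 0 := by
    rw [← norm_pos_iff, norm_star]; linarith
  have h3 : ‖(star τ)⁻¹ - τ‖ ≤ ε 0 * ε N := by
    have h4 : (star τ)⁻¹ - τ = (((1 - ‖τ‖ ^ 2 : ℝ)) : ℂ) * (star τ)⁻¹ := by
      have : star τ * τ = ((‖τ‖ ^ 2 : ℝ) : ℂ) := by
        rw [star_def, Complex.conj_mul']; push_cast; rfl
      field_simp
      rw [this]; push_cast; ring
    have h5 : 0 ≤ ‖τ‖ ^ 2 - 1 := by nlinarith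
    rw [h4, norm_mul, Complex.norm_real, norm_inv, norm_star, Real.norm_eq_abs, abs_sub_comm,
      abs_of_nonneg h5]
    calc (‖τ‖ ^ 2 - 1) * ‖τ‖⁻¹ ≤ (‖τ‖ ^ 2 - 1) * 1 := by
          gcongr; exact inv_le_one_of_one_le₀ hge
      _ = Real.sqrt (‖τ‖ ^ 2 - 1) * Real.sqrt (‖τ‖ ^ 2 - 1) := by
          rw [mul_one, Real.mul_self_sqrt h5]
      _ ≤ ε 0 * ε N :=
          mul_le_mul (hle 0) (hle N) (Real.sqrt_nonneg _) ((Real.sqrt_nonneg _).trans (hle 0))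
  calc ‖(star τ)⁻¹ - P N‖ = ‖(τ - P N) + ((star τ)⁻¹ - τ)‖ := by congr 1; ring
    _ ≤ _ := (norm_add_le _ _).trans (add_le_add (h.norm_sub_le hτ N) h3)

/-- The scattering coefficients in terms of the WKB amplitudes of the Jost solutions. -/
theorem scattering_estimate {q g : ℝ → ℝ} {e : ℝ → ℂ} (he : UnitPhase q e) {ε : ℕ → ℝ} {P : ℕ → ℂ}
    (happrox : ∀ a b : ℝ → ℂ, AmpPair q g a b → Tendsto a atBot (𝓝 1) → Tendsto b atBot (𝓝 0) →
      ApproxAtTop ε P a b)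
    {a₁ b₁ a₂ b₂ a₃ b₃ a₄ b₄ : ℝ → ℂ} {ω η : ℂ} (hω : ‖ω‖ = 1) (hη : ‖η‖ = 1)
    (h₁ : AmpPair q g a₁ b₁) (h₂ : AmpPair q g a₂ b₂) (h₃ : AmpPair q g a₃ b₃)
    (ha₁ : Tendsto a₁ atBot (𝓝 ω)) (hb₁ : Tendsto b₁ atBot (𝓝 0))
    (ha₂ : Tendsto a₂ atBot (𝓝 0)) (hb₂ : Tendsto (fun x => e x * b₂ x) atBot (𝓝 (star ω)))
    (ha₃ : Tendsto a₃ atTop (𝓝 (star η))) (hb₃ : Tendsto b₃ atTop (𝓝 0))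
    (ha₄ : Tendsto a₄ atTop (𝓝 0)) (hb₄ : Tendsto (fun x => e x * b₄ x) atTop (𝓝 η))
    {S : Matrix (Fin 2) (Fin 2) ℂ}
    (hSa₁ : ∀ x, a₁ x = S 0 0 * a₃ x + S 1 0 * a₂ x)
    (hSb₁ : ∀ x, b₁ x = S 0 0 * b₃ x + S 1 0 * b₂ x)
    (hSa₄ : ∀ x, a₄ x = S 0 1 * a₃ x + S 1 1 * a₂ x)
    (hSb₄ : ∀ x, b₄ x = S 0 1 * b₃ x + S 1 1 * b₂ x) :
    S 0 0 = S 1 1 ∧ ∀ N, ‖S 0 0 * star (ω * η) - P N‖ ≤ ε N + ε 0 * ε N ∧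
      ‖S 1 0‖ ≤ ε N ∧ ‖S 0 1‖ ≤ ε N := by
  have hωω : ω * star ω = 1 := by rw [star_def, Complex.mul_conj', hω]; simp
  have hηη : η * star η = 1 := by rw [star_def, Complex.mul_conj', hη]; simp
  have hebdd : IsBoundedUnder (· ≤ ·) atBot fun x => ‖e x‖ :=
    ⟨1, eventually_map.2 (Eventually.of_forall fun x => (he.norm_eq x).le)⟩
  have hebdd' : IsBoundedUnder (· ≤ ·) atTop fun x => ‖e x‖ :=
    ⟨1, eventually_map.2 (Eventually.of_forall fun x => (he.norm_eq x).le)⟩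
  set W : ℝ → ℂ := fun x => e x * (b₃ x * a₂ x - a₃ x * b₂ x) with hW
  have hWc : ∀ x, W x = W 0 := fun x => h₃.wronskian_eq h₂ he x 0
  -- Wronskians of the pairs with coinciding data
  have w12 : S 0 0 * W 0 = -1 := by
    have hl : Tendsto (fun x => b₁ x * (e x * a₂ x) - a₁ x * (e x * b₂ x)) atBot
        (𝓝 (0 * 0 - ω * star ω)) :=
      (hb₁.mul (isBoundedUnder_le_mul_tendsto_zero hebdd ha₂)).sub
        (ha₁.mul hb₂)
    rw [hωω, mul_zero, zero_sub] at hl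
    refine tendsto_nhds_unique (tendsto_const_nhds.congr fun x => ?_) hl
    rw [← hWc x, hSa₁, hSb₁]
    simp only [hW]
    ring
  have w34 : S 1 1 * W 0 = -1 := by
    have hl : Tendsto (fun x => b₃ x * (e x * a₄ x) - a₃ x * (e x * b₄ x)) atTop
        (𝓝 (0 * 0 - star η * η)) :=
      (hb₃.mul (isBoundedUnder_le_mul_tendsto_zero hebdd' ha₄)).sub
        (ha₃.mul hb₄)
    rw [mul_comm (star η), hηη, mul_zero, zero_sub] at hl
    refine tendsto_nhds_unique (tendsto_const_nhds.congr fun x => ?_) hl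
    rw [← hWc x, hSa₄, hSb₄]
    simp only [hW]
    ring
  have hW0 : W 0 ≠ 0 := fun h => by simp [h] at w12
  have hS : S 0 0 = S 1 1 := mul_right_cancel₀ hW0 (w12.trans w34.symm)
  -- solutions normalised at minus infinity
  have hp1 : AmpPair q g (fun x => star ω * a₁ x) fun x => star ω * b₁ x := h₁.const_mul _
  have hA1 : Tendsto (fun x => star ω * a₁ x) atBot (𝓝 1) := by
    have := ha₁.const_mul (star ω)
    rwa [mul_comm, hωω] at this
  have hB1 : Tendsto (fun x => star ω * b₁ x) atBot (𝓝 0) := by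
    simpa using hb₁.const_mul (star ω)
  have hX1 := happrox _ _ hp1 hA1 hB1
  have hp2 : AmpPair q g (fun x => star ω * star (e x * b₂ x)) fun x => star ω * star (e x * a₂ x) :=
    (h₂.conj_swap he).const_mul _
  have hA2 : Tendsto (fun x => star ω * star (e x * b₂ x)) atBot (𝓝 1) := by
    have := hb₂.star.const_mul (star ω)
    rwa [star_star, mul_comm, hωω] at this
  have hB2 : Tendsto (fun x => star ω * star (e x * a₂ x)) atBot (𝓝 0) := by
    have := (isBoundedUnder_le_mul_tendsto_zero hebdd ha₂).star.const_mul
      (star ω)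
    simpa using this
  have hX2 := happrox _ _ hp2 hA2 hB2
  have hb2n : ∀ x, ‖star ω * star (e x * b₂ x)‖ = ‖b₂ x‖ := fun x => by
    rw [norm_mul, norm_star, norm_star, norm_mul, hω, he.norm_eq, one_mul, one_mul]
  have ha2n : ∀ x, ‖star ω * star (e x * a₂ x)‖ = ‖a₂ x‖ := fun x => by
    rw [norm_mul, norm_star, norm_star, norm_mul, hω, he.norm_eq, one_mul, one_mul]
  have hb1n : ∀ x, ‖star ω * b₁ x‖ = ‖b₁ x‖ := fun x => by
    rw [norm_mul, norm_star, hω, one_mul]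
  have ha1n : ∀ x, ‖star ω * a₁ x‖ = ‖a₁ x‖ := fun x => by
    rw [norm_mul, norm_star, hω, one_mul]
  have bdd2a := hX2.isBoundedUnder_right
  have bdd2b := hX2.isBoundedUnder_left
  have bdd1a := hX1.isBoundedUnder_left
  simp only [hb2n] at bdd2b
  simp only [ha2n] at bdd2a
  simp only [ha1n] at bdd1a
  -- the limit at plus infinity of the second normalised solution
  have hlim : Tendsto (fun x => e x * b₂ x) atTop (𝓝 (-(W 0 * η))) := by
    have h1 : Tendsto (fun x => a₃ x * (e x * b₂ x)) atTop (𝓝 (-W 0)) := by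
      have h2 : Tendsto (fun x => e x * (a₂ x * b₃ x)) atTop (𝓝 0) :=
        isBoundedUnder_le_mul_tendsto_zero hebdd' (isBoundedUnder_le_mul_tendsto_zero bdd2a hb₃)
      have h3 := h2.sub_const (W 0)
      rw [zero_sub] at h3
      refine h3.congr fun x => ?_
      rw [← hWc x]
      simp only [hW]
      ring
    have hη' : star η ≠ 0 := fun h => by rw [h, mul_zero] at hηη; exact zero_ne_one hηη
    have h4 := h1.div ha₃ hη'
    have h5 : -W 0 / star η = -(W 0 * η) := by
      rw [div_eq_iff hη', neg_mul, mul_assoc, hηη, mul_one]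
    rw [h5] at h4
    refine h4.congr' ?_
    filter_upwards [ha₃.eventually_ne hη'] with x hx
    exact mul_div_cancel_left₀ _ hx
  have hτ : Tendsto (fun x => star ω * star (e x * b₂ x)) atTop (𝓝 (star ω * star (-(W 0 * η)))) :=
    hlim.star.const_mul _
  obtain ⟨hge, hmain⟩ := norm_inv_conj_sub_le hp2 hA2 hB2 hX2 hτ
  have hWn : 1 ≤ ‖W 0‖ := by
    rwa [norm_mul, norm_star, norm_star, norm_neg, norm_mul, hω, hη, one_mul, mul_one] at hge
  have hσ : (star (star ω * star (-(W 0 * η))))⁻¹ = S 0 0 * star (ω * η) := by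
    rw [star_mul, star_star, star_star]
    apply inv_eq_of_mul_eq_one_right
    rw [star_mul]
    linear_combination (-1 : ℂ) * w12 * (ω * star ω * (η * star η)) + hωω * (η * star η) + hηη
  rw [hσ] at hmain
  have hle : ∀ s : ℂ, ‖s‖ ≤ ‖s * W 0‖ := fun s => by
    rw [norm_mul]
    exact le_mul_of_one_le_right (norm_nonneg s) hWn
  refine ⟨hS, fun N => ⟨hmain N, ?_, ?_⟩⟩
  · have h2 : Tendsto (fun x => e x * (a₁ x * b₃ x)) atTop (𝓝 0) :=
      isBoundedUnder_le_mul_tendsto_zero hebdd' (isBoundedUnder_le_mul_tendsto_zero bdd1a hb₃)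
    have hk : Tendsto (fun x => ‖star ω * b₁ x * (e x * a₃ x)‖) atTop (𝓝 ‖S 1 0 * W 0‖) := by
      have h3 := (h2.sub_const (S 1 0 * W 0)).norm
      rw [zero_sub, norm_neg] at h3
      refine h3.congr fun x => ?_
      rw [mul_assoc, norm_mul (star ω), norm_star, hω, one_mul, ← hWc x, hSa₁, hSb₁]
      congr 1
      simp only [hW]
      ring
    have hf : Tendsto (fun x => ‖e x * a₃ x‖) atTop (𝓝 1) := by
      have h3 := ha₃.norm
      rw [norm_star, hη] at h3
      exact h3.congr fun x => by rw [norm_mul, he.norm_eq, one_mul]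
    exact (hle _).trans (hX1.le_of_tendsto_norm_mul hf hk N)
  · have h2 : Tendsto (fun x => e x * (b₂ x * a₄ x)) atTop (𝓝 0) :=
      isBoundedUnder_le_mul_tendsto_zero hebdd' (isBoundedUnder_le_mul_tendsto_zero bdd2b ha₄)
    have hk : Tendsto (fun x => ‖star ω * star (e x * a₂ x) * (e x * b₄ x)‖) atTop
        (𝓝 ‖S 0 1 * W 0‖) := by
      have h3 := (h2.add_const (S 0 1 * W 0)).norm
      rw [zero_add] at h3
      refine h3.congr fun x => ?_
      rw [norm_mul _ (e x * b₄ x), ha2n, norm_mul (e x), he.norm_eq, one_mul, ← norm_mul,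
        ← one_mul ‖a₂ x * b₄ x‖, ← he.norm_eq x, ← norm_mul, ← hWc x, hSa₄, hSb₄]
      congr 1
      simp only [hW]
      ring
    have hf : Tendsto (fun x => ‖e x * b₄ x‖) atTop (𝓝 1) := by
      have h3 := hb₄.norm
      rwa [hη] at h3
    exact (hle _).trans (hX2.le_of_tendsto_norm_mul hf hk N)

/-- The amplitude of the right-moving WKB wave in `u`. -/
noncomputable def ampRight (h : ℝ) (A p : ℝ → ℝ) (u : ℝ → ℂ × ℂ) (x : ℝ) : ℂ :=
  exp (-(I * ((∫ t in (0 : ℝ)..x, p t) / h : ℝ))) * ((u x).1 / A x + A x * (u x).2) / 2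

/-- The amplitude of the left-moving WKB wave in `u`, with the phase of the right-moving one. -/
noncomputable def ampLeft (h : ℝ) (A p : ℝ → ℝ) (u : ℝ → ℂ × ℂ) (x : ℝ) : ℂ :=
  exp (-(I * ((∫ t in (0 : ℝ)..x, p t) / h : ℝ))) * ((u x).1 / A x - A x * (u x).2) / 2

/-- The relative phase of the two WKB waves. -/
noncomputable def relPhase (h : ℝ) (p : ℝ → ℝ) (x : ℝ) : ℂ :=
  exp (I * (2 * (∫ t in (0 : ℝ)..x, p t) / h : ℝ))

lemma norm_exp_I_mul (y : ℝ) : ‖exp (I * (y : ℝ))‖ = 1 := by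
  rw [mul_comm]; exact Complex.norm_exp_ofReal_mul_I y

lemma norm_exp_neg_I_mul (y : ℝ) : ‖exp (-(I * (y : ℝ)))‖ = 1 := by
  have := norm_exp_I_mul (-y)
  rwa [ofReal_neg, mul_neg] at this

lemma unitPhase_relPhase (h : ℝ) {p : ℝ → ℝ} (hp : Continuous p) :
    UnitPhase (fun x => 2 * p x / h) (relPhase h p) := by
  refine ⟨fun x => norm_exp_I_mul _, fun x => ?_⟩
  have h1 : HasDerivAt (fun x => ∫ t in (0 : ℝ)..x, p t) (p x) x :=
    (hp.integral_hasStrictDerivAt 0 x).hasDerivAt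
  have h2 := (((h1.const_mul 2).div_const h).ofReal_comp.const_mul I).cexp
  refine h2.congr_deriv ?_
  rw [relPhase]
  ring

lemma IsDiracSolution.hasDerivAt {h m c E : ℝ} {V : ℂ → ℂ} {u : ℝ → ℂ × ℂ}
    (hu : IsDiracSolution h m c V E u) (hh : 0 < h) (hc : 0 < c) (x : ℝ) :
    HasDerivAt (fun y => (u y).1) (I / (h * c) * ((E - V x + m * c ^ 2) * (u x).2)) x ∧
      HasDerivAt (fun y => (u y).2) (I / (h * c) * ((E - V x - m * c ^ 2) * (u x).1)) x := by
  have hh' : (h : ℂ) ≠ 0 := by exact_mod_cast hh.ne'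
  have hc' : (c : ℂ) ≠ 0 := by exact_mod_cast hc.ne'
  refine ⟨(hu.diff1 x).hasDerivAt.congr_deriv ?_, (hu.diff2 x).hasDerivAt.congr_deriv ?_⟩
  · have := hu.eq2 x
    field_simp
    linear_combination I * this + h * c * deriv (fun y : ℝ => (u y).1) x * I_mul_I
  · have := hu.eq1 x
    field_simp
    linear_combination I * this + h * c * deriv (fun y : ℝ => (u y).2) x * I_mul_I

namespace DiracFrame
variable {m c E Vm Vp Tm Tp h : ℝ} {V : ℂ → ℂ} {A p g : ℝ → ℝ} {u : ℝ → ℂ × ℂ}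

lemma ampPair (hF : DiracFrame m c E Vm Vp Tm Tp V A p g) (hh : 0 < h) (hc : 0 < c)
    (hu : IsDiracSolution h m c V E u) :
    AmpPair (fun x => 2 * p x / h) g (ampRight h A p u) (ampLeft h A p u) := by
  have hh' : (h : ℂ) ≠ 0 := by exact_mod_cast hh.ne'
  have hc' : (c : ℂ) ≠ 0 := by exact_mod_cast hc.ne'
  have key : ∀ x : ℝ, HasDerivAt (fun y => (u y).1 / A y)
      (I * p x / h * (A x * (u x).2) - g x * ((u x).1 / A x)) x ∧
      HasDerivAt (fun y => A y * (u y).2)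
      (I * p x / h * ((u x).1 / A x) + g x * (A x * (u x).2)) x := by
    intro x
    have hA : (A x : ℂ) ≠ 0 := by exact_mod_cast (hF.A_pos x).ne'
    obtain ⟨h1, h2⟩ := hu.hasDerivAt hh hc x
    have h3 := (hF.A_deriv x).ofReal_comp
    have h4 : (E - V x - m * c ^ 2) * (A x : ℂ) ^ 2 = c * p x := by
      rw [← hF.V_real x]; exact_mod_cast hF.minus x
    have h5 : c * p x * (A x : ℂ) ^ 2 = E - V x + m * c ^ 2 := by
      rw [← hF.V_real x]; exact_mod_cast hF.plus x
    refine ⟨(h1.div h3 hA).congr_deriv ?_, (h3.mul h2).congr_deriv ?_⟩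
    · rw [← h5]
      push_cast
      field_simp
    · have h6 : (E - V x - m * c ^ 2) = c * p x / (A x : ℂ) ^ 2 := by
        rw [eq_div_iff (pow_ne_zero 2 hA), h4]
      rw [h6]
      push_cast
      field_simp
      ring
  have hz : ∀ x : ℝ, HasDerivAt (fun x => exp (-(I * ((∫ t in (0 : ℝ)..x, p t) / h : ℝ))))
      (-(I * p x / h) * exp (-(I * ((∫ t in (0 : ℝ)..x, p t) / h : ℝ)))) x := by
    intro x
    have h1 : HasDerivAt (fun x => ∫ t in (0 : ℝ)..x, p t) (p x) x :=
      (hF.p_cont.integral_hasStrictDerivAt 0 x).hasDerivAt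
    refine (((h1.div_const h).ofReal_comp.const_mul I).neg.cexp).congr_deriv ?_
    simp only [Pi.neg_apply]
    push_cast
    ring
  refine ⟨fun x => ?_, fun x => ?_⟩
  · refine (((hz x).mul ((key x).1.add (key x).2)).div_const 2).congr_deriv ?_
    simp only [ampLeft, Pi.add_apply]
    ring
  · refine (((hz x).mul ((key x).1.sub (key x).2)).div_const 2).congr_deriv ?_
    simp only [ampLeft, ampRight, Pi.sub_apply]
    push_cast
    ring

end DiracFrame

namespace JostCond
variable {m c E V₀ h T s : ℝ} {A p : ℝ → ℝ} {u : ℝ → ℂ × ℂ} {l : Filter ℝ}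

lemma tendsto_components (hu : JostCond h m c E V₀ s s l u) (hA₀ : 0 < AmpF m c (E - V₀))
    (hA : Tendsto A l (𝓝 (AmpF m c (E - V₀)))) :
    Tendsto (fun x => ((u x).1 / A x + A x * (u x).2) / 2 *
      exp (-(s * I / (h * c) * (PhiF m c (E - V₀) : ℝ) * x))) l (𝓝 ((1 + s) / 2)) ∧
    Tendsto (fun x => ((u x).1 / A x - A x * (u x).2) / 2 *
      exp (-(s * I / (h * c) * (PhiF m c (E - V₀) : ℝ) * x))) l (𝓝 ((1 - s) / 2)) := by
  obtain ⟨h1, h2⟩ := hu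
  have hA' : Tendsto (fun x => (A x : ℂ)) l (𝓝 (AmpF m c (E - V₀) : ℂ)) :=
    (continuous_ofReal.tendsto _).comp hA
  have hA0 : (AmpF m c (E - V₀) : ℂ) ≠ 0 := by exact_mod_cast hA₀.ne'
  have h3 := h1.div hA' hA0
  have h4 := hA'.mul h2
  rw [div_self hA0] at h3
  rw [mul_left_comm, mul_inv_cancel₀ hA0, mul_one] at h4
  refine ⟨((h3.add h4).div_const 2).congr fun x => ?_, ((h3.sub h4).div_const 2).congr fun x => ?_⟩
  · simp only [Pi.div_apply]
    ring
  · simp only [Pi.div_apply]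
    ring

lemma tendsto_phase {φ : ℝ → ℝ} (hT : Tendsto φ l (𝓝 T)) :
    Tendsto (fun x => exp (I * (φ x / h : ℝ))) l (𝓝 (exp (I * (T / h : ℝ)))) :=
  (continuous_exp.tendsto _).comp
    (((continuous_ofReal.tendsto _).comp (hT.div_const h)).const_mul I)

lemma tendsto_right (hu : JostCond h m c E V₀ 1 1 l u) (hA₀ : 0 < AmpF m c (E - V₀))
    (hA : Tendsto A l (𝓝 (AmpF m c (E - V₀))))
    (hT : Tendsto (fun x => (∫ t in (0 : ℝ)..x, p t) - x * (PhiF m c (E - V₀) / c)) l (𝓝 T)) :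
    Tendsto (ampRight h A p u) l (𝓝 (exp (I * (-T / h : ℝ)))) ∧
      Tendsto (ampLeft h A p u) l (𝓝 0) := by
  obtain ⟨h1, h2⟩ := hu.tendsto_components hA₀ hA
  have hph := tendsto_phase (h := h) hT.neg
  have hexp : ∀ x : ℝ, exp (I * (-((∫ t in (0 : ℝ)..x, p t) -
      x * (PhiF m c (E - V₀) / c)) / h : ℝ)) *
      exp (-(((1 : ℝ) : ℂ) * I / (h * c) * (PhiF m c (E - V₀) : ℝ) * x)) =
      exp (-(I * ((∫ t in (0 : ℝ)..x, p t) / h : ℝ))) := by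
    intro x
    rw [← Complex.exp_add]
    congr 1
    push_cast
    ring
  have h3 := hph.mul h1
  have h4 := hph.mul h2
  rw [ofReal_one, add_self_div_two, mul_one] at h3
  rw [ofReal_one, sub_self, zero_div, mul_zero] at h4
  refine ⟨h3.congr fun x => ?_, h4.congr fun x => ?_⟩
  · rw [ampRight, ← hexp, ofReal_one]; ring
  · rw [ampLeft, ← hexp, ofReal_one]; ring

lemma tendsto_left (hu : JostCond h m c E V₀ (-1) (-1) l u) (hA₀ : 0 < AmpF m c (E - V₀))
    (hA : Tendsto A l (𝓝 (AmpF m c (E - V₀))))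
    (hT : Tendsto (fun x => (∫ t in (0 : ℝ)..x, p t) - x * (PhiF m c (E - V₀) / c)) l (𝓝 T)) :
    Tendsto (ampRight h A p u) l (𝓝 0) ∧
      Tendsto (fun x => relPhase h p x * ampLeft h A p u x) l (𝓝 (exp (I * (T / h : ℝ)))) := by
  obtain ⟨h1, h2⟩ := hu.tendsto_components hA₀ hA
  have hph := tendsto_phase (h := h) hT
  have hexp : ∀ x : ℝ, exp (I * (((∫ t in (0 : ℝ)..x, p t) -
      x * (PhiF m c (E - V₀) / c)) / h : ℝ)) *
      exp (-(((-1 : ℝ) : ℂ) * I / (h * c) * (PhiF m c (E - V₀) : ℝ) * x)) =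
      relPhase h p x * exp (-(I * ((∫ t in (0 : ℝ)..x, p t) / h : ℝ))) := by
    intro x
    rw [relPhase, ← Complex.exp_add, ← Complex.exp_add]
    congr 1
    push_cast
    ring
  have h4 := hph.mul h2
  have e1 : ((1 : ℂ) - ((-1 : ℝ) : ℂ)) / 2 = 1 := by push_cast; norm_num
  have e2 : ((1 : ℂ) + ((-1 : ℝ) : ℂ)) / 2 = 0 := by push_cast; norm_num
  rw [e1, mul_one] at h4
  rw [e2] at h1
  refine ⟨?_, h4.congr fun x => ?_⟩
  · rw [tendsto_zero_iff_norm_tendsto_zero] at h1 ⊢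
    refine h1.congr fun x => ?_
    have h5 : ‖exp (-(((-1 : ℝ) : ℂ) * I / (h * c) * (PhiF m c (E - V₀) : ℝ) * x))‖ = 1 := by
      have h6 : -(((-1 : ℝ) : ℂ) * I / (h * c) * (PhiF m c (E - V₀) : ℝ) * x) =
          I * (PhiF m c (E - V₀) / (h * c) * x : ℝ) := by
        push_cast; ring
      rw [h6, norm_exp_I_mul]
    rw [norm_mul, h5, mul_one, ampRight, mul_div_assoc, norm_mul, norm_exp_neg_I_mul, one_mul]
  · rw [ampLeft]
    linear_combination ((u x).1 / A x - A x * (u x).2) / 2 * hexp x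

end JostCond

lemma ampRight_comb {h : ℝ} {A p : ℝ → ℝ} {u v w : ℝ → ℂ × ℂ} {k l : ℂ}
    (H : ∀ x, u x = k • v x + l • w x) (x : ℝ) :
    ampRight h A p u x = k * ampRight h A p v x + l * ampRight h A p w x := by
  simp only [ampRight, H x, Prod.fst_add, Prod.snd_add, Prod.smul_fst, Prod.smul_snd, smul_eq_mul]
  ring

lemma ampLeft_comb {h : ℝ} {A p : ℝ → ℝ} {u v w : ℝ → ℂ × ℂ} {k l : ℂ}
    (H : ∀ x, u x = k • v x + l • w x) (x : ℝ) :
    ampLeft h A p u x = k * ampLeft h A p v x + l * ampLeft h A p w x := by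
  simp only [ampLeft, H x, Prod.fst_add, Prod.snd_add, Prod.smul_fst, Prod.smul_snd, smul_eq_mul]
  ring

/-- **Total transmission** (Theorem 2.7).  Under assumption (A), `m ≥ 0`, `E` in
region I (`V⁺ + mc² < E`), and `m²c⁴ − (V(x)−E)²` having no zeros, there are a
classical analytic symbol `φ` of non-negative order and a constant `C > 0` with
`s₁₁ = s₂₂ = (1 + hφ(h)) e^{i T̃(E)/h}`, `s₂₁ = O(e^{−C/h})`, `s₁₂ = O(e^{−C/h})`,
where `T̃(E) = ∫_{−∞}^0 Q⁻ + ∫_0^{∞} Q⁺`. -/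
theorem total_transmission
    (m c Vm Vp E : ℝ) (V : ℂ → ℂ)
    (hA : AssumptionA V Vm Vp) (hm : 0 ≤ m) (hc : 0 < c)
    (hE : Vp + m * c ^ 2 < E)
    (hnozero : ∀ x : ℝ, m ^ 2 * c ^ 4 - ((V x).re - E) ^ 2 ≠ 0)
    (ωinm ωinp ωoutp ωoutm : ℝ → ℝ → ℂ × ℂ)
    (S : ℝ → Matrix (Fin 2) (Fin 2) ℂ)
    (hsol : ∀ h : ℝ, 0 < h →
      IsDiracSolution h m c V E (ωinm h) ∧ IsDiracSolution h m c V E (ωinp h) ∧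
      IsDiracSolution h m c V E (ωoutp h) ∧ IsDiracSolution h m c V E (ωoutm h))
    (hjost : ∀ h : ℝ, 0 < h →
      JostCond h m c E Vm 1 1 atBot (ωinm h) ∧
      JostCond h m c E Vp (-1) (-1) atTop (ωinp h) ∧
      JostCond h m c E Vp 1 1 atTop (ωoutp h) ∧
      JostCond h m c E Vm (-1) (-1) atBot (ωoutm h))
    (hScat : ∀ h : ℝ, 0 < h → ScatRel (ωinm h) (ωinp h) (ωoutp h) (ωoutm h) (S h)) :
    ∃ φ : ℝ → ℂ, IsCAS φ ∧ ∃ C > (0 : ℝ), ∃ K : ℝ,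
      ∃ h₀ > (0 : ℝ), ∀ h : ℝ, 0 < h → h < h₀ →
        (S h 0 0 = S h 1 1 ∧
          S h 0 0 = (1 + (h : ℂ) * φ h)
            * Complex.exp (Complex.I
              * ((((∫ t in Set.Iic (0:ℝ), Qsym m c E Vm V t)
                  + (∫ t in Set.Ici (0:ℝ), Qsym m c E Vp V t) : ℝ)) : ℂ) / (h : ℂ))) ∧
        ‖S h 1 0‖ ≤ K * Real.exp (-C / h) ∧ ‖S h 0 1‖ ≤ K * Real.exp (-C / h) := by
  obtain ⟨κ, L, C, w, hV⟩ := hA.exists_potentialBounds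
  obtain ⟨ν, hν, hgap⟩ := hV.exists_gap hA.lt hE hnozero
  obtain ⟨κ', G, p₀, hD⟩ := hV.exists_wkbData hm hc hν hgap
  have hF := hV.diracFrame hA.lt hm hc hE hν hgap
  set Tm := ∫ t in Iic (0 : ℝ), Qsym m c E Vm V t
  set Tp := ∫ t in Ici (0 : ℝ), Qsym m c E Vp V t
  obtain ⟨K, hK, M, hM, a, ha, hexp⟩ := hD.exists_gevrey_expansion
    (hV.dirCoupling_ofReal m c E) (hV.dirMomentum_ofReal hm hc hν hgap)
    (hV.abs_realMomentum_le m c E)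
  have hscat : ∀ h : ℝ, 0 < h → S h 0 0 = S h 1 1 ∧ ∀ N : ℕ,
      ‖S h 0 0 * exp (-(I * ((Tm + Tp) / h : ℝ))) -
        (1 + ∑ k ∈ Finset.range N, a k * (h : ℂ) ^ (k + 1))‖ ≤
          (1 + M) * M * ((K * h) ^ N * (N.factorial : ℝ)) ∧
      ‖S h 1 0‖ ≤ M * ((K * h) ^ N * (N.factorial : ℝ)) ∧
      ‖S h 0 1‖ ≤ M * ((K * h) ^ N * (N.factorial : ℝ)) := by
    intro h hh
    obtain ⟨s1, s4, s3, s2⟩ := hsol h hh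
    obtain ⟨j1, j4, j3, j2⟩ := hjost h hh
    obtain ⟨r1, r4⟩ := hScat h hh
    have l1 := j1.tendsto_right hF.Am_pos hF.A_atBot hF.action_atBot
    have l2 := j2.tendsto_left hF.Am_pos hF.A_atBot hF.action_atBot
    have l3 := j3.tendsto_right hF.Ap_pos hF.A_atTop hF.action_atTop
    have l4 := j4.tendsto_left hF.Ap_pos hF.A_atTop hF.action_atTop
    have hstar : ∀ y : ℝ, exp (I * (-y / h : ℝ)) = star (exp (I * (y / h : ℝ))) := fun y => by
      rw [star_def, ← Complex.exp_conj, map_mul, conj_I, conj_ofReal]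
      congr 1
      push_cast
      ring
    rw [neg_neg] at l1
    rw [hstar] at l2 l3
    obtain ⟨hS, hN⟩ := scattering_estimate (unitPhase_relPhase h hF.p_cont)
      (ε := fun N => M * ((K * h) ^ N * (N.factorial : ℝ)))
      (P := fun N => 1 + ∑ k ∈ Finset.range N, a k * (h : ℂ) ^ (k + 1))
      (fun a b hab hla hlb => hexp h hh a b hab.left hab.right hla hlb)
      (norm_exp_I_mul _) (norm_exp_I_mul _)
      (hF.ampPair hh hc s1) (hF.ampPair hh hc s2) (hF.ampPair hh hc s3)
      l1.1 l1.2 l2.1 l2.2 l3.1 l3.2 l4.1 l4.2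
      (ampRight_comb r1) (ampLeft_comb r1) (ampRight_comb r4) (ampLeft_comb r4)
    refine ⟨hS, fun N => ⟨?_, (hN N).2⟩⟩
    have hph : exp (-(I * ((Tm + Tp) / h : ℝ))) =
        star (exp (I * (Tm / h : ℝ)) * exp (I * (Tp / h : ℝ))) := by
      rw [← Complex.exp_add, star_def, ← Complex.exp_conj, map_add, map_mul, map_mul, conj_I,
        conj_ofReal, conj_ofReal]
      congr 1
      push_cast
      ring
    rw [hph]
    refine (hN N).1.trans (le_of_eq ?_)
    simp
    ring
  obtain ⟨C₁, hC₁, K₁, hK₁⟩ := exists_exp_bound_of_gevrey hK hM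
  refine ⟨fun h => (S h 0 0 * exp (-(I * ((Tm + Tp) / h : ℝ))) - 1) / h,
    isCAS_of_gevrey (M := (1 + M) * M) hK (mul_nonneg (by linarith) hM) (fun k => (ha k).trans ?_)
      fun h hh N => ?_, C₁, hC₁, K₁, 1, one_pos, fun h hh hh1 => ⟨⟨(hscat h hh).1, ?_⟩, ?_, ?_⟩⟩
  · have h1 : 0 ≤ K ^ k * (k.factorial : ℝ) := by positivity
    nlinarith [mul_nonneg (mul_nonneg hM hM) h1]
  · have hh' : (h : ℂ) ≠ 0 := by exact_mod_cast hh.ne'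
    have h1 := ((hscat h hh).2 N).1
    have h2 : (S h 0 0 * exp (-(I * ((Tm + Tp) / h : ℝ))) - 1) / h -
        ∑ k ∈ Finset.range N, a k * (h : ℂ) ^ k =
        (1 / h : ℝ) * (S h 0 0 * exp (-(I * ((Tm + Tp) / h : ℝ))) -
          (1 + ∑ k ∈ Finset.range N, a k * (h : ℂ) ^ (k + 1))) := by
      have h3 : ∑ k ∈ Finset.range N, a k * (h : ℂ) ^ (k + 1) =
          h * ∑ k ∈ Finset.range N, a k * (h : ℂ) ^ k := by
        rw [Finset.mul_sum]
        exact Finset.sum_congr rfl fun k _ => by ring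
      rw [h3]
      push_cast
      field_simp
      ring
    rw [h2, norm_mul, Complex.norm_real, Real.norm_eq_abs, abs_of_pos (by positivity)]
    gcongr
  · have hh' : (h : ℂ) ≠ 0 := by exact_mod_cast hh.ne'
    have h1 : I * ((Tm + Tp : ℝ) : ℂ) / h = I * ((Tm + Tp) / h : ℝ) := by
      push_cast; ring
    rw [h1, mul_div_cancel₀ _ hh', add_sub_cancel, mul_assoc, ← Complex.exp_add, neg_add_cancel,
      Complex.exp_zero, mul_one]
  · exact hK₁ h hh hh1 _ fun N => ((hscat h hh).2 N).2.1
  · exact hK₁ h hh hh1 _ fun N => ((hscat h hh).2 N).2.2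
end

section
/- Existence of Jost solutions (Theorem 4.2, oscillatory case): Assume V satisfies assumption (A) and m ≥ 0. For every real E in region I, III, or V, the equation (H − E)u = 0 possesses four solutions ω_in^± and ω_out^± on ℝ with the exact asymptotic behavior ω_in^± ~ exp(∓(i/(hc))Φ(E−V^±)x)·(A(E−V^±), ∓A(E−V^±)^{−1})ᵀ as x → ±∞ and ω_out^± ~ exp(±(i/(hc))Φ(E−V^±)x)·(A(E−V^±), ±A(E−V^±)^{−1})ᵀ as x → ±∞, where Φ(λ) = sgn(λ)√(λ² − m²c⁴) and A(λ) = ((λ+mc²)/(λ−mc²))^{1/4} for λ ∉ [−mc², mc²]. -/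
open Complex Filter Topology MeasureTheory Set

theorem hasDerivAt_integral_Ioi {F : Type*} [NormedAddCommGroup F] [NormedSpace ℝ F]
    [CompleteSpace F] {f : ℝ → F} (hf : Continuous f) (hi : ∀ a, IntegrableOn f (Ioi a)) (x : ℝ) :
    HasDerivAt (fun y => ∫ t in Ioi y, f t) (-f x) x := by
  have h : (fun y => ∫ t in Ioi y, f t) = fun y => (∫ t in Ioi 0, f t) - ∫ t in (0 : ℝ)..y, f t := by
    funext y
    rw [← intervalIntegral.integral_interval_add_Ioi (hi 0) (hi y)]
    abel
  rw [h]
  exact (hf.integral_hasStrictDerivAt 0 x).hasDerivAt.const_sub _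

theorem tendsto_integral_Ioi_zero {F : Type*} [NormedAddCommGroup F] [NormedSpace ℝ F]
    {f : ℝ → F} (hi : ∀ a, IntegrableOn f (Ioi a)) :
    Tendsto (fun y => ∫ t in Ioi y, f t) atTop (𝓝 0) := by
  have h : (fun y => ∫ t in Ioi y, f t) = fun y => (∫ t in Ioi 0, f t) - ∫ t in (0 : ℝ)..y, f t := by
    funext y
    rw [← intervalIntegral.integral_interval_add_Ioi (hi 0) (hi y)]
    abel
  rw [h]
  simpa using (intervalIntegral_tendsto_integral_Ioi 0 (hi 0) tendsto_id).const_sub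
    (∫ t in Ioi 0, f t)

/-- A linear system with a coefficient integrable at `+∞` has a global solution with any
prescribed limit at `+∞`. -/
theorem exists_linear_ode_tendsto_atTop {F : Type*} [NormedAddCommGroup F] [NormedSpace ℝ F]
    [CompleteSpace F] {R : ℝ → F →L[ℝ] F} (hR : Continuous R)
    (hi : ∀ a, IntegrableOn R (Ioi a)) (y₀ : F) :
    ∃ y : ℝ → F, (∀ x, HasDerivAt y (R x (y x)) x) ∧ Tendsto y atTop (𝓝 y₀) := by
  set ρ : ℝ → ℝ := fun x => ∫ t in Ioi x, ‖R t‖ with hρ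
  have hρd : ∀ x, HasDerivAt ρ (-‖R x‖) x :=
    hasDerivAt_integral_Ioi hR.norm fun a => (hi a).norm
  have hρ0 : Tendsto ρ atTop (𝓝 0) := tendsto_integral_Ioi_zero fun a => (hi a).norm
  have hρc : Continuous ρ := continuous_iff_continuousAt.2 fun x => (hρd x).continuousAt
  have hρn : ∀ x, 0 ≤ ρ x := fun x => integral_nonneg fun t => norm_nonneg _
  have hgd : ∀ x, HasDerivAt (fun t => -(Real.exp (2 * ρ t) / 2))
      (Real.exp (2 * ρ x) * ‖R x‖) x := fun x => by
    refine (((hρd x).const_mul 2).exp.div_const 2).neg.congr_deriv ?_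
    ring
  have hglim : Tendsto (fun t => -(Real.exp (2 * ρ t) / 2)) atTop (𝓝 (-(1 / 2))) := by
    have := (((hρ0.const_mul 2).rexp).div_const 2).neg
    simpa using this
  have hgi : ∀ x, IntegrableOn (fun t => Real.exp (2 * ρ t) * ‖R t‖) (Ioi x) := fun x =>
    integrableOn_Ioi_deriv_of_nonneg' (fun t _ => hgd t) (fun t _ => by positivity) hglim
  have hgint : ∀ x, ∫ t in Ioi x, Real.exp (2 * ρ t) * ‖R t‖ = (Real.exp (2 * ρ x) - 1) / 2 :=
    fun x => by
      rw [integral_Ioi_of_hasDerivAt_of_tendsto' (fun t _ => hgd t) (hgi x) hglim]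
      ring
  have hfc : ∀ w : BoundedContinuousFunction ℝ F,
      Continuous fun t => Real.exp (2 * ρ t) • R t (w t) := fun w =>
    (by fun_prop : Continuous fun t => Real.exp (2 * ρ t)).smul (hR.clm_apply w.continuous)
  have hfn : ∀ (w : BoundedContinuousFunction ℝ F) t,
      ‖Real.exp (2 * ρ t) • R t (w t)‖ ≤ (Real.exp (2 * ρ t) * ‖R t‖) * ‖w‖ := fun w t => by
    rw [norm_smul, Real.norm_of_nonneg (Real.exp_nonneg _), mul_assoc]
    gcongr
    exact (R t).le_opNorm_of_le (w.norm_coe_le_norm t)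
  have hfi : ∀ (w : BoundedContinuousFunction ℝ F) a,
      IntegrableOn (fun t => Real.exp (2 * ρ t) • R t (w t)) (Ioi a) := fun w a =>
    Integrable.mono' ((hgi a).mul_const ‖w‖) (hfc w).aestronglyMeasurable
      (Eventually.of_forall (hfn w))
  have hfint : ∀ (w : BoundedContinuousFunction ℝ F) x,
      ‖∫ t in Ioi x, Real.exp (2 * ρ t) • R t (w t)‖ ≤ (Real.exp (2 * ρ x) - 1) / 2 * ‖w‖ :=
    fun w x => by
      rw [← hgint, ← integral_mul_const]
      exact norm_integral_le_of_norm_le ((hgi x).mul_const ‖w‖) (Eventually.of_forall (hfn w))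
  have hEw : ∀ (w : BoundedContinuousFunction ℝ F) x,
      ‖Real.exp (-(2 * ρ x)) • ∫ t in Ioi x, Real.exp (2 * ρ t) • R t (w t)‖ ≤ ‖w‖ / 2 :=
    fun w x => by
      rw [norm_smul, Real.norm_of_nonneg (Real.exp_nonneg _)]
      calc _ ≤ Real.exp (-(2 * ρ x)) * ((Real.exp (2 * ρ x) - 1) / 2 * ‖w‖) := by
            gcongr; exact hfint w x
        _ = (1 - Real.exp (-(2 * ρ x))) / 2 * ‖w‖ := by
            have : Real.exp (-(2 * ρ x)) * Real.exp (2 * ρ x) = 1 := by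
              rw [← Real.exp_add]; simp
            linear_combination ‖w‖ / 2 * this
        _ ≤ _ := by nlinarith [norm_nonneg w, Real.exp_nonneg (-(2 * ρ x))]
  let T : BoundedContinuousFunction ℝ F → BoundedContinuousFunction ℝ F := fun w =>
    BoundedContinuousFunction.ofNormedAddCommGroup
      (fun x => Real.exp (-(2 * ρ x)) • (y₀ - ∫ t in Ioi x, Real.exp (2 * ρ t) • R t (w t)))
      ((by fun_prop : Continuous fun t => Real.exp (-(2 * ρ t))).smul
        (continuous_const.sub (continuous_iff_continuousAt.2 fun x =>
          (hasDerivAt_integral_Ioi (hfc w) (hfi w) x).continuousAt)))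
      (‖y₀‖ + ‖w‖ / 2) (fun x => by
        rw [smul_sub]
        refine (norm_sub_le _ _).trans (add_le_add ?_ (hEw w x))
        rw [norm_smul, Real.norm_of_nonneg (Real.exp_nonneg _)]
        exact mul_le_of_le_one_left (norm_nonneg _)
          (Real.exp_le_one_iff.2 (by linarith [hρn x])))
  have hT : ContractingWith (1 / 2) T := by
    refine ⟨by rw [← NNReal.coe_lt_coe]; norm_num, LipschitzWith.of_dist_le_mul fun v w => ?_⟩
    rw [BoundedContinuousFunction.dist_le (by positivity)]
    intro x
    have h1 : T v x - T w x = -(Real.exp (-(2 * ρ x)) •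
        ∫ t in Ioi x, Real.exp (2 * ρ t) • R t ((v - w) t)) := by
      simp only [T, BoundedContinuousFunction.coe_ofNormedAddCommGroup,
        BoundedContinuousFunction.coe_sub, Pi.sub_apply, map_sub, smul_sub]
      rw [integral_sub (hfi v x) (hfi w x), smul_sub]
      abel
    rw [dist_eq_norm, h1, norm_neg, dist_eq_norm]
    refine (hEw (v - w) x).trans_eq ?_
    push_cast
    ring
  obtain ⟨w, hw, -⟩ := hT.exists_fixedPoint 0 (edist_ne_top _ _)
  have hy : ∀ x, Real.exp (2 * ρ x) • w x =
      y₀ - ∫ t in Ioi x, Real.exp (2 * ρ t) • R t (w t) := fun x => by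
    have h1 : w x = Real.exp (-(2 * ρ x)) •
        (y₀ - ∫ t in Ioi x, Real.exp (2 * ρ t) • R t (w t)) := (DFunLike.congr_fun hw x).symm
    conv_lhs => rw [h1]
    rw [smul_smul, ← Real.exp_add]
    simp
  refine ⟨fun x => y₀ - ∫ t in Ioi x, Real.exp (2 * ρ t) • R t (w t), fun x => ?_, ?_⟩
  · have := (hasDerivAt_integral_Ioi (hfc w) (hfi w) x).const_sub y₀
    rw [neg_neg] at this
    refine this.congr_deriv ?_
    simp only [← hy x, map_smul]
  · simpa using (tendsto_integral_Ioi_zero (hfi w)).const_sub y₀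

theorem integrableOn_add_smul_const {G : Type*} [NormedAddCommGroup G] [NormedSpace ℂ G]
    {a b c d : ℝ → ℂ} {S : Set ℝ} (ha : IntegrableOn a S) (hb : IntegrableOn b S)
    (hc : IntegrableOn c S) (hd : IntegrableOn d S) (M₁ M₂ M₃ M₄ : G) :
    IntegrableOn (fun x => a x • M₁ + b x • M₂ + c x • M₃ + d x • M₄) S :=
  (((Integrable.smul_const ha M₁).add (Integrable.smul_const hb M₂)).add
    (Integrable.smul_const hc M₃)).add (Integrable.smul_const hd M₄)

/-- The scalar form of `exists_linear_ode_tendsto_atTop` for a system of two equations. -/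
theorem exists_linear_system_tendsto_atTop {a b c d : ℝ → ℂ} (ha : Continuous a)
    (hb : Continuous b) (hc : Continuous c) (hd : Continuous d)
    (hai : ∀ x, IntegrableOn a (Ioi x)) (hbi : ∀ x, IntegrableOn b (Ioi x))
    (hci : ∀ x, IntegrableOn c (Ioi x)) (hdi : ∀ x, IntegrableOn d (Ioi x)) (α₀ β₀ : ℂ) :
    ∃ α β : ℝ → ℂ, (∀ x, HasDerivAt α (a x * α x + b x * β x) x) ∧
      (∀ x, HasDerivAt β (c x * α x + d x * β x) x) ∧
      Tendsto α atTop (𝓝 α₀) ∧ Tendsto β atTop (𝓝 β₀) := by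
  let f₁ := ContinuousLinearMap.fst ℂ ℂ ℂ
  let f₂ := ContinuousLinearMap.snd ℂ ℂ ℂ
  let i₁ := ContinuousLinearMap.inl ℂ ℂ ℂ
  let i₂ := ContinuousLinearMap.inr ℂ ℂ ℂ
  let L : (ℂ × ℂ →L[ℂ] ℂ × ℂ) →L[ℝ] (ℂ × ℂ →L[ℝ] ℂ × ℂ) :=
    ContinuousLinearMap.restrictScalarsL ℂ (ℂ × ℂ) (ℂ × ℂ) ℝ ℝ
  let R : ℝ → (ℂ × ℂ →L[ℂ] ℂ × ℂ) := fun x =>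
    a x • i₁.comp f₁ + b x • i₁.comp f₂ + c x • i₂.comp f₁ + d x • i₂.comp f₂
  have hR : Continuous R := by fun_prop
  have hi : ∀ x, IntegrableOn R (Ioi x) := fun x =>
    integrableOn_add_smul_const (hai x) (hbi x) (hci x) (hdi x) _ _ _ _
  obtain ⟨y, hy, hlim⟩ := exists_linear_ode_tendsto_atTop (R := fun x => L (R x))
    (L.continuous.comp hR) (fun x => L.integrable_comp (hi x)) (α₀, β₀)
  refine ⟨fun x => (y x).1, fun x => (y x).2, fun x => ?_, fun x => ?_,
    (continuous_fst.tendsto _).comp hlim, (continuous_snd.tendsto _).comp hlim⟩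
  · refine ((hasFDerivAt_fst (𝕜 := ℝ) (p := y x)).comp_hasDerivAt x (hy x)).congr_deriv ?_
    simp [L, R, f₁, f₂, i₁, i₂]
  · refine ((hasFDerivAt_snd (𝕜 := ℝ) (p := y x)).comp_hasDerivAt x (hy x)).congr_deriv ?_
    simp [L, R, f₁, f₂, i₁, i₂]

/-- If `exp (i k x) (A, B)` solves `u₁' = i p u₂`, `u₂' = i q u₁`, then the system perturbed by
`r` has a global solution with this asymptotic behaviour at `+∞`. -/
theorem exists_perturbed_wave_atTop {r : ℝ → ℂ} (hr : Continuous r)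
    (hri : ∀ a, IntegrableOn r (Ioi a)) {p q A B : ℂ} {k : ℝ} (hA : A ≠ 0) (hB : B ≠ 0)
    (hp : k * A = p * B) (hq : k * B = q * A) :
    ∃ u v : ℝ → ℂ, (∀ x, HasDerivAt u (I * (p - r x) * v x) x) ∧
      (∀ x, HasDerivAt v (I * (q - r x) * u x) x) ∧
      Tendsto (fun x : ℝ => u x * exp (-(I * k * x))) atTop (𝓝 A) ∧
      Tendsto (fun x : ℝ => v x * exp (-(I * k * x))) atTop (𝓝 B) := by
  set s : ℂ := (A / B + B / A) / 2 with hs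
  set d : ℂ := (A / B - B / A) / 2 with hd
  let e : ℝ → ℂ := fun x => exp (I * k * x)
  let e' : ℝ → ℂ := fun x => exp (-(I * k * x))
  have hec : Continuous e := by fun_prop
  have hec' : Continuous e' := by fun_prop
  have hee : ∀ x, e x * e' x = 1 := fun x => by simp [e, e', ← exp_add]
  have hen : ∀ x, ‖e x‖ = 1 := fun x => by simp [e, norm_exp]
  have hen' : ∀ x, ‖e' x‖ = 1 := fun x => by simp [e', norm_exp]
  have hed : ∀ x, HasDerivAt e (I * k * e x) x := fun x => by
    refine (((hasDerivAt_id x).ofReal_comp).const_mul (I * (k : ℂ))).cexp.congr_deriv ?_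
    simp [e, mul_comm]
  have hed' : ∀ x, HasDerivAt e' (-(I * k) * e' x) x := fun x => by
    refine ((((hasDerivAt_id x).ofReal_comp).const_mul (I * (k : ℂ))).neg).cexp.congr_deriv ?_
    simp [e', mul_comm]
  have hbdd : ∀ {g : ℝ → ℂ} {C : ℝ}, Continuous g → (∀ x, ‖g x‖ ≤ C) →
      ∀ a, IntegrableOn (fun x => g x * r x) (Ioi a) := fun {g} C hg hC a =>
    Integrable.bdd_mul (hri a) hg.aestronglyMeasurable (Eventually.of_forall hC)
  obtain ⟨α, β, hα, hβ, hαl, hβl⟩ := exists_linear_system_tendsto_atTop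
    (a := fun x => (-I * s) * r x) (b := fun x => (-I * d * e' x ^ 2) * r x)
    (c := fun x => (I * d * e x ^ 2) * r x) (d := fun x => (I * s) * r x)
    (by fun_prop) (by fun_prop) (by fun_prop) (by fun_prop)
    (hbdd continuous_const fun _ => le_rfl)
    (hbdd (C := ‖d‖) (by fun_prop) fun x => by simp [hen'])
    (hbdd (C := ‖d‖) (by fun_prop) fun x => by simp [hen])
    (hbdd continuous_const fun _ => le_rfl) 1 0
  have hlim : Tendsto (fun x => β x * e' x ^ 2) atTop (𝓝 0) := by
    refine squeeze_zero_norm (fun x => ?_) (tendsto_zero_iff_norm_tendsto_zero.1 hβl)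
    simp [hen']
  refine ⟨fun x => A * (α x * e x + β x * e' x), fun x => B * (α x * e x - β x * e' x),
    fun x => ?_, fun x => ?_, ?_, ?_⟩
  · refine ((((hα x).mul (hed x)).add ((hβ x).mul (hed' x))).const_mul A).congr_deriv ?_
    have h1 : A * s - A * d = B := by rw [hs, hd]; field_simp; ring
    linear_combination (I * (α x * e x - β x * e' x)) * hp
      - (r x * I * (α x * e x - β x * e' x)) * h1
      + (r x * I * A * d * (e x * α x - e' x * β x)) * hee x
  · refine ((((hα x).mul (hed x)).sub ((hβ x).mul (hed' x))).const_mul B).congr_deriv ?_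
    have h1 : B * s + B * d = A := by rw [hs, hd]; field_simp; ring
    linear_combination (I * (α x * e x + β x * e' x)) * hq
      - (r x * I * (α x * e x + β x * e' x)) * h1
      - (r x * I * B * d * (e x * α x + e' x * β x)) * hee x
  · have := (hαl.add hlim).const_mul A
    rw [add_zero, mul_one] at this
    refine this.congr fun x => ?_
    change _ = A * (α x * e x + β x * e' x) * e' x
    linear_combination (-A * α x) * hee x
  · have := (hαl.sub hlim).const_mul B
    rw [sub_zero, mul_one] at this
    refine this.congr fun x => ?_
    change _ = B * (α x * e x - β x * e' x) * e' x
    linear_combination (-B * α x) * hee x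

/-- The counterpart of `exists_perturbed_wave_atTop` at `-∞`. -/
theorem exists_perturbed_wave_atBot {r : ℝ → ℂ} (hr : Continuous r)
    (hri : ∀ a, IntegrableOn r (Iio a)) {p q A B : ℂ} {k : ℝ} (hA : A ≠ 0) (hB : B ≠ 0)
    (hp : k * A = p * B) (hq : k * B = q * A) :
    ∃ u v : ℝ → ℂ, (∀ x, HasDerivAt u (I * (p - r x) * v x) x) ∧
      (∀ x, HasDerivAt v (I * (q - r x) * u x) x) ∧
      Tendsto (fun x : ℝ => u x * exp (-(I * k * x))) atBot (𝓝 A) ∧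
      Tendsto (fun x : ℝ => v x * exp (-(I * k * x))) atBot (𝓝 B) := by
  obtain ⟨u, v, hu, hv, hul, hvl⟩ := exists_perturbed_wave_atTop (r := fun x => r (-x))
    (by fun_prop) (fun a => (hri (-a)).comp_neg_Ioi) (p := p) (q := q) (A := A) (B := -B)
    (k := -k) hA (neg_ne_zero.2 hB) (by push_cast; linear_combination -hp)
    (by push_cast; linear_combination hq)
  refine ⟨fun x => u (-x), fun x => -v (-x), fun x => ?_, fun x => ?_, ?_, ?_⟩
  · refine (HasDerivAt.scomp x (hu (-x)) (hasDerivAt_neg x)).congr_deriv ?_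
    simp
  · refine (HasDerivAt.scomp x (hv (-x)) (hasDerivAt_neg x)).neg.congr_deriv ?_
    simp
  · refine (hul.comp tendsto_neg_atBot_atTop).congr fun x => ?_
    simp
  · rw [← neg_neg B]
    refine (hvl.comp tendsto_neg_atBot_atTop).neg.congr fun x => ?_
    simp

/-- Decay like `⟨x⟩^{-δ}` with `δ > 1` gives integrability at `+∞`. -/
theorem integrableOn_Ioi_of_norm_le_japanese {f : ℝ → ℂ} (hf : Continuous f) {C R δ : ℝ}
    (hδ : 1 < δ) (h : ∀ x, R ≤ x → ‖f x‖ ≤ C * (1 + ‖x‖ ^ 2) ^ (-(δ / 2))) (a : ℝ) :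
    IntegrableOn f (Ioi a) := by
  have hJ : Integrable fun x : ℝ => C * (1 + ‖x‖ ^ 2) ^ (-(δ / 2)) := by
    have := (integrable_rpow_neg_one_add_norm_sq (E := ℝ) (μ := volume) (r := δ)
      (by simpa using hδ)).const_mul C
    simpa only [neg_div] using this
  have hRi : IntegrableOn f (Ioi R) :=
    Integrable.mono' hJ.integrableOn hf.aestronglyMeasurable
      ((ae_restrict_mem measurableSet_Ioi).mono fun x hx => h x (le_of_lt hx))
  refine ((hf.integrableOn_Ioc (a := a) (b := R)).union hRi).mono_set fun x hx => ?_
  rcases le_or_gt x R with hxR | hxR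
  exacts [Or.inl ⟨hx, hxR⟩, Or.inr hxR]

theorem ampF_pos {m c lam : ℝ} (h : m * c ^ 2 < |lam|) (hm : 0 ≤ m * c ^ 2) :
    0 < AmpF m c lam := by
  refine Real.rpow_pos_of_pos ?_ _
  rcases lt_abs.1 h with h | h
  · exact div_pos (by linarith) (by linarith)
  · exact div_pos_of_neg_of_neg (by linarith) (by linarith)

theorem phiF_mul_ampF {m c lam : ℝ} (h : m * c ^ 2 < |lam|) (hm : 0 ≤ m * c ^ 2) :
    PhiF m c lam * AmpF m c lam = (lam + m * c ^ 2) * (AmpF m c lam)⁻¹ ∧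
      PhiF m c lam * (AmpF m c lam)⁻¹ = (lam - m * c ^ 2) * AmpF m c lam := by
  have hpos := ampF_pos h hm
  have hsq : AmpF m c lam ^ 2 = √((lam + m * c ^ 2) / (lam - m * c ^ 2)) := by
    rw [AmpF, ← Real.rpow_natCast, ← Real.rpow_mul, Real.sqrt_eq_rpow]
    · norm_num
    · rcases lt_abs.1 h with h | h
      · exact (div_pos (by linarith) (by linarith)).le
      · exact (div_pos_of_neg_of_neg (by linarith) (by linarith)).le
  have hfac : lam ^ 2 - m ^ 2 * c ^ 4 = (lam + m * c ^ 2) * (lam - m * c ^ 2) := by ring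
  have key : PhiF m c lam * AmpF m c lam ^ 2 = lam + m * c ^ 2 ∧
      PhiF m c lam = (lam - m * c ^ 2) * AmpF m c lam ^ 2 := by
    rw [hsq, PhiF, hfac]
    rcases lt_abs.1 h with h | h
    · rw [Real.sign_of_pos (by linarith), Real.sqrt_mul (by linarith),
        Real.sqrt_div (by linarith)]
      have h1 : 0 < √(lam - m * c ^ 2) := Real.sqrt_pos.2 (by linarith)
      have h2 := Real.sq_sqrt (show 0 ≤ lam - m * c ^ 2 by linarith)
      have h3 := Real.sq_sqrt (show 0 ≤ lam + m * c ^ 2 by linarith)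
      constructor
      · field_simp
        linarith
      · field_simp
        linear_combination √(lam + m * c ^ 2) * h2
    · rw [Real.sign_of_neg (by linarith), ← neg_mul_neg (lam + m * c ^ 2),
        ← neg_div_neg_eq (lam + m * c ^ 2), Real.sqrt_mul (by linarith),
        Real.sqrt_div (by linarith)]
      have h1 : 0 < √(-(lam - m * c ^ 2)) := Real.sqrt_pos.2 (by linarith)
      have h2 := Real.sq_sqrt (show 0 ≤ -(lam - m * c ^ 2) by linarith)
      have h3 := Real.sq_sqrt (show 0 ≤ -(lam + m * c ^ 2) by linarith)
      constructor
      · field_simp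
        linarith
      · field_simp
        linear_combination -√(-(lam + m * c ^ 2)) * h2
  constructor
  · field_simp
    linarith [key.1]
  · field_simp
    linarith [key.2]

theorem isDiracSolution_of_hasDerivAt {h m c V₀ E : ℝ} (hh : h ≠ 0) (hc : c ≠ 0) {V : ℂ → ℂ}
    {u v : ℝ → ℂ}
    (hu : ∀ x : ℝ, HasDerivAt u (I * (((E - V₀ + m * c ^ 2) / (h * c) : ℝ)
      - (V x - V₀) / (h * c)) * v x) x)
    (hv : ∀ x : ℝ, HasDerivAt v (I * (((E - V₀ - m * c ^ 2) / (h * c) : ℝ)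
      - (V x - V₀) / (h * c)) * u x) x) :
    IsDiracSolution h m c V E fun x => (u x, v x) := by
  have hh' : (h : ℂ) ≠ 0 := by exact_mod_cast hh
  have hc' : (c : ℂ) ≠ 0 := by exact_mod_cast hc
  refine ⟨fun x => (hu x).differentiableAt, fun x => (hv x).differentiableAt,
    fun x => ?_, fun x => ?_⟩
  · simp only [(hv x).deriv]
    push_cast
    field_simp
    linear_combination (E - V x - m * c ^ 2) * u x * -I_sq
  · simp only [(hu x).deriv]
    push_cast
    field_simp
    linear_combination (E - V x + m * c ^ 2) * v x * -I_sq

theorem exists_jost_solution {h m c V₀ E s : ℝ} (hh : 0 < h) (hc : 0 < c) (hm : 0 ≤ m)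
    {V : ℂ → ℂ} (hV : Continuous fun x : ℝ => V x) (hs : s ^ 2 = 1)
    (hE : m * c ^ 2 < |E - V₀|) {l : Filter ℝ}
    (hl : (l = atTop ∧ ∀ a, IntegrableOn (fun x : ℝ => V x - V₀) (Ioi a)) ∨
      (l = atBot ∧ ∀ a, IntegrableOn (fun x : ℝ => V x - V₀) (Iio a))) :
    ∃ u, IsDiracSolution h m c V E u ∧ JostCond h m c E V₀ s s l u := by
  have hm' : 0 ≤ m * c ^ 2 := by positivity
  have hA := ampF_pos hE hm'
  obtain ⟨h1, h2⟩ := phiF_mul_ampF hE hm'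
  set A := AmpF m c (E - V₀) with hAdef
  set k := s * PhiF m c (E - V₀) / (h * c) with hk
  have hs0 : s ≠ 0 := fun h0 => by simp [h0] at hs
  have hA0 : (A : ℂ) ≠ 0 := by exact_mod_cast hA.ne'
  have hB0 : (s : ℂ) * (A : ℂ)⁻¹ ≠ 0 := mul_ne_zero (by exact_mod_cast hs0) (inv_ne_zero hA0)
  have hp : (k : ℂ) * A = ((E - V₀ + m * c ^ 2) / (h * c) : ℝ) * (s * (A : ℂ)⁻¹) := by
    have : k * A = (E - V₀ + m * c ^ 2) / (h * c) * (s * A⁻¹) := by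
      rw [hk]; linear_combination s / (h * c) * h1
    exact_mod_cast this
  have hq : (k : ℂ) * (s * (A : ℂ)⁻¹) = ((E - V₀ - m * c ^ 2) / (h * c) : ℝ) * A := by
    have : k * (s * A⁻¹) = (E - V₀ - m * c ^ 2) / (h * c) * A := by
      rw [hk]
      linear_combination s ^ 2 / (h * c) * h2 + (E - V₀ - m * c ^ 2) / (h * c) * A * hs
    exact_mod_cast this
  have hr : Continuous fun x : ℝ => (V x - V₀) / (h * c) :=
    (hV.sub continuous_const).div_const _
  have hθ : (s : ℂ) * I / (h * c) * (PhiF m c (E - V₀) : ℝ) = I * k := by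
    rw [hk]; push_cast; ring
  rcases hl with ⟨rfl, hi⟩ | ⟨rfl, hi⟩
  · obtain ⟨u, v, hu, hv, hul, hvl⟩ := exists_perturbed_wave_atTop hr
      (fun a => Integrable.div_const (hi a) _) hA0 hB0 hp hq
    refine ⟨_, isDiracSolution_of_hasDerivAt hh.ne' hc.ne' hu hv, ?_⟩
    rw [JostCond, hθ]
    exact ⟨hul, hvl⟩
  · obtain ⟨u, v, hu, hv, hul, hvl⟩ := exists_perturbed_wave_atBot hr
      (fun a => Integrable.div_const (hi a) _) hA0 hB0 hp hq
    refine ⟨_, isDiracSolution_of_hasDerivAt hh.ne' hc.ne' hu hv, ?_⟩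
    rw [JostCond, hθ]
    exact ⟨hul, hvl⟩

theorem AssumptionA.continuous_and_integrableOn {V : ℂ → ℂ} {Vm Vp : ℝ}
    (hA : AssumptionA V Vm Vp) : (Continuous fun x : ℝ => V x) ∧
      (∀ a, IntegrableOn (fun x : ℝ => V x - Vm) (Iio a)) ∧
      ∀ a, IntegrableOn (fun x : ℝ => V x - Vp) (Ioi a) := by
  obtain ⟨ε, hε, η, hη, δ, hδ, han, ⟨C, R, hp⟩, ⟨C', R', hn⟩⟩ := hA.sector
  have hmem : ∀ x : ℝ, (x : ℂ) ∈ Sector ε η := fun x => by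
    simp only [Sector, mem_ofPred_eq, ofReal_im, ofReal_re, abs_zero]
    positivity
  have hc : Continuous fun x : ℝ => V x := continuous_iff_continuousAt.2 fun x =>
    (han x (hmem x)).continuousAt.comp (f := fun x : ℝ => (x : ℂ)) continuous_ofReal.continuousAt
  refine ⟨hc, fun a => ?_, integrableOn_Ioi_of_norm_le_japanese (hc.sub continuous_const) hδ
    fun x hx => by simpa using hp x (hmem x) (by simpa using hx)⟩
  have := integrableOn_Ioi_of_norm_le_japanese (f := fun x : ℝ => V (-x : ℝ) - Vm) (C := C')
    (R := R') (δ := δ) ((hc.comp continuous_neg).sub continuous_const) hδ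
    (fun x hx => by simpa using hn (-x : ℝ) (hmem _) (by simpa using hx)) (-a)
  simpa using this.comp_neg_Iio

/-- **Existence of Jost solutions, oscillatory case** (Theorem 4.2, part 1).
Under assumption (A), `m ≥ 0`, and `E` in region I, III or V, for every `h > 0`
the equation `(H−E)u = 0` has four solutions `ω_in^±`, `ω_out^±` with
`ω_in^± ~ exp(∓(i/(hc))Φ(E−V^±)x)(A(E−V^±), ∓A(E−V^±)⁻¹)` and
`ω_out^± ~ exp(±(i/(hc))Φ(E−V^±)x)(A(E−V^±), ±A(E−V^±)⁻¹)` as `x → ±∞`. -/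
theorem jost_solutions_oscillatory
    (m c Vm Vp E : ℝ) (V : ℂ → ℂ)
    (hA : AssumptionA V Vm Vp) (hm : 0 ≤ m) (hc : 0 < c)
    (hE : (Vp + m * c ^ 2 < E) ∨
      (Vm + m * c ^ 2 < E ∧ E < Vp - m * c ^ 2) ∨
      (E < Vm - m * c ^ 2)) :
    ∀ h : ℝ, 0 < h →
      ∃ ωinm ωinp ωoutp ωoutm : ℝ → ℂ × ℂ,
        IsDiracSolution h m c V E ωinm ∧ IsDiracSolution h m c V E ωinp ∧
        IsDiracSolution h m c V E ωoutp ∧ IsDiracSolution h m c V E ωoutm ∧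
        JostCond h m c E Vm 1 1 atBot ωinm ∧
        JostCond h m c E Vp (-1) (-1) atTop ωinp ∧
        JostCond h m c E Vp 1 1 atTop ωoutp ∧
        JostCond h m c E Vm (-1) (-1) atBot ωoutm := by
  intro h hh
  have hmc : 0 ≤ m * c ^ 2 := by positivity
  have hlt := hA.lt
  obtain ⟨hV, hn, hp⟩ := hA.continuous_and_integrableOn
  have hEm : m * c ^ 2 < |E - Vm| := by
    rw [lt_abs]
    rcases hE with hE | ⟨hE, -⟩ | hE
    exacts [Or.inl (by linarith), Or.inl (by linarith), Or.inr (by linarith)]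
  have hEp : m * c ^ 2 < |E - Vp| := by
    rw [lt_abs]
    rcases hE with hE | ⟨-, hE⟩ | hE
    exacts [Or.inl (by linarith), Or.inr (by linarith), Or.inr (by linarith)]
  obtain ⟨u₁, h₁, h₁'⟩ := exists_jost_solution hh hc hm hV (one_pow 2) hEm (.inr ⟨rfl, hn⟩)
  obtain ⟨u₂, h₂, h₂'⟩ := exists_jost_solution hh hc hm hV neg_one_sq hEp (.inl ⟨rfl, hp⟩)
  obtain ⟨u₃, h₃, h₃'⟩ := exists_jost_solution hh hc hm hV (one_pow 2) hEp (.inl ⟨rfl, hp⟩)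
  obtain ⟨u₄, h₄, h₄'⟩ := exists_jost_solution hh hc hm hV neg_one_sq hEm (.inr ⟨rfl, hn⟩)
  exact ⟨u₁, u₂, u₃, u₄, h₁, h₂, h₃, h₄, h₁', h₂', h₃', h₄'⟩
end
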